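/- Let n ≥ 2 and let l be an integer with |l| ≥ 3. Every continuous, translation invariant valuation μ on ℂⁿ satisfying μ(gK) = (det g)^l μ(K) for all g ∈ U(n) and all convex bodies K is identically zero. -/

import Mathlib

open MeasureTheory
open scoped ENNReal

noncomputable section

/-- `ℂⁿ`, regarded as a real inner product space via `Re⟨z,w⟫`. -/
abbrev Cn (n : ℕ) := EuclideanSpace ℂ (Fin n)

/-- `μ` is a valuation: it is finitely additive on convex bodies of `ℂⁿ`. -/
def IsValuation {n : ℕ} (μ : ConvexBody (Cn n) → ℂ) : Prop :=
  ∀ K L U I : ConvexBody (Cn n),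
    (U : Set (Cn n)) = (K : Set (Cn n)) ∪ (L : Set (Cn n)) →
    (I : Set (Cn n)) = (K : Set (Cn n)) ∩ (L : Set (Cn n)) →
    μ U + μ I = μ K + μ L

/-- `μ` is translation invariant. -/
def TranslationInvariant {n : ℕ} (μ : ConvexBody (Cn n) → ℂ) : Prop :=
  ∀ (x : Cn n) (K L : ConvexBody (Cn n)),
    (L : Set (Cn n)) = (fun y => x + y) '' (K : Set (Cn n)) → μ L = μ K

/-- `μ` has weight `l` : `μ (g K) = (det g)^l • μ K` for all `g ∈ U(n)`. -/
def HasWeight {n : ℕ} (l : ℤ) (μ : ConvexBody (Cn n) → ℂ) : Prop :=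
  ∀ g ∈ Matrix.unitaryGroup (Fin n) ℂ, ∀ K L : ConvexBody (Cn n),
    (L : Set (Cn n)) = (Matrix.toEuclideanLin g) '' (K : Set (Cn n)) →
    μ L = (Matrix.det g) ^ l * μ K

namespace UVal

open Set Metric Filter Topology
open scoped RealInnerProductSpace NNReal Pointwise

section Bodies

variable {E : Type*} [NormedAddCommGroup E] [InnerProductSpace ℝ E]

/-- The support function of a convex body. -/
def supp (K : ConvexBody E) (u : E) : ℝ := sSup ((fun x : E => ⟪x, u⟫) '' (K : Set E))

lemma bddAbove_inner (K : ConvexBody E) (u : E) :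
    BddAbove ((fun x : E => ⟪x, u⟫) '' (K : Set E)) :=
  (K.isCompact.image (by fun_prop)).bddAbove

lemma inner_le_supp {K : ConvexBody E} {x : E} (hx : x ∈ (K : Set E)) (u : E) :
    ⟪x, u⟫ ≤ supp K u :=
  le_csSup (bddAbove_inner K u) (mem_image_of_mem _ hx)

lemma supp_le {K : ConvexBody E} {u : E} {a : ℝ} (h : ∀ x ∈ (K : Set E), ⟪x, u⟫ ≤ a) :
    supp K u ≤ a :=
  csSup_le (K.nonempty.image _) (by rintro _ ⟨x, hx, rfl⟩; exact h x hx)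

lemma exists_supp_eq (K : ConvexBody E) (u : E) : ∃ x ∈ (K : Set E), ⟪x, u⟫ = supp K u := by
  obtain ⟨x, hx, h⟩ := K.isCompact.exists_isMaxOn K.nonempty
    (f := fun x : E => ⟪x, u⟫) (by fun_prop)
  exact ⟨x, hx, le_antisymm (inner_le_supp hx u) (supp_le fun y hy => h hy)⟩

lemma supp_add (K L : ConvexBody E) (u : E) : supp (K + L) u = supp K u + supp L u := by
  apply le_antisymm
  · apply supp_le
    intro x hx
    rw [ConvexBody.coe_add] at hx
    obtain ⟨a, ha, b, hb, rfl⟩ := hx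
    rw [inner_add_left]
    exact add_le_add (inner_le_supp ha u) (inner_le_supp hb u)
  · obtain ⟨a, ha, h1⟩ := exists_supp_eq K u
    obtain ⟨b, hb, h2⟩ := exists_supp_eq L u
    rw [← h1, ← h2, ← inner_add_left]
    apply inner_le_supp
    rw [ConvexBody.coe_add]
    exact add_mem_add ha hb

lemma supp_smul (K : ConvexBody E) {t : ℝ} (ht : 0 ≤ t) (u : E) :
    supp (t • K) u = t * supp K u := by
  apply le_antisymm
  · apply supp_le
    intro x hx
    rw [ConvexBody.coe_smul] at hx
    obtain ⟨a, ha, rfl⟩ := hx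
    simp only [real_inner_smul_left]
    exact mul_le_mul_of_nonneg_left (inner_le_supp ha u) ht
  · obtain ⟨a, ha, h1⟩ := exists_supp_eq K u
    rw [← h1, ← real_inner_smul_left]
    apply inner_le_supp
    rw [ConvexBody.coe_smul]
    exact smul_mem_smul_set ha

lemma supp_smul_right (K : ConvexBody E) {t : ℝ} (ht : 0 ≤ t) (u : E) :
    supp K (t • u) = t * supp K u := by
  obtain ⟨a, ha, h1⟩ := exists_supp_eq K u
  obtain ⟨b, hb, h2⟩ := exists_supp_eq K (t • u)
  apply le_antisymm
  · rw [← h2, real_inner_smul_right]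
    exact mul_le_mul_of_nonneg_left (inner_le_supp hb u) ht
  · rw [← h1, ← real_inner_smul_right]
    exact inner_le_supp ha _

lemma supp_add_right_le (K : ConvexBody E) (u v : E) :
    supp K (u + v) ≤ supp K u + supp K v := by
  apply supp_le
  intro x hx
  rw [inner_add_right]
  exact add_le_add (inner_le_supp hx u) (inner_le_supp hx v)

@[simp] lemma supp_zero (u : E) : supp (0 : ConvexBody E) u = 0 := by
  obtain ⟨a, ha, h1⟩ := exists_supp_eq (0 : ConvexBody E) u
  have : a = 0 := by simpa using ha
  rw [← h1, this, inner_zero_left]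

lemma exists_bound (K : ConvexBody E) : ∃ R : ℝ, 0 ≤ R ∧ ∀ x ∈ (K : Set E), ‖x‖ ≤ R := by
  obtain ⟨R, hR⟩ := K.isBounded.exists_norm_le
  obtain ⟨x, hx⟩ := K.nonempty
  exact ⟨R, (norm_nonneg x).trans (hR x hx), hR⟩

lemma continuous_supp (K : ConvexBody E) : Continuous (supp K) := by
  obtain ⟨R, hR0, hR⟩ := exists_bound K
  refine LipschitzWith.continuous (K := ⟨R, hR0⟩) (LipschitzWith.of_le_add_mul _ fun u v => ?_)
  apply supp_le
  intro x hx
  have h1 : ⟪x, u⟫ = ⟪x, v⟫ + ⟪x, u - v⟫ := by rw [← inner_add_right]; congr 1; abel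
  have h2 : ⟪x, u - v⟫ ≤ R * ‖u - v‖ :=
    (real_inner_le_norm _ _).trans (mul_le_mul_of_nonneg_right (hR x hx) (norm_nonneg _))
  rw [h1, dist_eq_norm]
  exact add_le_add (inner_le_supp hx v) h2

lemma mem_iff_inner_le_supp [CompleteSpace E] (K : ConvexBody E) (x : E) :
    x ∈ (K : Set E) ↔ ∀ u : E, ‖u‖ = 1 → ⟪x, u⟫ ≤ supp K u := by
  refine ⟨fun hx u _ => inner_le_supp hx u, fun h => ?_⟩
  by_contra hx
  obtain ⟨f, a, hf, ha⟩ := geometric_hahn_banach_closed_point K.convex K.isClosed hx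
  set v := (InnerProductSpace.toDual ℝ E).symm f with hv
  have hfv : ∀ y, f y = ⟪y, v⟫ := fun y => by
    rw [real_inner_comm, hv, InnerProductSpace.toDual_symm_apply]
  have hv0 : v ≠ 0 := by
    intro h0
    obtain ⟨y, hy⟩ := K.nonempty
    have := hf y hy
    rw [hfv, h0, inner_zero_right] at this
    rw [hfv, h0, inner_zero_right] at ha
    linarith
  have hn : 0 < ‖v‖ := norm_pos_iff.2 hv0
  have h1 := h (‖v‖⁻¹ • v) (by rw [norm_smul, norm_inv, norm_norm, inv_mul_cancel₀ hn.ne'])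
  rw [supp_smul_right _ (by positivity), real_inner_smul_right] at h1
  have h2 : ⟪x, v⟫ ≤ supp K v := le_of_mul_le_mul_left h1 (by positivity)
  obtain ⟨y, hy, hy2⟩ := exists_supp_eq K v
  have := hf y hy
  rw [hfv] at this ha
  linarith

lemma supp_le_supp_iff [CompleteSpace E] (K L : ConvexBody E) :
    (K : Set E) ⊆ L ↔ ∀ u : E, ‖u‖ = 1 → supp K u ≤ supp L u := by
  constructor
  · intro h u _
    exact supp_le fun x hx => inner_le_supp (h hx) u
  · intro h x hx
    rw [mem_iff_inner_le_supp]
    exact fun u hu => (inner_le_supp hx u).trans (h u hu)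

lemma ext_supp [CompleteSpace E] {K L : ConvexBody E}
    (h : ∀ u : E, ‖u‖ = 1 → supp K u = supp L u) : K = L :=
  ConvexBody.ext (Subset.antisymm ((supp_le_supp_iff K L).2 fun u hu => (h u hu).le)
    ((supp_le_supp_iff L K).2 fun u hu => (h u hu).ge))

variable [FiniteDimensional ℝ E]

/-- The unit ball as a convex body. -/
def ballBody (E : Type*) [NormedAddCommGroup E] [InnerProductSpace ℝ E]
    [FiniteDimensional ℝ E] : ConvexBody E where
  carrier := closedBall 0 1
  convex' := convex_closedBall _ _
  isCompact' := isCompact_closedBall _ _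
  nonempty' := ⟨0, by simp⟩

lemma coe_ballBody : (ballBody E : Set E) = closedBall 0 1 := rfl

lemma supp_ballBody {u : E} (hu : ‖u‖ = 1) : supp (ballBody E) u = 1 := by
  apply le_antisymm
  · apply supp_le
    intro x hx
    rw [coe_ballBody, mem_closedBall_zero_iff] at hx
    have := real_inner_le_norm x u
    rw [hu, mul_one] at this
    exact this.trans hx
  · have : ⟪u, u⟫ = 1 := by rw [real_inner_self_eq_norm_sq, hu]; norm_num
    rw [← this]
    apply inner_le_supp
    rw [coe_ballBody, mem_closedBall_zero_iff, hu]

lemma dist_le_of_supp {K L : ConvexBody E} {ε : ℝ} (hε : 0 ≤ ε)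
    (h : ∀ u : E, ‖u‖ = 1 → |supp K u - supp L u| ≤ ε) : dist K L ≤ ε := by
  rw [← ConvexBody.hausdorffDist_coe]
  have key : ∀ K L : ConvexBody E, (∀ u : E, ‖u‖ = 1 → supp K u ≤ supp L u + ε) →
      ∀ x ∈ (K : Set E), ∃ y ∈ (L : Set E), dist x y ≤ ε := by
    intro K L h x hx
    have h1 : (K : Set E) ⊆ (L + ε • ballBody E : ConvexBody E) := by
      rw [supp_le_supp_iff]
      intro u hu
      rw [supp_add, supp_smul _ hε, supp_ballBody hu, mul_one]
      exact h u hu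
    have h2 := h1 hx
    rw [ConvexBody.coe_add, ConvexBody.coe_smul] at h2
    obtain ⟨y, hy, z, hz, rfl⟩ := h2
    obtain ⟨b, hb, rfl⟩ := hz
    refine ⟨y, hy, ?_⟩
    rw [coe_ballBody, mem_closedBall_zero_iff] at hb
    simp only [dist_eq_norm, add_sub_cancel_left, norm_smul, Real.norm_eq_abs, abs_of_nonneg hε]
    exact mul_le_of_le_one_right hε hb
  refine hausdorffDist_le_of_mem_dist hε (key K L fun u hu => ?_) (key L K fun u hu => ?_)
  · linarith [(abs_le.1 (h u hu)).2]
  · linarith [(abs_le.1 (h u hu)).1]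

omit [FiniteDimensional ℝ E] in
lemma supp_le_of_dist (K L : ConvexBody E) {u : E} (hu : ‖u‖ = 1) :
    |supp K u - supp L u| ≤ dist K L := by
  have key : ∀ K L : ConvexBody E, supp K u - supp L u ≤ dist K L := by
    intro K L
    obtain ⟨x, hx, hxe⟩ := exists_supp_eq K u
    obtain ⟨y, hy, hxy⟩ := L.isCompact.exists_infDist_eq_dist L.nonempty x
    have h1 : dist x y ≤ dist K L := by
      rw [← hxy, ← ConvexBody.hausdorffDist_coe]
      exact infDist_le_hausdorffDist_of_mem hx ConvexBody.hausdorffEDist_ne_top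
    have h2 : ⟪x, u⟫ - ⟪y, u⟫ ≤ dist x y := by
      rw [← inner_sub_left, dist_eq_norm]
      simpa [hu] using real_inner_le_norm (x - y) u
    linarith [inner_le_supp hy u]
  rw [abs_le]
  constructor
  · have := key L K
    rw [dist_comm] at this
    linarith
  · exact key K L

/-- A function bounded above on the sphere and touched from below by linear functions at every
point of the sphere is a support function. -/
lemma exists_body {ψ : E → ℝ}
    (hb : ∃ C, ∀ u : E, ‖u‖ = 1 → ψ u ≤ C)
    (h : ∀ u₀ : E, ‖u₀‖ = 1 → ∃ q : E, ⟪q, u₀⟫ = ψ u₀ ∧ ∀ u : E, ‖u‖ = 1 → ⟪q, u⟫ ≤ ψ u)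
    (hne : ∃ q : E, ∀ u : E, ‖u‖ = 1 → ⟪q, u⟫ ≤ ψ u) :
    ∃ K : ConvexBody E, ∀ u : E, ‖u‖ = 1 → supp K u = ψ u := by
  obtain ⟨C, hC⟩ := hb
  let S : Set E := {x | ∀ u : E, ‖u‖ = 1 → ⟪x, u⟫ ≤ ψ u}
  have hS : S = ⋂ u : E, ⋂ _ : ‖u‖ = 1, {x : E | ⟪x, u⟫ ≤ ψ u} := by
    ext x; simp [S]
  have hclosed : IsClosed S := by
    rw [hS]
    exact isClosed_iInter fun u => isClosed_iInter fun _ =>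
      isClosed_le (by fun_prop) continuous_const
  have hconv : Convex ℝ S := by
    intro x hx y hy a b ha hb hab u hu
    rw [inner_add_left, real_inner_smul_left, real_inner_smul_left]
    have h1 := mul_le_mul_of_nonneg_left (hx u hu) ha
    have h2 := mul_le_mul_of_nonneg_left (hy u hu) hb
    have h3 : a * ψ u + b * ψ u = ψ u := by rw [← add_mul, hab, one_mul]
    linarith
  have hbdd : S ⊆ closedBall 0 (max C 0) := by
    intro x hx
    rw [mem_closedBall_zero_iff]
    by_cases hx0 : x = 0
    · simp [hx0]
    have hn : 0 < ‖x‖ := norm_pos_iff.2 hx0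
    have hu : ‖(‖x‖⁻¹ • x)‖ = 1 := by rw [norm_smul, norm_inv, norm_norm, inv_mul_cancel₀ hn.ne']
    have h1 := (hx _ hu).trans (hC _ hu)
    rw [real_inner_smul_right, real_inner_self_eq_norm_sq, sq, inv_mul_cancel_left₀ hn.ne'] at h1
    exact h1.trans (le_max_left _ _)
  obtain ⟨q₀, hq₀⟩ := hne
  let K : ConvexBody E := ⟨S, hconv, (isCompact_closedBall _ _).of_isClosed_subset hclosed hbdd,
    ⟨q₀, hq₀⟩⟩
  refine ⟨K, fun u hu => le_antisymm (supp_le fun x hx => hx u hu) ?_⟩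
  obtain ⟨q, hq1, hq2⟩ := h u hu
  rw [← hq1]
  exact inner_le_supp (K := K) (show q ∈ S from hq2) u

/-- If `min` and `max` of two support functions are support functions, the corresponding bodies are
intersection and union. -/
lemma coe_inf_of_supp {K L I : ConvexBody E}
    (hI : ∀ u : E, ‖u‖ = 1 → supp I u = min (supp K u) (supp L u)) :
    (I : Set E) = (K : Set E) ∩ L := by
  ext x
  rw [mem_inter_iff, mem_iff_inner_le_supp, mem_iff_inner_le_supp, mem_iff_inner_le_supp]
  constructor
  · intro h
    exact ⟨fun u hu => (h u hu).trans ((hI u hu).trans_le (min_le_left _ _)),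
      fun u hu => (h u hu).trans ((hI u hu).trans_le (min_le_right _ _))⟩
  · rintro ⟨h1, h2⟩ u hu
    rw [hI u hu]
    exact le_min (h1 u hu) (h2 u hu)

omit [FiniteDimensional ℝ E] in
lemma supp_eq_of_sphere {K L U : ConvexBody E} {m : ℝ → ℝ → ℝ}
    (hm : ∀ t a b : ℝ, 0 ≤ t → m (t * a) (t * b) = t * m a b)
    (h : ∀ u : E, ‖u‖ = 1 → supp U u = m (supp K u) (supp L u)) (u : E) :
    supp U u = m (supp K u) (supp L u) := by
  have key : u = ‖u‖ • (‖u‖⁻¹ • u) := by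
    by_cases hu : u = 0
    · simp [hu]
    · rw [smul_smul, mul_inv_cancel₀ (norm_ne_zero_iff.2 hu), one_smul]
  by_cases hu : u = 0
  · have h0 : ∀ K : ConvexBody E, supp K 0 = 0 := fun K => by
      have := supp_smul_right K (le_refl (0 : ℝ)) 0
      simpa using this
    have := hm 0 0 0 le_rfl
    simp only [zero_mul] at this
    rw [hu, h0, h0, h0, this]
  · have hu1 : ‖(‖u‖⁻¹ • u)‖ = 1 := by
      rw [norm_smul, norm_inv, norm_norm, inv_mul_cancel₀ (norm_ne_zero_iff.2 hu)]
    rw [key, supp_smul_right _ (norm_nonneg _), supp_smul_right _ (norm_nonneg _),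
      supp_smul_right _ (norm_nonneg _), h _ hu1, hm _ _ _ (norm_nonneg _)]

lemma coe_sup_of_supp {K L U I : ConvexBody E}
    (hI : ∀ u : E, ‖u‖ = 1 → supp I u = min (supp K u) (supp L u))
    (hU : ∀ u : E, ‖u‖ = 1 → supp U u = max (supp K u) (supp L u)) :
    (U : Set E) = (K : Set E) ∪ L := by
  have hI' := supp_eq_of_sphere (m := min) (fun t a b ht => (mul_min_of_nonneg a b ht).symm) hI
  have hU' := supp_eq_of_sphere (m := max) (fun t a b ht => (mul_max_of_nonneg a b ht).symm) hU
  apply Subset.antisymm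
  · intro x hx
    by_contra hcon
    rw [mem_union, not_or, mem_iff_inner_le_supp, mem_iff_inner_le_supp] at hcon
    push Not at hcon
    obtain ⟨⟨u, -, hu⟩, v, -, hv⟩ := hcon
    let γ : ℝ → E := fun t => (1 - t) • u + t • v
    have hγ : Continuous γ := by fun_prop
    let A : Set ℝ := {t | supp K (γ t) < ⟪x, γ t⟫}
    let B : Set ℝ := {t | supp L (γ t) < ⟪x, γ t⟫}
    have hA : IsOpen A := isOpen_lt ((continuous_supp K).comp hγ) (by fun_prop)
    have hB : IsOpen B := isOpen_lt ((continuous_supp L).comp hγ) (by fun_prop)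
    have hcover : Icc (0 : ℝ) 1 ⊆ A ∪ B := by
      rintro t ⟨ht0, ht1⟩
      have h1 : supp I (γ t) < ⟪x, γ t⟫ := by
        have e1 : supp I (γ t) ≤ (1 - t) * supp I u + t * supp I v := by
          refine (supp_add_right_le _ _ _).trans_eq ?_
          rw [supp_smul_right _ (by linarith), supp_smul_right _ ht0]
        have e2 : supp I u < ⟪x, u⟫ := by rw [hI']; exact (min_le_left _ _).trans_lt hu
        have e3 : supp I v < ⟪x, v⟫ := by rw [hI']; exact (min_le_right _ _).trans_lt hv
        have e4 : ⟪x, γ t⟫ = (1 - t) * ⟪x, u⟫ + t * ⟪x, v⟫ := by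
          simp only [γ]
          rw [inner_add_right, real_inner_smul_right, real_inner_smul_right]
        rw [e4]
        refine e1.trans_lt ?_
        rcases eq_or_lt_of_le ht0 with h | h
        · rw [← h]; simpa using e2
        · have := mul_lt_mul_of_pos_left e3 h
          have := mul_le_mul_of_nonneg_left e2.le (by linarith : 0 ≤ 1 - t)
          linarith
      rw [hI', min_lt_iff] at h1
      exact h1
    have hdisj : Icc (0 : ℝ) 1 ∩ (A ∩ B) = ∅ := by
      rw [eq_empty_iff_forall_notMem]
      rintro t ⟨-, h1, h2⟩
      have h3 : ⟪x, γ t⟫ ≤ supp U (γ t) := inner_le_supp hx _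
      rw [hU'] at h3
      exact absurd h3 (not_le.2 (max_lt h1 h2))
    have := isPreconnected_Icc A B hA hB hcover
      ⟨0, by simp, by simpa [A, γ] using hu⟩ ⟨1, by simp, by simpa [B, γ] using hv⟩
    rw [hdisj] at this
    exact this.ne_empty rfl
  · rintro x (hx | hx)
    · rw [mem_iff_inner_le_supp]
      exact fun u hu => (inner_le_supp hx u).trans ((le_max_left _ _).trans_eq (hU u hu).symm)
    · rw [mem_iff_inner_le_supp]
      exact fun u hu => (inner_le_supp hx u).trans ((le_max_right _ _).trans_eq (hU u hu).symm)

end Bodies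

section Algebra

variable {E : Type*} [NormedAddCommGroup E] [InnerProductSpace ℝ E]

/-- Continuous translation invariant valuations. -/
structure IsVal (ν : ConvexBody E → ℂ) : Prop where
  add : ∀ K L U I : ConvexBody E, (U : Set E) = (K : Set E) ∪ L → (I : Set E) = (K : Set E) ∩ L →
    ν U + ν I = ν K + ν L
  cont : Continuous ν
  trans : ∀ (x : E) (K L : ConvexBody E), (L : Set E) = (fun y => x + y) '' (K : Set E) → ν L = ν K

lemma inter_add_eq {K L : ConvexBody E} (M : ConvexBody E)
    (h : Convex ℝ ((K : Set E) ∪ L)) :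
    ((K : Set E) ∩ L) + (M : Set E) = ((K : Set E) + M) ∩ ((L : Set E) + M) := by
  apply Subset.antisymm
  · exact inter_add_subset
  · rintro z ⟨⟨a, ha, m, hm, rfl⟩, ⟨b, hb, m', hm', hz⟩⟩
    simp only at hz
    let γ : ℝ → E := fun t => (1 - t) • a + t • b
    have hγ : Continuous γ := by fun_prop
    have hcover : Icc (0 : ℝ) 1 ⊆ γ ⁻¹' (K : Set E) ∪ γ ⁻¹' (L : Set E) := fun t ht =>
      h (Or.inl ha) (Or.inr hb) (by linarith [ht.2]) ht.1 (by ring)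
    obtain ⟨t, ht, htK, htL⟩ := isPreconnected_closed_iff.1 isPreconnected_Icc _ _
      (K.isClosed.preimage hγ) (L.isClosed.preimage hγ) hcover
      ⟨0, by simp, by simpa [γ] using ha⟩ ⟨1, by simp, by simpa [γ] using hb⟩
    refine ⟨γ t, ⟨htK, htL⟩, (1 - t) • m + t • m',
      M.convex hm hm' (by linarith [ht.2]) ht.1 (by ring), ?_⟩
    have h2 : m' = a + m - b := by rw [← hz]; abel
    simp only [γ, h2]
    module

lemma dist_add_le [FiniteDimensional ℝ E] (K K' L L' : ConvexBody E) :
    dist (K + L) (K' + L') ≤ dist K K' + dist L L' := by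
  refine dist_le_of_supp (by positivity) fun u hu => ?_
  rw [supp_add, supp_add]
  have h1 := supp_le_of_dist K K' hu
  have h2 := supp_le_of_dist L L' hu
  rw [abs_le] at *
  constructor <;> linarith

lemma continuous_add_body [FiniteDimensional ℝ E] :
    Continuous fun p : ConvexBody E × ConvexBody E => p.1 + p.2 := by
  refine LipschitzWith.continuous (K := 2) (LipschitzWith.of_dist_le_mul fun p q => ?_)
  refine (dist_add_le _ _ _ _).trans ?_
  have h1 : dist p.1 q.1 ≤ dist p q := le_max_left _ _
  have h2 : dist p.2 q.2 ≤ dist p q := le_max_right _ _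
  change _ ≤ (2 : ℝ) * dist p q
  linarith

lemma continuous_nsmul_body [FiniteDimensional ℝ E] (i : ℕ) :
    Continuous fun p : ConvexBody E => i • p := by
  induction i with
  | zero => simpa using continuous_const
  | succ i ih =>
    simp only [add_smul, one_smul]
    exact continuous_add_body.comp (ih.prodMk continuous_id)

lemma IsVal.shift [FiniteDimensional ℝ E] {ν : ConvexBody E → ℂ} (h : IsVal ν)
    (M : ConvexBody E) : IsVal fun K => ν (K + M) where
  add K L U I hU hI := by
    apply h.add
    · simp only [ConvexBody.coe_add, hU, union_add]
    · simp only [ConvexBody.coe_add, hI]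
      exact inter_add_eq M (hU ▸ U.convex)
  cont := h.cont.comp (continuous_add_body.comp (continuous_id.prodMk continuous_const))
  trans x K L hL := by
    apply h.trans x
    rw [ConvexBody.coe_add, ConvexBody.coe_add, hL, image_add_left, image_add_left]
    ext y
    simp only [mem_preimage, Set.mem_add]
    constructor
    · rintro ⟨a, ha, b, hb, rfl⟩
      exact ⟨-x + a, ha, b, hb, (add_assoc _ _ _)⟩
    · rintro ⟨a, ha, b, hb, hab⟩
      exact ⟨x + a, by simpa using ha, b, hb, by
        rw [add_assoc, show a + b = -x + y from hab]; abel⟩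

lemma supp_nsmul (k : ℕ) (K : ConvexBody E) (u : E) : supp (k • K) u = k * supp K u := by
  induction k with
  | zero => simp
  | succ k ih => rw [add_smul, one_smul, supp_add, ih]; push_cast; ring

lemma nsmul_body_eq [FiniteDimensional ℝ E] (k : ℕ) (K : ConvexBody E) :
    k • K = (k : ℝ) • K :=
  ext_supp fun u _ => by rw [supp_nsmul, supp_smul _ (Nat.cast_nonneg k)]

/-- The linear extension of a functional on bodies to formal combinations of bodies. -/
def pre (ν : ConvexBody E → ℂ) : AddMonoidAlgebra ℂ (ConvexBody E) →ₗ[ℂ] ℂ :=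
  Finsupp.linearCombination ℂ ν ∘ₗ (AddMonoidAlgebra.coeffLinearEquiv ℂ).toLinearMap

lemma pre_single (ν : ConvexBody E → ℂ) (K : ConvexBody E) (c : ℂ) :
    pre ν (AddMonoidAlgebra.single K c) = c * ν K := by
  simp [pre]

lemma pre_mul_single (ν : ConvexBody E → ℂ) (K : ConvexBody E) (c : ℂ)
    (a : AddMonoidAlgebra ℂ (ConvexBody E)) :
    pre ν (AddMonoidAlgebra.single K c * a) = c * pre (fun L => ν (L + K)) a := by
  induction a using AddMonoidAlgebra.induction_linear with
  | zero => simp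
  | add f g hf hg => rw [mul_add, map_add, hf, hg, map_add, mul_add]
  | single L d =>
    rw [AddMonoidAlgebra.single_mul_single, pre_single, pre_single, add_comm]
    ring

variable [FiniteDimensional ℝ E]

/-- Formal combinations of bodies on which all continuous translation invariant valuations
vanish. -/
def relIdeal (E : Type*) [NormedAddCommGroup E] [InnerProductSpace ℝ E]
    [FiniteDimensional ℝ E] : Ideal (AddMonoidAlgebra ℂ (ConvexBody E)) where
  carrier := {a | ∀ ν, IsVal ν → pre ν a = 0}
  add_mem' := fun ha hb ν hν => by rw [map_add, ha ν hν, hb ν hν, add_zero]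
  zero_mem' := fun ν _ => map_zero _
  smul_mem' := fun b a ha ν hν => by
    rw [smul_eq_mul]
    induction b using AddMonoidAlgebra.induction_linear with
    | zero => simp
    | add f g hf hg => rw [add_mul, map_add, hf, hg, add_zero]
    | single L d => rw [pre_mul_single, ha _ (hν.shift L), mul_zero]

/-- The algebra of convex bodies modulo all continuous translation invariant valuations. -/
def BodyAlg (E : Type*) [NormedAddCommGroup E] [InnerProductSpace ℝ E]
    [FiniteDimensional ℝ E] : Type _ := AddMonoidAlgebra ℂ (ConvexBody E) ⧸ relIdeal E

instance : CommRing (BodyAlg E) :=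
  inferInstanceAs (CommRing (AddMonoidAlgebra ℂ (ConvexBody E) ⧸ relIdeal E))

instance : Algebra ℂ (BodyAlg E) :=
  inferInstanceAs (Algebra ℂ (AddMonoidAlgebra ℂ (ConvexBody E) ⧸ relIdeal E))

/-- The quotient map onto the body algebra. -/
def toBodyAlg : AddMonoidAlgebra ℂ (ConvexBody E) →ₐ[ℂ] BodyAlg E :=
  Ideal.Quotient.mkₐ ℂ (relIdeal E)

lemma toBodyAlg_surjective : Function.Surjective (toBodyAlg (E := E)) :=
  Ideal.Quotient.mkₐ_surjective ℂ (relIdeal E)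

lemma toBodyAlg_eq_zero {a : AddMonoidAlgebra ℂ (ConvexBody E)} :
    toBodyAlg a = 0 ↔ a ∈ relIdeal E := Ideal.Quotient.eq_zero_iff_mem

/-- The class of a body. -/
def cls (K : ConvexBody E) : BodyAlg E := toBodyAlg (AddMonoidAlgebra.single K 1)

/-- The functional on the body algebra defined by a valuation. -/
def ev (ν : ConvexBody E → ℂ) (hν : IsVal ν) : BodyAlg E →ₗ[ℂ] ℂ :=
  Submodule.liftQ ((relIdeal E).restrictScalars ℂ) (pre ν) fun _ ha => ha ν hν

@[simp] lemma ev_cls {ν : ConvexBody E → ℂ} (hν : IsVal ν) (K : ConvexBody E) :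
    ev ν hν (cls K) = ν K := by
  have : ev ν hν (cls K) = pre ν (AddMonoidAlgebra.single K 1) := rfl
  rw [this, pre_single, one_mul]

lemma eq_zero_of_ev {x : BodyAlg E} (h : ∀ ν (hν : IsVal ν), ev ν hν x = 0) : x = 0 := by
  obtain ⟨a, rfl⟩ := toBodyAlg_surjective x
  rw [toBodyAlg_eq_zero]
  exact fun ν hν => h ν hν

lemma eq_of_ev {x y : BodyAlg E} (h : ∀ ν (hν : IsVal ν), ev ν hν x = ev ν hν y) : x = y := by
  rw [← sub_eq_zero]
  exact eq_zero_of_ev fun ν hν => by rw [map_sub, h, sub_self]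

lemma bodyAlg_induction {p : BodyAlg E → Prop} (x : BodyAlg E) (hz : p 0)
    (ha : ∀ x y, p x → p y → p (x + y)) (hs : ∀ (c : ℂ) K, p (c • cls K)) : p x := by
  obtain ⟨a, rfl⟩ := toBodyAlg_surjective x
  induction a using AddMonoidAlgebra.induction_linear with
  | zero => simpa using hz
  | add f g hf hg => rw [map_add]; exact ha _ _ hf hg
  | single L d =>
    have : toBodyAlg (AddMonoidAlgebra.single L d) = d • cls L := by
      rw [cls, ← map_smul, AddMonoidAlgebra.smul_single, smul_eq_mul, mul_one]
    rw [this]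
    exact hs _ _

@[simp] lemma cls_add (K L : ConvexBody E) : cls (K + L) = cls K * cls L := by
  rw [cls, cls, cls, ← map_mul, AddMonoidAlgebra.single_mul_single, one_mul]

@[simp] lemma cls_zero : cls (0 : ConvexBody E) = 1 := by
  rw [cls, ← AddMonoidAlgebra.one_def, map_one]

@[simp] lemma cls_nsmul (k : ℕ) (K : ConvexBody E) : cls (k • K) = cls K ^ k := by
  induction k with
  | zero => simp
  | succ k ih => rw [add_smul, one_smul, cls_add, ih, pow_succ]

lemma cls_translate {x : E} {K L : ConvexBody E}
    (h : (L : Set E) = (fun y => x + y) '' (K : Set E)) : cls L = cls K :=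
  eq_of_ev fun ν hν => by rw [ev_cls, ev_cls, hν.trans x K L h]

lemma cls_union {K L U I : ConvexBody E} (hU : (U : Set E) = (K : Set E) ∪ L)
    (hI : (I : Set E) = (K : Set E) ∩ L) : cls U + cls I = cls K + cls L :=
  eq_of_ev fun ν hν => by
    rw [map_add, map_add, ev_cls, ev_cls, ev_cls, ev_cls, hν.add K L U I hU hI]

lemma continuous_ev_mul_cls {ν : ConvexBody E → ℂ} (hν : IsVal ν) (x : BodyAlg E) :
    Continuous fun K => ev ν hν (x * cls K) := by
  induction x using bodyAlg_induction with
  | hz => simpa using continuous_const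
  | ha x y hx hy => simp only [add_mul, map_add]; exact hx.add hy
  | hs c K =>
    simp only [smul_mul_assoc, ← cls_add, map_smul, ev_cls]
    exact (hν.cont.comp
      (continuous_add_body.comp (continuous_const.prodMk continuous_id))).const_smul c

lemma continuous_ev_aeval_cls {ν : ConvexBody E → ℂ} (hν : IsVal ν) (x : BodyAlg E)
    (p : Polynomial ℂ) :
    Continuous fun K => ev ν hν (x * Polynomial.aeval (cls K) p) := by
  induction p using Polynomial.induction_on' with
  | add p q hp hq => simp only [map_add, mul_add]; exact hp.add hq
  | monomial n a =>
    simp only [Polynomial.aeval_monomial]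
    have := (continuous_ev_mul_cls hν (x * algebraMap ℂ (BodyAlg E) a)).comp (continuous_nsmul_body n)
    simpa only [Function.comp_def, cls_nsmul, mul_assoc] using this

lemma continuous_ev_aeval_mul_aeval {ν : ConvexBody E → ℂ} (hν : IsVal ν)
    (p q : Polynomial ℂ) :
    Continuous fun K : ConvexBody E × ConvexBody E =>
      ev ν hν (Polynomial.aeval (cls K.1) p * Polynomial.aeval (cls K.2) q) := by
  induction p using Polynomial.induction_on' with
  | add p q hp hq => simp only [map_add, add_mul]; exact hp.add hq
  | monomial n a =>
    induction q using Polynomial.induction_on' with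
    | add p q hp hq => simp only [map_add, mul_add]; exact hp.add hq
    | monomial m b =>
      have h1 : ∀ K : ConvexBody E × ConvexBody E,
          ev ν hν (Polynomial.aeval (cls K.1) (Polynomial.monomial n a) *
            Polynomial.aeval (cls K.2) (Polynomial.monomial m b))
          = (a * b) • ν (n • K.1 + m • K.2) := by
        intro K
        rw [← ev_cls hν, ← map_smul, Polynomial.aeval_monomial, Polynomial.aeval_monomial,
          cls_add, cls_nsmul, cls_nsmul, Algebra.smul_def, map_mul (algebraMap ℂ (BodyAlg E))]
        congr 1; ring
      simp only [h1]
      have h2 : Continuous fun K : ConvexBody E × ConvexBody E => ν (n • K.1 + m • K.2) :=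
        hν.cont.comp (continuous_add_body.comp
          (((continuous_nsmul_body n).comp continuous_fst).prodMk
            ((continuous_nsmul_body m).comp continuous_snd)))
      simp only [smul_eq_mul]
      exact continuous_const.mul h2

end Algebra

section Nilpotent

variable {E : Type*} [NormedAddCommGroup E] [InnerProductSpace ℝ E] [FiniteDimensional ℝ E]

lemma cls_cone {P F : ConvexBody E}
    (hP : ∀ y, y ∈ (P : Set E) ↔ ∃ r : ℝ, 0 ≤ r ∧ r ≤ 1 ∧ ∃ f ∈ (F : Set E), y = r • f) :
    (cls P - cls F) * (cls P - 1) = 0 := by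
  obtain ⟨f₀, hf₀⟩ := F.nonempty
  have h0 : (0 : E) ∈ (P : Set E) := (hP 0).2 ⟨0, le_rfl, zero_le_one, f₀, hf₀, by simp⟩
  have hFP : (F : Set E) ⊆ P := fun f hf => (hP f).2 ⟨1, zero_le_one, le_rfl, f, hf, by simp⟩
  have hU : ((P + P : ConvexBody E) : Set E) = (P : Set E) ∪ (F + P : ConvexBody E) := by
    rw [ConvexBody.coe_add, ConvexBody.coe_add]
    apply Subset.antisymm
    · rintro _ ⟨y, hy, z, hz, rfl⟩
      obtain ⟨r, hr0, hr1, f, hf, rfl⟩ := (hP y).1 hy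
      obtain ⟨s, hs0, hs1, g, hg, rfl⟩ := (hP z).1 hz
      obtain ⟨h, hh, e⟩ : ∃ h ∈ (F : Set E), r • f + s • g = (r + s) • h := by
        rcases eq_or_lt_of_le (add_nonneg hr0 hs0) with h | h
        · have hr : r = 0 := by linarith
          have hs : s = 0 := by linarith
          exact ⟨f, hf, by simp [hr, hs]⟩
        · refine ⟨(r / (r + s)) • f + (s / (r + s)) • g,
            F.convex hf hg (by positivity) (by positivity) (by field_simp), ?_⟩
          rw [smul_add, smul_smul, smul_smul, mul_div_cancel₀ _ h.ne', mul_div_cancel₀ _ h.ne']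
      simp only
      rw [e]
      by_cases h1 : r + s ≤ 1
      · exact Or.inl ((hP _).2 ⟨r + s, by linarith, h1, h, hh, rfl⟩)
      · refine Or.inr ⟨h, hh, (r + s - 1) • h,
          (hP _).2 ⟨r + s - 1, by linarith, by linarith, h, hh, rfl⟩, ?_⟩
        simp only
        module
    · apply union_subset
      · intro y hy
        exact ⟨y, hy, 0, h0, by simp⟩
      · exact add_subset_add_right hFP
  have hI : (F : Set E) = (P : Set E) ∩ (F + P : ConvexBody E) := by
    rw [ConvexBody.coe_add]
    apply Subset.antisymm
    · exact subset_inter hFP fun f hf => ⟨f, hf, 0, h0, by simp⟩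
    · rintro y ⟨hy, f', hf', z, hz, hsum⟩
      obtain ⟨r, hr0, hr1, f, hf, rfl⟩ := (hP y).1 hy
      obtain ⟨s, hs0, hs1, g, hg, rfl⟩ := (hP z).1 hz
      have hs : 0 < 1 + s := by linarith
      set h : E := (1 / (1 + s)) • f' + (s / (1 + s)) • g with hh
      have hhF : h ∈ (F : Set E) :=
        F.convex hf' hg (by positivity) (by positivity) (by field_simp)
      have e : r • f = (1 + s) • h := by
        rw [hh, smul_add, smul_smul, smul_smul, mul_div_cancel₀ _ hs.ne',
          mul_div_cancel₀ _ hs.ne', one_smul]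
        exact hsum.symm
      rcases eq_or_lt_of_le hs0 with h0 | h0
      · rw [e, ← h0]; simpa using hhF
      · have hrs : 0 < 1 + s - r := by linarith
        have e2 : r • f = (s / (1 + s - r)) • (r • f) + ((1 - r) / (1 + s - r)) • ((1 + s) • h) := by
          rw [← e, ← add_smul, ← add_div, show s + (1 - r) = 1 + s - r by ring,
            div_self hrs.ne', one_smul]
        rw [e2, smul_smul, smul_smul]
        refine F.convex hf hhF (by positivity) ?_ (by field_simp; ring)
        have : 0 ≤ 1 - r := by linarith
        positivity
  have := cls_union hU hI
  rw [cls_add, cls_add] at this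
  linear_combination this

lemma nilpotent_hull (s : Finset E) (hs : s.Nonempty) :
    ∀ P : ConvexBody E, (P : Set E) = convexHull ℝ (s : Set E) → (cls P - 1) ^ s.card = 0 := by
  classical
  induction hs using Finset.Nonempty.cons_induction with
  | singleton a =>
    intro P hP
    have : cls P = cls (0 : ConvexBody E) := cls_translate (x := a) (by
      rw [hP]; simp)
    rw [this, cls_zero, sub_self]
    simp
  | cons v t hv ht ih =>
    intro P hP
    let F : ConvexBody E := ⟨convexHull ℝ (t : Set E), convex_convexHull _ _,
      t.finite_toSet.isCompact_convexHull (𝕜 := ℝ), by simpa using ht⟩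
    have hF : (F : Set E) = convexHull ℝ (t : Set E) := rfl
    have ih' := ih F hF
    let V : ConvexBody E := ⟨{-v}, convex_singleton _, isCompact_singleton, singleton_nonempty _⟩
    have hV : (V : Set E) = {-v} := rfl
    have tr : ∀ K : ConvexBody E, cls (V + K) = cls K := fun K => cls_translate (x := -v) (by
      rw [ConvexBody.coe_add, hV, singleton_add])
    have key := cls_cone (P := V + P) (F := V + F) (by
      intro y
      rw [ConvexBody.coe_add, ConvexBody.coe_add, hV, hP, Finset.coe_cons,
        convexHull_insert (𝕜 := ℝ) (s := (t : Set E)) (by simpa using ht), ← hF]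
      have hj : ∀ x, x ∈ convexJoin ℝ {v} (F : Set E) ↔ ∃ f ∈ (F : Set E), x ∈ segment ℝ v f := by
        intro x
        rw [mem_convexJoin]
        simp only [mem_singleton_iff, exists_eq_left]
      simp only [singleton_add, mem_image, exists_exists_and_eq_and, hj]
      constructor
      · rintro ⟨x, ⟨f, hf, hx⟩, rfl⟩
        obtain ⟨a, b, ha, hb, hab, rfl⟩ := hx
        refine ⟨b, hb, by linarith, f, hf, ?_⟩
        rw [show a = 1 - b by linarith]
        module
      · rintro ⟨r, h0, h1, f, hf, rfl⟩
        refine ⟨(1 - r) • v + r • f, ⟨f, hf, 1 - r, r, by linarith, h0, by ring, rfl⟩, ?_⟩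
        module)
    rw [tr, tr] at key
    have : ∀ m : ℕ, (cls P - 1) ^ (m + 1) = (cls F - 1) ^ m * (cls P - 1) := by
      intro m
      induction m with
      | zero => simp
      | succ m ihm =>
        rw [pow_succ, ihm, pow_succ]
        linear_combination (cls F - 1) ^ m * key
    rw [Finset.card_cons, this, ih', zero_mul]

end Nilpotent

section Growth

variable {E : Type*} [NormedAddCommGroup E] [InnerProductSpace ℝ E] [FiniteDimensional ℝ E]

lemma exists_subseq_tendsto (K : ℕ → ConvexBody E) (R : ℝ)
    (hK : ∀ n, (K n : Set E) ⊆ closedBall 0 R) :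
    ∃ (L : ConvexBody E) (φ : ℕ → ℕ), StrictMono φ ∧ Tendsto (K ∘ φ) atTop (𝓝 L) := by
  let X := closedBall (0 : E) R
  have : CompactSpace X := isCompact_iff_compactSpace.1 (isCompact_closedBall _ _)
  have hval : Isometry (Subtype.val : X → E) := isometry_subtype_coe
  let N : ℕ → TopologicalSpace.NonemptyCompacts X := fun n =>
    { carrier := Subtype.val ⁻¹' (K n : Set E)
      isCompact' := (((K n).isClosed.preimage continuous_subtype_val).isCompact)
      nonempty' := by
        obtain ⟨x, hx⟩ := (K n).nonempty
        exact ⟨⟨x, hK n hx⟩, hx⟩ }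
  have hN : ∀ n, Subtype.val '' (N n : Set X) = (K n : Set E) := fun n => by
    change Subtype.val '' (Subtype.val ⁻¹' (K n : Set E)) = _
    rw [Subtype.image_preimage_coe, inter_eq_right]
    exact hK n
  obtain ⟨M, φ, hφ, hM⟩ := CompactSpace.tendsto_subseq N
  have hd : Tendsto (fun n => hausdorffDist (N (φ n) : Set X) (M : Set X)) atTop (𝓝 0) := by
    rw [tendsto_iff_dist_tendsto_zero] at hM
    exact hM
  have hcompact : IsCompact (Subtype.val '' (M : Set X)) := M.isCompact.image continuous_subtype_val
  have hne : (Subtype.val '' (M : Set X)).Nonempty := M.nonempty.image _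
  have hd' : Tendsto (fun n => hausdorffDist (K (φ n) : Set E) (Subtype.val '' (M : Set X)))
      atTop (𝓝 0) := by
    refine hd.congr fun n => ?_
    rw [← hN, hausdorffDist_image hval]
  have hfin : ∀ n, hausdorffEDist (K n : Set E) (Subtype.val '' (M : Set X)) ≠ ⊤ := fun n =>
    hausdorffEDist_ne_top_of_nonempty_of_bounded (K n).nonempty hne (K n).isBounded
      hcompact.isBounded
  have hconv : Convex ℝ (Subtype.val '' (M : Set X)) := by
    intro x hx y hy a b ha hb hab
    rw [← hcompact.isClosed.closure_eq, mem_closure_iff_infDist_zero hne]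
    refine le_antisymm (le_of_forall_pos_le_add fun ε hε => ?_) infDist_nonneg
    obtain ⟨n, hn⟩ := (hd'.eventually (gt_mem_nhds (half_pos hε))).exists
    have hn' := hn
    rw [hausdorffDist_comm] at hn'
    have hf := hfin (φ n)
    have hf' := hf
    rw [hausdorffEDist_comm] at hf'
    obtain ⟨x', hx', hxx⟩ := exists_dist_lt_of_hausdorffDist_lt hx hn' hf'
    obtain ⟨y', hy', hyy⟩ := exists_dist_lt_of_hausdorffDist_lt hy hn' hf'
    obtain ⟨z, hz, hzz⟩ := exists_dist_lt_of_hausdorffDist_lt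
      ((K (φ n)).convex hx' hy' ha hb hab) hn hf
    rw [zero_add]
    refine (infDist_le_dist_of_mem hz).trans ((dist_triangle _ (a • x' + b • y') _).trans ?_)
    have h1 : dist (a • x + b • y) (a • x' + b • y') ≤ ε / 2 := by
      refine (dist_add_add_le _ _ _ _).trans ?_
      rw [dist_smul₀, dist_smul₀, Real.norm_of_nonneg ha, Real.norm_of_nonneg hb]
      calc a * dist x x' + b * dist y y' ≤ a * (ε / 2) + b * (ε / 2) := by gcongr
        _ = ε / 2 := by rw [← add_mul, hab, one_mul]
    linarith
  refine ⟨⟨_, hconv, hcompact, hne⟩, φ, hφ, ?_⟩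
  rw [tendsto_iff_dist_tendsto_zero]
  exact hd'

lemma exists_bound_of_subset_ball {ν : ConvexBody E → ℂ} (hν : IsVal ν) (R : ℝ) :
    ∃ C : ℝ, ∀ K : ConvexBody E, (K : Set E) ⊆ closedBall 0 R → ‖ν K‖ ≤ C := by
  by_contra! hcon
  choose K hK hK' using fun n : ℕ => hcon n
  obtain ⟨L, φ, hφ, hL⟩ := exists_subseq_tendsto K R hK
  have h1 : Tendsto (fun n => ‖ν (K (φ n))‖) atTop (𝓝 ‖ν L‖) :=
    ((hν.cont.tendsto L).comp hL).norm
  have h2 : Tendsto (fun n => ((φ n : ℕ) : ℝ)) atTop atTop :=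
    tendsto_natCast_atTop_atTop.comp hφ.tendsto_atTop
  exact not_tendsto_nhds_of_tendsto_atTop
    (tendsto_atTop_mono (fun n => (hK' (φ n)).le) h2) _ h1

/-- Bodies contained in a translate of the box with given side lengths. -/
def InBox {ι : Type*} (b : ι → E) (w : ι → ℝ) (K : ConvexBody E) : Prop :=
  ∀ i, ∃ a : ℝ, ∀ x ∈ (K : Set E), a ≤ ⟪b i, x⟫ ∧ ⟪b i, x⟫ ≤ a + w i

omit [FiniteDimensional ℝ E] in
lemma bound_double {ι : Type*} [DecidableEq ι] {ν : ConvexBody E → ℂ} (hν : IsVal ν)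
    (b : ι → E) (w : ι → ℝ) (i : ι) {C : ℝ} (hC0 : 0 ≤ C)
    (hC : ∀ K, InBox b w K → ‖ν K‖ ≤ C) (K : ConvexBody E)
    (hK : InBox b (Function.update w i (2 * w i)) K) : ‖ν K‖ ≤ 3 * C := by
  obtain ⟨a, ha⟩ := hK i
  rw [Function.update_self] at ha
  let A : Set E := (K : Set E) ∩ {x | ⟪b i, x⟫ ≤ a + w i}
  let B : Set E := (K : Set E) ∩ {x | a + w i ≤ ⟪b i, x⟫}
  have hbox : ∀ L : ConvexBody E, (L : Set E) ⊆ K → ((L : Set E) ⊆ A ∨ (L : Set E) ⊆ B) →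
      InBox b w L := by
    intro L hL hAB j
    by_cases hj : j = i
    · subst hj
      rcases hAB with h | h
      · exact ⟨a, fun x hx => ⟨(ha x (hL hx)).1, (h hx).2⟩⟩
      · exact ⟨a + w j, fun x hx => ⟨(h hx).2, by linarith [(ha x (hL hx)).2]⟩⟩
    · obtain ⟨c, hc⟩ := hK j
      rw [Function.update_of_ne hj] at hc
      exact ⟨c, fun x hx => hc x (hL hx)⟩
  have hclA : IsClosed {x : E | ⟪b i, x⟫ ≤ a + w i} := isClosed_le (by fun_prop) continuous_const
  have hclB : IsClosed {x : E | a + w i ≤ ⟪b i, x⟫} := isClosed_le continuous_const (by fun_prop)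
  have hlin : IsLinearMap ℝ (fun x : E => ⟪b i, x⟫) :=
    ⟨fun x y => inner_add_right _ _ _, fun c x => real_inner_smul_right _ _ _⟩
  have hcA : Convex ℝ A := K.convex.inter (convex_halfSpace_le hlin _)
  have hcB : Convex ℝ B := K.convex.inter (convex_halfSpace_ge hlin _)
  have hcov : (K : Set E) = A ∪ B := by
    ext x
    simp only [A, B, mem_union, mem_inter_iff, mem_ofPred_eq]
    constructor
    · intro hx
      rcases le_total ⟪b i, x⟫ (a + w i) with h | h
      · exact Or.inl ⟨hx, h⟩
      · exact Or.inr ⟨hx, h⟩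
    · rintro (h | h) <;> exact h.1
  by_cases hAne : A.Nonempty
  swap
  · rw [not_nonempty_iff_eq_empty] at hAne
    rw [hAne, empty_union] at hcov
    have := hC K (hbox K subset_rfl (Or.inr hcov.le))
    linarith
  by_cases hBne : B.Nonempty
  swap
  · rw [not_nonempty_iff_eq_empty] at hBne
    rw [hBne, union_empty] at hcov
    have := hC K (hbox K subset_rfl (Or.inl hcov.le))
    linarith
  have hABne : (A ∩ B).Nonempty := by
    have hp := K.convex.isPreconnected
    rw [isPreconnected_closed_iff] at hp
    obtain ⟨x, hx, h1, h2⟩ := hp _ _ hclA hclB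
      (fun x _ => le_total ⟪b i, x⟫ (a + w i)) hAne hBne
    exact ⟨x, ⟨hx, h1⟩, hx, h2⟩
  let KA : ConvexBody E := ⟨A, hcA, K.isCompact.inter_right hclA, hAne⟩
  let KB : ConvexBody E := ⟨B, hcB, K.isCompact.inter_right hclB, hBne⟩
  let KI : ConvexBody E := ⟨A ∩ B, hcA.inter hcB,
    KA.isCompact.inter_right KB.isClosed, hABne⟩
  have hA := hC KA (hbox KA inter_subset_left (Or.inl subset_rfl))
  have hB := hC KB (hbox KB inter_subset_left (Or.inr subset_rfl))
  have hI := hC KI (hbox KI (inter_subset_left.trans inter_subset_left)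
    (Or.inl inter_subset_left))
  have hval : ν K = ν KA + ν KB - ν KI :=
    eq_sub_of_add_eq (hν.add KA KB K KI hcov rfl)
  rw [hval]
  calc ‖ν KA + ν KB - ν KI‖ ≤ ‖ν KA‖ + ‖ν KB‖ + ‖ν KI‖ :=
        (norm_sub_le _ _).trans (add_le_add (norm_add_le _ _) le_rfl)
    _ ≤ 3 * C := by linarith

omit [FiniteDimensional ℝ E] in
lemma bound_double_all {ι : Type*} [Fintype ι] {ν : ConvexBody E → ℂ} (hν : IsVal ν)
    (b : ι → E) (w : ι → ℝ) {C : ℝ} (hC0 : 0 ≤ C)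
    (hC : ∀ K, InBox b w K → ‖ν K‖ ≤ C) (K : ConvexBody E)
    (hK : InBox b (fun i => 2 * w i) K) : ‖ν K‖ ≤ 3 ^ Fintype.card ι * C := by
  classical
  have key : ∀ s : Finset ι, ∀ K, InBox b (fun i => if i ∈ s then 2 * w i else w i) K →
      ‖ν K‖ ≤ 3 ^ s.card * C := by
    intro s
    induction s using Finset.induction_on with
    | empty => simpa using hC
    | insert i s hi ih =>
      intro K hK
      rw [Finset.card_insert_of_notMem hi, pow_succ, mul_comm _ (3 : ℝ), mul_assoc]
      refine bound_double hν b _ i (by positivity) ih K ?_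
      convert hK using 1
      funext j
      by_cases hj : j = i
      · subst hj; simp [hi]
      · simp [hj]
  exact key Finset.univ K (by simpa using hK)

lemma exists_growth {ν : ConvexBody E → ℂ} (hν : IsVal ν) (P : ConvexBody E) :
    ∃ C : ℝ, ∀ j : ℕ, ‖ν (2 ^ j • P)‖ ≤ C * (3 ^ Module.finrank ℝ E) ^ j := by
  let b := stdOrthonormalBasis ℝ E
  obtain ⟨r, hr0, hr⟩ := exists_bound P
  set N := Module.finrank ℝ E
  have hbP : ∀ i, ∀ x ∈ (P : Set E), |⟪b i, x⟫| ≤ r := by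
    intro i x hx
    refine (abs_real_inner_le_norm _ _).trans ?_
    rw [b.orthonormal.1 i, one_mul]
    exact hr x hx
  obtain ⟨C, hC⟩ := exists_bound_of_subset_ball hν (N * (2 * r))
  have hC0 : 0 ≤ C := (norm_nonneg _).trans (hC 0 (by
    rw [ConvexBody.coe_zero]
    intro x hx
    rw [Set.mem_zero.1 hx, mem_closedBall_zero_iff, norm_zero]
    positivity))
  have base : ∀ K, InBox b (fun _ => 2 * r) K → ‖ν K‖ ≤ C := by
    intro K hK
    obtain ⟨x₀, hx₀⟩ := K.nonempty
    let L : ConvexBody E := ⟨(fun y => -x₀ + y) '' (K : Set E), by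
      simpa [image_add_left] using K.convex.translate (-x₀),
      K.isCompact.image (by fun_prop), K.nonempty.image _⟩
    have hL : (L : Set E) = (fun y => -x₀ + y) '' (K : Set E) := rfl
    rw [← hν.trans (-x₀) K L hL]
    apply hC
    rw [hL]
    rintro _ ⟨x, hx, rfl⟩
    rw [mem_closedBall_zero_iff]
    change ‖-x₀ + x‖ ≤ _
    rw [← b.sum_repr (-x₀ + x)]
    refine (norm_sum_le _ _).trans ?_
    have : ∀ i ∈ Finset.univ, ‖b.repr (-x₀ + x) i • b i‖ ≤ 2 * r := by
      intro i _
      rw [norm_smul, b.orthonormal.1 i, mul_one, b.repr_apply_apply, Real.norm_eq_abs,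
        inner_add_right, inner_neg_right, abs_le]
      obtain ⟨a, ha⟩ := hK i
      have h1 := ha x hx
      have h2 := ha x₀ hx₀
      constructor <;> linarith [h1.1, h1.2, h2.1, h2.2]
    refine (Finset.sum_le_sum this).trans_eq ?_
    simp [N]
  have step : ∀ j : ℕ, ∀ K, InBox b (fun _ => 2 ^ j * (2 * r)) K → ‖ν K‖ ≤ (3 ^ N) ^ j * C := by
    intro j
    induction j with
    | zero => simpa using base
    | succ j ih =>
      intro K hK
      have := bound_double_all hν b _ (by positivity) ih K (by
        convert hK using 2
        ring)
      rw [Fintype.card_fin] at this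
      refine this.trans_eq ?_
      ring
  refine ⟨C, fun j => ?_⟩
  rw [mul_comm]
  refine step j _ fun i => ⟨-(2 ^ j * r), ?_⟩
  intro x hx
  rw [nsmul_body_eq, ConvexBody.coe_smul] at hx
  obtain ⟨y, hy, hyx⟩ := hx
  have h1 := abs_le.1 (hbP i y hy)
  have h2 : ⟪b i, x⟫ = 2 ^ j * ⟪b i, y⟫ := by
    rw [← hyx]
    simp only [real_inner_smul_right]
    push_cast
    ring
  rw [h2]
  have h3 : (0 : ℝ) ≤ 2 ^ j := by positivity
  constructor
  · nlinarith [h1.1]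
  · nlinarith [h1.2]

end Growth

section Growth

lemma tendsto_choose_two_pow {i m : ℕ} (him : i ≤ m) :
    Tendsto (fun j : ℕ => (((2 ^ j).choose i : ℕ) : ℝ) / ((2 : ℝ) ^ j) ^ m) atTop
      (𝓝 (if i = m then 1 / (m.factorial : ℝ) else 0)) := by
  have h1 : Tendsto (fun n : ℕ => ((n.choose i : ℕ) : ℝ) / ((n : ℝ) ^ i / i.factorial)) atTop
      (𝓝 1) := by
    have := (isEquivalent_choose i)
    rw [Asymptotics.isEquivalent_iff_tendsto_one] at this
    · exact this
    · filter_upwards [eventually_gt_atTop 0] with n hn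
      have : (0 : ℝ) < n := by exact_mod_cast hn
      positivity
  have h2 : Tendsto (fun n : ℕ => (n : ℝ) ^ i / (n : ℝ) ^ m) atTop
      (𝓝 (if i = m then 1 else 0)) := by
    split_ifs with h
    · subst h
      refine tendsto_const_nhds.congr' ?_
      filter_upwards [eventually_gt_atTop 0] with n hn
      have : (0 : ℝ) < n := by exact_mod_cast hn
      rw [div_self (by positivity)]
    · have hlt : i < m := lt_of_le_of_ne him h
      have := (tendsto_pow_div_pow_atTop_zero (𝕜 := ℝ) hlt).comp tendsto_natCast_atTop_atTop
      exact this
  have h3 := (h1.mul h2).div_const (i.factorial : ℝ)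
  have h4 : Tendsto (fun n : ℕ => ((n.choose i : ℕ) : ℝ) / (n : ℝ) ^ m) atTop
      (𝓝 (if i = m then 1 / (m.factorial : ℝ) else 0)) := by
    have e : (if i = m then 1 / (m.factorial : ℝ) else 0)
        = 1 * (if i = m then 1 else 0) / (i.factorial : ℝ) := by
      split_ifs with h <;> simp [h]
    rw [e]
    refine h3.congr' ?_
    filter_upwards [eventually_gt_atTop 0] with n hn
    have : (0 : ℝ) < n := by exact_mod_cast hn
    have : (0 : ℝ) < i.factorial := by positivity
    field_simp
  have h5 : Tendsto (fun j : ℕ => 2 ^ j) atTop atTop := tendsto_pow_atTop_atTop_of_one_lt one_lt_two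
  refine (h4.comp h5).congr fun j => ?_
  simp

lemma choose_coeff_zero {N : ℕ} {C : ℝ} {a : ℕ → ℂ} : ∀ {m : ℕ},
    (∀ j : ℕ, ‖∑ i ∈ Finset.range m, (((2 ^ j).choose i : ℕ) : ℂ) * a i‖ ≤ C * (3 ^ N) ^ j) →
    ∀ i < m, 2 * N < i → a i = 0 := by
  intro m
  induction m with
  | zero => simp
  | succ m ih =>
    intro h i hi hN
    by_cases hm : 2 * N < m
    · have ham : a m = 0 := by
        have t1 : Tendsto (fun j : ℕ => ∑ i ∈ Finset.range (m + 1),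
            (((((2 ^ j).choose i : ℕ) : ℝ) / ((2 : ℝ) ^ j) ^ m : ℝ) : ℂ) * a i) atTop
            (𝓝 (∑ i ∈ Finset.range (m + 1),
              ((if i = m then 1 / (m.factorial : ℝ) else 0 : ℝ) : ℂ) * a i)) :=
          tendsto_finsetSum _ fun i hi => ((Complex.continuous_ofReal.tendsto _).comp
            (tendsto_choose_two_pow (Finset.mem_range_succ_iff.1 hi))).mul_const _
        have t2 : Tendsto (fun j : ℕ => ∑ i ∈ Finset.range (m + 1),
            (((((2 ^ j).choose i : ℕ) : ℝ) / ((2 : ℝ) ^ j) ^ m : ℝ) : ℂ) * a i) atTop (𝓝 0) := by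
          have b : Tendsto (fun j : ℕ => C * ((3 : ℝ) ^ N / 2 ^ m) ^ j) atTop (𝓝 (C * 0)) := by
            refine (tendsto_pow_atTop_nhds_zero_of_lt_one (by positivity) ?_).const_mul C
            rw [div_lt_one (by positivity)]
            calc (3 : ℝ) ^ N ≤ 4 ^ N := by gcongr; norm_num
              _ = 2 ^ (2 * N) := by rw [pow_mul]; norm_num
              _ < 2 ^ m := pow_lt_pow_right₀ one_lt_two hm
          rw [mul_zero] at b
          refine squeeze_zero_norm (fun j => ?_) b
          have e : ∑ i ∈ Finset.range (m + 1),
            (((((2 ^ j).choose i : ℕ) : ℝ) / ((2 : ℝ) ^ j) ^ m : ℝ) : ℂ) * a i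
              = (((2 : ℝ) ^ j) ^ m : ℝ)⁻¹ •
                ∑ i ∈ Finset.range (m + 1), (((2 ^ j).choose i : ℕ) : ℂ) * a i := by
            rw [Finset.smul_sum]
            refine Finset.sum_congr rfl fun i _ => ?_
            rw [Complex.real_smul]
            push_cast
            ring
          rw [e, norm_smul, norm_inv, Real.norm_of_nonneg (by positivity)]
          calc (((2 : ℝ) ^ j) ^ m)⁻¹ * _ ≤ (((2 : ℝ) ^ j) ^ m)⁻¹ * (C * (3 ^ N) ^ j) := by
                gcongr; exact h j
            _ = C * ((3 : ℝ) ^ N / 2 ^ m) ^ j := by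
                rw [div_pow, ← pow_mul 2, ← pow_mul 2, mul_comm j m, div_eq_mul_inv]; ring
        have := tendsto_nhds_unique t1 t2
        rw [Finset.sum_eq_single m] at this
        · have hf : (m.factorial : ℂ) ≠ 0 := by exact_mod_cast m.factorial_ne_zero
          simpa [hf] using this
        · intro b _ hb; simp [hb]
        · simp
      rcases Nat.lt_succ_iff_lt_or_eq.1 hi with h' | rfl
      · refine ih (fun j => ?_) i h' hN
        have := h j
        rwa [Finset.sum_range_succ, ham, mul_zero, add_zero] at this
      · exact ham
    · omega

end Growth

section Poly

variable {E : Type*} [NormedAddCommGroup E] [InnerProductSpace ℝ E] [FiniteDimensional ℝ E]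

omit [FiniteDimensional ℝ E] in
lemma exists_polytope_dist_le (K : ConvexBody E) {ε : ℝ} (hε : 0 < ε) :
    ∃ (s : Finset E) (_ : s.Nonempty) (P : ConvexBody E), (P : Set E) = convexHull ℝ (s : Set E) ∧
      (s : Set E) ⊆ K ∧ dist K P ≤ ε := by
  obtain ⟨t, htK, htf, ht⟩ := K.isCompact.finite_cover_balls hε
  obtain ⟨s, rfl⟩ := htf.exists_finset_coe
  have hs : s.Nonempty := by
    obtain ⟨x, hx⟩ := K.nonempty
    obtain ⟨y, hy, _⟩ := mem_iUnion₂.1 (ht hx)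
    exact ⟨y, hy⟩
  let P : ConvexBody E := ⟨convexHull ℝ (s : Set E), convex_convexHull _ _,
      s.finite_toSet.isCompact_convexHull (𝕜 := ℝ), by simpa using hs⟩
  have hPK : (P : Set E) ⊆ K := convexHull_min htK K.convex
  refine ⟨s, hs, P, rfl, htK, ?_⟩
  refine hausdorffDist_le_of_mem_dist hε.le (fun x hx => ?_) fun x hx => ⟨x, hPK hx, by
    simpa using hε.le⟩
  obtain ⟨y, hy, hxy⟩ := mem_iUnion₂.1 (ht hx)
  exact ⟨y, subset_convexHull ℝ _ hy, (mem_ball.1 hxy).le⟩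

/-- A bound for the degree of homogeneity. -/
abbrev deg (E : Type*) [NormedAddCommGroup E] [InnerProductSpace ℝ E] : ℕ :=
  2 * Module.finrank ℝ E

lemma cls_pow_eq_sum (K : ConvexBody E) {m : ℕ} (h : (cls K - 1) ^ m = 0) (k : ℕ) :
    cls K ^ k = ∑ i ∈ Finset.range m, ((k.choose i : ℕ) : BodyAlg E) * (cls K - 1) ^ i := by
  have hz : ∀ i, m ≤ i → (cls K - 1) ^ i = 0 := fun i hi => pow_eq_zero_of_le hi h
  have e : cls K ^ k = ((cls K - 1) + 1) ^ k := by rw [sub_add_cancel]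
  rw [e, add_pow]
  simp only [one_pow, mul_one]
  rcases le_total m (k + 1) with hmk | hmk
  · rw [Finset.sum_congr rfl fun i _ => mul_comm _ _]
    refine (Finset.sum_subset (Finset.range_mono hmk) ?_).symm
    intro i _ hi
    rw [hz i (by simpa using hi), mul_zero]
  · rw [Finset.sum_congr rfl fun i _ => mul_comm _ _]
    refine Finset.sum_subset (Finset.range_mono hmk) ?_
    intro i _ hi
    rw [Nat.choose_eq_zero_of_lt (by simpa using hi), Nat.cast_zero, zero_mul]

lemma cls_sub_one_pow_polytope {P : ConvexBody E} {m : ℕ} (h : (cls P - 1) ^ m = 0) :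
    (cls P - 1) ^ (deg E + 1) = 0 := by
  refine eq_zero_of_ev fun ν hν => ?_
  obtain ⟨C, hC⟩ := exists_growth hν P
  have key := choose_coeff_zero (N := Module.finrank ℝ E) (C := C)
    (a := fun i => ev ν hν ((cls P - 1) ^ i)) (m := m) (fun j => by
      have h1 := hC j
      rw [← ev_cls hν, cls_nsmul, cls_pow_eq_sum P h, map_sum] at h1
      refine le_trans (le_of_eq ?_) h1
      congr 1
      refine Finset.sum_congr rfl fun i _ => ?_
      rw [← nsmul_eq_mul, ← nsmul_eq_mul, map_nsmul])
  by_cases hm : deg E + 1 < m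
  · exact key _ hm (by simp)
  · rw [pow_eq_zero_of_le (not_lt.1 hm) h, map_zero]

lemma cls_sub_one_pow (K : ConvexBody E) : (cls K - 1) ^ (deg E + 1) = 0 := by
  refine eq_zero_of_ev fun ν hν => ?_
  choose s hs P hP hsK hd using fun n : ℕ => exists_polytope_dist_le K (Nat.one_div_pos_of_nat (α := ℝ) (n := n))
  have hlim : Tendsto P atTop (𝓝 K) := by
    rw [tendsto_iff_dist_tendsto_zero]
    refine squeeze_zero (fun _ => dist_nonneg) (fun n => ?_) tendsto_one_div_add_atTop_nhds_zero_nat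
    rw [dist_comm]
    exact hd n
  have hc := continuous_ev_aeval_cls hν 1 ((Polynomial.X - 1) ^ (deg E + 1))
  simp only [one_mul, map_pow, map_sub, Polynomial.aeval_X, map_one] at hc
  refine tendsto_nhds_unique ((hc.tendsto K).comp hlim) ?_
  refine tendsto_const_nhds.congr fun n => ?_
  rw [Function.comp_apply, cls_sub_one_pow_polytope (nilpotent_hull _ (hs n) _ (hP n)), map_zero]

end Poly

section Unique

lemma eq_zero_of_sum_pow_smul {V : Type*} [AddCommGroup V] [Module ℂ V] {a : ℕ → V} {m : ℕ}
    {S : Set ℂ} (hS : S.Infinite) (h : ∀ c ∈ S, ∑ i ∈ Finset.range m, c ^ i • a i = 0) :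
    ∀ i < m, a i = 0 := by
  intro i hi
  rw [← Module.forall_dual_apply_eq_zero_iff ℂ]
  intro φ
  let p : Polynomial ℂ := ∑ i ∈ Finset.range m, Polynomial.monomial i (φ (a i))
  have hp : p = 0 := by
    refine p.eq_zero_of_infinite_isRoot (hS.mono fun c hc => ?_)
    have := congrArg φ (h c hc)
    simp only [map_sum, map_smul, map_zero, smul_eq_mul] at this
    change Polynomial.eval c p = 0
    simp only [p, Polynomial.eval_finsetSum, Polynomial.eval_monomial]
    rw [← this]
    exact Finset.sum_congr rfl fun _ _ => mul_comm _ _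
  have := congrArg (fun q => Polynomial.coeff q i) hp
  simpa [p, Polynomial.finsetSum_coeff, Polynomial.coeff_monomial, hi] using this

variable {A : Type*} [CommRing A] [Algebra ℂ A]

open Polynomial in
lemma poly_unique {f g : A[X]} {S : Set ℂ} (hS : S.Infinite)
    (h : ∀ c ∈ S, f.eval (algebraMap ℂ A c) = g.eval (algebraMap ℂ A c)) : f = g := by
  rw [← sub_eq_zero]
  set q := f - g
  have hq : ∀ c ∈ S, ∑ i ∈ Finset.range (q.natDegree + 1), c ^ i • q.coeff i = 0 := by
    intro c hc
    have : q.eval (algebraMap ℂ A c) = 0 := by rw [Polynomial.eval_sub, h c hc, sub_self]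
    rw [Polynomial.eval_eq_sum_range] at this
    rw [← this]
    refine Finset.sum_congr rfl fun i _ => ?_
    rw [Algebra.smul_def, map_pow, mul_comm]
  ext i
  by_cases hi : i < q.natDegree + 1
  · exact eq_zero_of_sum_pow_smul hS hq i hi
  · rw [Polynomial.coeff_eq_zero_of_natDegree_lt (by omega), Polynomial.coeff_zero]

lemma infinite_natCast : (range (Nat.cast : ℕ → ℂ)).Infinite :=
  infinite_range_of_injective Nat.cast_injective

open Polynomial in
lemma poly_unique_nat {f g : A[X]} (h : ∀ k : ℕ, f.eval (k : A) = g.eval (k : A)) : f = g :=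
  poly_unique infinite_natCast (by
    rintro _ ⟨k, rfl⟩
    rw [map_natCast]
    exact h k)

end Unique

section Poly

open Polynomial

variable {E : Type*} [NormedAddCommGroup E] [InnerProductSpace ℝ E] [FiniteDimensional ℝ E]

/-- The polynomial `X.choose j`. -/
def binomPoly (j : ℕ) : ℂ[X] := C ((j.factorial : ℂ)⁻¹) * descPochhammer ℂ j

lemma binomPoly_eval_nat (j k : ℕ) : (binomPoly j).eval (k : ℂ) = (k.choose j : ℂ) := by
  rw [binomPoly, eval_mul, eval_C, descPochhammer_eval_eq_descFactorial,
    Nat.descFactorial_eq_factorial_mul_choose]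
  have : (j.factorial : ℂ) ≠ 0 := by exact_mod_cast j.factorial_ne_zero
  push_cast
  field_simp

lemma binomPoly_natDegree (j : ℕ) : (binomPoly j).natDegree ≤ j := by
  rw [binomPoly]
  refine (natDegree_C_mul_le _ _).trans ?_
  rw [descPochhammer_natDegree]

/-- The Minkowski polynomial of a body. -/
def mink (K : ConvexBody E) : (BodyAlg E)[X] :=
  ∑ j ∈ Finset.range (deg E + 1), C ((cls K - 1) ^ j) * (binomPoly j).map (algebraMap ℂ (BodyAlg E))

lemma eval_mink_nat (K : ConvexBody E) (k : ℕ) : (mink K).eval (k : BodyAlg E) = cls K ^ k := by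
  rw [cls_pow_eq_sum K (cls_sub_one_pow K), mink, eval_finsetSum]
  refine Finset.sum_congr rfl fun j _ => ?_
  rw [eval_mul, eval_C, ← map_natCast (algebraMap ℂ (BodyAlg E)) k, eval_map_algebraMap,
    aeval_algebraMap_apply_eq_algebraMap_eval, binomPoly_eval_nat, map_natCast, mul_comm]

lemma mink_natDegree (K : ConvexBody E) : (mink K).natDegree ≤ deg E := by
  refine natDegree_sum_le_of_forall_le _ _ fun j hj => ?_
  refine (natDegree_C_mul_le _ _).trans (natDegree_map_le.trans ((binomPoly_natDegree j).trans ?_))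
  exact Finset.mem_range_succ_iff.1 hj

lemma mink_add (K L : ConvexBody E) : mink (K + L) = mink K * mink L :=
  poly_unique_nat fun k => by rw [eval_mul]; simp only [eval_mink_nat, cls_add, mul_pow]

lemma smul_smul_body (K : ConvexBody E) {s t : ℝ} (hs : 0 ≤ s) (ht : 0 ≤ t) :
    s • (t • K) = (s * t) • K :=
  ext_supp fun u _ => by
    rw [supp_smul _ hs, supp_smul _ ht, supp_smul _ (mul_nonneg hs ht), mul_assoc]

lemma eval_mink_rat (K : ConvexBody E) (p q : ℕ) (hq : 0 < q) :
    (mink K).eval (algebraMap ℂ (BodyAlg E) ((p : ℂ) / q)) = cls (((p : ℝ) / q) • K) := by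
  have hq' : (0 : ℝ) < q := by exact_mod_cast hq
  have hqc : (q : ℂ) ≠ 0 := by exact_mod_cast hq.ne'
  set L : ConvexBody E := ((1 : ℝ) / q) • K with hL
  have e1 : (mink L).comp (C (q : BodyAlg E) * X) = mink K := by
    refine poly_unique_nat fun k => ?_
    rw [eval_comp, eval_mul, eval_C, eval_X, ← Nat.cast_mul, eval_mink_nat, eval_mink_nat, pow_mul,
      ← cls_nsmul q, nsmul_body_eq, hL, smul_smul_body _ hq'.le (by positivity),
      mul_one_div_cancel hq'.ne']
    congr 2
    exact ext_supp fun u _ => by rw [supp_smul _ zero_le_one, one_mul]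
  rw [← e1, eval_comp, eval_mul, eval_C, eval_X, ← map_natCast (algebraMap ℂ (BodyAlg E)) q,
    ← map_mul, mul_div_cancel₀ _ hqc, map_natCast, eval_mink_nat, ← cls_nsmul, nsmul_body_eq, hL,
    smul_smul_body _ (Nat.cast_nonneg p) (by positivity), mul_one_div]

lemma dist_smul_body_le (K : ConvexBody E) :
    ∃ R : ℝ, ∀ s t : ℝ, 0 ≤ s → 0 ≤ t → dist (s • K) (t • K) ≤ R * |s - t| := by
  obtain ⟨R, hR0, hR⟩ := exists_bound K
  refine ⟨R, fun s t hs ht => dist_le_of_supp (by positivity) fun u hu => ?_⟩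
  rw [supp_smul _ hs, supp_smul _ ht, ← sub_mul, abs_mul, mul_comm]
  refine mul_le_mul_of_nonneg_right ?_ (abs_nonneg _)
  obtain ⟨x, hx, e⟩ := exists_supp_eq K u
  rw [← e]
  refine (abs_real_inner_le_norm _ _).trans ?_
  rw [hu, mul_one]
  exact hR x hx

lemma continuous_smul_body (K : ConvexBody E) : Continuous fun t : ℝ≥0 => (t : ℝ) • K := by
  obtain ⟨R, hR⟩ := dist_smul_body_le K
  rw [continuous_iff_continuousAt]
  intro t
  rw [ContinuousAt, tendsto_iff_dist_tendsto_zero]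
  have h : Tendsto (fun s : ℝ≥0 => R * |(s : ℝ) - t|) (𝓝 t) (𝓝 (R * |(t : ℝ) - t|)) := by
    apply Continuous.tendsto
    fun_prop
  rw [sub_self, abs_zero, mul_zero] at h
  exact squeeze_zero (fun _ => dist_nonneg) (fun s => hR s t s.2 t.2) h

lemma eval_mink (K : ConvexBody E) {t : ℝ} (ht : 0 ≤ t) :
    (mink K).eval (algebraMap ℂ (BodyAlg E) (t : ℂ)) = cls (t • K) := by
  lift t to ℝ≥0 using ht
  refine eq_of_ev fun ν hν => ?_
  have h1 : Continuous fun t : ℝ≥0 => ev ν hν (cls ((t : ℝ) • K)) := by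
    simp only [ev_cls]
    exact hν.cont.comp (continuous_smul_body K)
  have h2 : Continuous fun t : ℝ≥0 =>
      ev ν hν ((mink K).eval (algebraMap ℂ (BodyAlg E) ((t : ℝ) : ℂ))) := by
    simp only [eval_eq_sum_range, map_sum, ← map_pow]
    refine continuous_finsetSum _ fun i _ => ?_
    have e : ∀ c : ℂ, ev ν hν ((mink K).coeff i * algebraMap ℂ (BodyAlg E) (c ^ i))
        = c ^ i * ev ν hν ((mink K).coeff i) := fun c => by
      rw [mul_comm, ← Algebra.smul_def, map_smul, smul_eq_mul]
    simp only [e]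
    fun_prop
  have hd : DenseRange (fun q : ℚ≥0 => (q : ℝ≥0)) := by
    intro x
    rw [Metric.mem_closure_iff]
    intro ε hε
    obtain ⟨q, hq1, hq2⟩ := exists_rat_btwn (show (x : ℝ) < x + ε by linarith)
    have hq0 : (0 : ℚ) ≤ q := by
      have : (0 : ℝ) ≤ q := x.2.trans hq1.le
      exact_mod_cast this
    lift q to ℚ≥0 using hq0
    refine ⟨_, ⟨q, rfl⟩, ?_⟩
    rw [NNReal.dist_eq, abs_sub_comm, abs_of_nonneg]
    · have : ((q : ℝ≥0) : ℝ) = ((q : ℚ) : ℝ) := by norm_cast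
      rw [this]; linarith
    · have : ((q : ℝ≥0) : ℝ) = ((q : ℚ) : ℝ) := by norm_cast
      rw [this]; linarith
  refine congrFun (hd.equalizer h2 h1 (funext fun q => ?_)) t
  simp only [Function.comp_apply]
  have := eval_mink_rat K q.num q.den q.den_pos
  have e : ((q : ℝ≥0) : ℝ) = (q.num : ℝ) / q.den := by
    have h3 : ((q : ℝ≥0) : ℝ) = (q : ℝ) := by norm_cast
    rw [h3, NNRat.cast_def]
  rw [e]
  push_cast
  rw [this]

lemma mink_smul (K : ConvexBody E) {s : ℝ} (hs : 0 ≤ s) :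
    mink (s • K) = (mink K).comp (C (algebraMap ℂ (BodyAlg E) (s : ℂ)) * X) :=
  poly_unique_nat fun k => by
    rw [eval_mink_nat, eval_comp, eval_mul, eval_C, eval_X,
      ← map_natCast (algebraMap ℂ (BodyAlg E)) k, ← map_mul, ← cls_nsmul, nsmul_body_eq,
      smul_smul_body _ (Nat.cast_nonneg k) hs]
    have := eval_mink K (mul_nonneg hs (Nat.cast_nonneg (α := ℝ) k))
    rw [Complex.ofReal_mul, Complex.ofReal_natCast] at this
    rw [this, mul_comm]

lemma mink_coeff_zero (K : ConvexBody E) : (mink K).coeff 0 = 1 := by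
  have := eval_mink_nat K 0
  rwa [Nat.cast_zero, pow_zero, ← coeff_zero_eq_eval_zero] at this

/-- The logarithm of the class of a body. -/
def lg (K : ConvexBody E) : BodyAlg E := (mink K).coeff 1

lemma lg_add (K L : ConvexBody E) : lg (K + L) = lg K + lg L := by
  rw [lg, mink_add, mul_coeff_one, mink_coeff_zero, mink_coeff_zero, lg, lg]
  ring

lemma lg_smul (K : ConvexBody E) {s : ℝ} (hs : 0 ≤ s) : lg (s • K) = (s : ℂ) • lg K := by
  rw [lg, mink_smul K hs, comp_C_mul_X_coeff, pow_one, lg, Algebra.smul_def, mul_comm]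

lemma lg_of_cls_eq {K L : ConvexBody E} (h : cls K = cls L) : lg K = lg L := by
  rw [lg, lg, mink, mink, h]

lemma derivative_mink (K : ConvexBody E) : derivative (mink K) = C (lg K) * mink K := by
  refine poly_unique_nat fun k => ?_
  rw [← taylor_coeff_one]
  have : taylor (k : BodyAlg E) (mink K) = C (cls K ^ k) * mink K := by
    refine poly_unique_nat fun j => ?_
    rw [taylor_eval, eval_mul, eval_C, ← Nat.cast_add, eval_mink_nat, eval_mink_nat, pow_add,
      mul_comm]
  rw [this, coeff_C_mul, eval_mul, eval_C, eval_mink_nat, mul_comm, lg]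

lemma mink_coeff (K : ConvexBody E) (j : ℕ) :
    (mink K).coeff j = ((j.factorial : ℂ)⁻¹) • lg K ^ j := by
  induction j with
  | zero => simp [mink_coeff_zero]
  | succ j ih =>
    have := congrArg (fun p => coeff p j) (derivative_mink K)
    simp only [coeff_derivative, coeff_C_mul, ih] at this
    have h2 : ((j : ℂ) + 1) • (mink K).coeff (j + 1) = (mink K).coeff (j + 1) * ((j : BodyAlg E) + 1) := by
      rw [Algebra.smul_def, map_add, map_natCast, map_one, mul_comm]
    rw [this] at h2
    have hj : (j : ℂ) + 1 ≠ 0 := by exact_mod_cast j.succ_ne_zero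
    have h3 := congrArg (fun x => ((j : ℂ) + 1)⁻¹ • x) h2
    simp only [smul_smul, inv_mul_cancel₀ hj, one_smul] at h3
    rw [h3, Nat.factorial_succ, mul_smul_comm, smul_smul, ← pow_succ']
    congr 1
    push_cast
    rw [mul_inv]

lemma cls_eq_sum_lg (K : ConvexBody E) :
    cls K = ∑ j ∈ Finset.range (deg E + 1), ((j.factorial : ℂ)⁻¹) • lg K ^ j := by
  have := eval_mink_nat K 1
  rw [pow_one, eval_eq_sum_range' (Nat.lt_succ_of_le (mink_natDegree K))] at this
  rw [← this]
  simp [mink_coeff]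

/-- The polynomial whose value at the class of a body is its logarithm. -/
def lgPoly (E : Type*) [NormedAddCommGroup E] [InnerProductSpace ℝ E] : ℂ[X] :=
  ∑ j ∈ Finset.range (deg E + 1), (X - 1) ^ j * C ((binomPoly j).coeff 1)

lemma lg_eq_aeval (K : ConvexBody E) : lg K = aeval (cls K) (lgPoly E) := by
  rw [lg, mink, lgPoly, finsetSum_coeff, map_sum]
  refine Finset.sum_congr rfl fun j _ => ?_
  rw [coeff_C_mul, coeff_map, map_mul, map_pow, map_sub, aeval_X, map_one, aeval_C]

end Poly

section C11

variable {E : Type*} [NormedAddCommGroup E] [InnerProductSpace ℝ E]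

/-- Quantitative second order regularity of functions on the unit sphere. -/
structure C11 (ψ : E → ℝ) (c : ℝ) : Prop where
  nonneg : 0 ≤ c
  bound : ∀ u, ‖u‖ = 1 → |ψ u| ≤ c
  taylor : ∀ u₀, ‖u₀‖ = 1 → ∃ p : E, ‖p‖ ≤ c ∧
    ∀ u, ‖u‖ = 1 → |ψ u - ψ u₀ - ⟪p, u - u₀⟫| ≤ c * ‖u - u₀‖ ^ 2

lemma C11.mono {ψ : E → ℝ} {c c' : ℝ} (h : C11 ψ c) (hc : c ≤ c') : C11 ψ c' where
  nonneg := h.nonneg.trans hc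
  bound u hu := (h.bound u hu).trans hc
  taylor u₀ hu₀ := by
    obtain ⟨p, hp, h'⟩ := h.taylor u₀ hu₀
    exact ⟨p, hp.trans hc, fun u hu => (h' u hu).trans (by gcongr)⟩

lemma C11.congr {ψ ψ' : E → ℝ} {c : ℝ} (h : C11 ψ c) (e : ∀ u, ‖u‖ = 1 → ψ' u = ψ u) :
    C11 ψ' c where
  nonneg := h.nonneg
  bound u hu := by rw [e u hu]; exact h.bound u hu
  taylor u₀ hu₀ := by
    obtain ⟨p, hp, h'⟩ := h.taylor u₀ hu₀
    exact ⟨p, hp, fun u hu => by rw [e u hu, e u₀ hu₀]; exact h' u hu⟩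

lemma C11.add {ψ φ : E → ℝ} {c d : ℝ} (h : C11 ψ c) (k : C11 φ d) :
    C11 (fun u => ψ u + φ u) (c + d) where
  nonneg := add_nonneg h.nonneg k.nonneg
  bound u hu := (abs_add_le _ _).trans (add_le_add (h.bound u hu) (k.bound u hu))
  taylor u₀ hu₀ := by
    obtain ⟨p, hp, h'⟩ := h.taylor u₀ hu₀
    obtain ⟨q, hq, k'⟩ := k.taylor u₀ hu₀
    refine ⟨p + q, (norm_add_le _ _).trans (add_le_add hp hq), fun u hu => ?_⟩
    have h1 := h' u hu
    have h2 := k' u hu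
    rw [inner_add_left]
    rw [abs_le] at *
    constructor <;> linarith

lemma C11.smul {ψ : E → ℝ} {c : ℝ} (h : C11 ψ c) (a : ℝ) : C11 (fun u => a * ψ u) (|a| * c) where
  nonneg := mul_nonneg (abs_nonneg _) h.nonneg
  bound u hu := by rw [abs_mul]; gcongr; exact h.bound u hu
  taylor u₀ hu₀ := by
    obtain ⟨p, hp, h'⟩ := h.taylor u₀ hu₀
    refine ⟨a • p, by rw [norm_smul, Real.norm_eq_abs]; gcongr, fun u hu => ?_⟩
    rw [real_inner_smul_left, ← mul_sub, ← mul_sub, abs_mul, mul_assoc]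
    gcongr
    exact h' u hu

lemma C11.neg {ψ : E → ℝ} {c : ℝ} (h : C11 ψ c) : C11 (fun u => -ψ u) c := by
  simpa using h.smul (-1)

lemma C11.sub {ψ φ : E → ℝ} {c d : ℝ} (h : C11 ψ c) (k : C11 φ d) :
    C11 (fun u => ψ u - φ u) (c + d) := by
  simpa [sub_eq_add_neg] using h.add k.neg

lemma C11.const (a : ℝ) : C11 (fun _ : E => a) |a| where
  nonneg := abs_nonneg _
  bound _ _ := le_rfl
  taylor _ _ := ⟨0, by simp, fun u _ => by
    simp only [sub_self, inner_zero_left, abs_zero]; positivity⟩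

lemma C11.inner (p : E) : C11 (fun u : E => ⟪p, u⟫) ‖p‖ where
  nonneg := norm_nonneg _
  bound u hu := by simpa [hu] using abs_real_inner_le_norm p u
  taylor _ _ := ⟨p, le_rfl, fun u _ => by
    rw [inner_sub_right, sub_self, abs_zero]; positivity⟩

lemma C11.lipschitz {ψ : E → ℝ} {c : ℝ} (h : C11 ψ c) {u u₀ : E} (hu : ‖u‖ = 1) (hu₀ : ‖u₀‖ = 1) :
    |ψ u - ψ u₀| ≤ 3 * c * ‖u - u₀‖ := by
  obtain ⟨p, hp, h'⟩ := h.taylor u₀ hu₀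
  have h1 := h' u hu
  have h2 : |⟪p, u - u₀⟫| ≤ c * ‖u - u₀‖ :=
    (abs_real_inner_le_norm _ _).trans (by gcongr)
  have h3 : ‖u - u₀‖ ≤ 2 := (norm_sub_le _ _).trans (by rw [hu, hu₀]; norm_num)
  have h4 : c * ‖u - u₀‖ ^ 2 ≤ 2 * c * ‖u - u₀‖ := by
    have := mul_le_mul_of_nonneg_left h3 (mul_nonneg h.nonneg (norm_nonneg (u - u₀)))
    nlinarith
  rw [abs_le] at *
  constructor <;> linarith

lemma C11.mul {ψ φ : E → ℝ} {c d : ℝ} (h : C11 ψ c) (k : C11 φ d) :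
    C11 (fun u => ψ u * φ u) (11 * (c * d)) where
  nonneg := by have := h.nonneg; have := k.nonneg; positivity
  bound u hu := by
    have h0 := h.nonneg
    have k0 := k.nonneg
    rw [abs_mul]
    calc |ψ u| * |φ u| ≤ c * d := mul_le_mul (h.bound u hu) (k.bound u hu) (abs_nonneg _) h0
      _ ≤ 11 * (c * d) := by nlinarith [mul_nonneg h0 k0]
  taylor u₀ hu₀ := by
    have h0 := h.nonneg
    have k0 := k.nonneg
    obtain ⟨p, hp, h'⟩ := h.taylor u₀ hu₀
    obtain ⟨q, hq, k'⟩ := k.taylor u₀ hu₀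
    have b1 := h.bound u₀ hu₀
    have b2 := k.bound u₀ hu₀
    refine ⟨ψ u₀ • q + φ u₀ • p, ?_, fun u hu => ?_⟩
    · refine (norm_add_le _ _).trans ?_
      rw [norm_smul, norm_smul, Real.norm_eq_abs, Real.norm_eq_abs]
      have e1 : |ψ u₀| * ‖q‖ ≤ c * d := mul_le_mul b1 hq (norm_nonneg _) h0
      have e2 : |φ u₀| * ‖p‖ ≤ d * c := mul_le_mul b2 hp (norm_nonneg _) k0
      nlinarith [mul_nonneg h0 k0]
    · have l1 := h.lipschitz hu hu₀
      have l2 := k.lipschitz hu hu₀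
      rw [inner_add_left, real_inner_smul_left, real_inner_smul_left]
      have e : ψ u * φ u - ψ u₀ * φ u₀ - (ψ u₀ * ⟪q, u - u₀⟫ + φ u₀ * ⟪p, u - u₀⟫)
          = ψ u₀ * (φ u - φ u₀ - ⟪q, u - u₀⟫) + φ u₀ * (ψ u - ψ u₀ - ⟪p, u - u₀⟫)
            + (ψ u - ψ u₀) * (φ u - φ u₀) := by ring
      rw [e]
      refine (abs_add_three _ _ _).trans ?_
      rw [abs_mul, abs_mul, abs_mul]
      have e1 : |ψ u₀| * |φ u - φ u₀ - ⟪q, u - u₀⟫| ≤ c * (d * ‖u - u₀‖ ^ 2) :=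
        mul_le_mul b1 (k' u hu) (abs_nonneg _) h0
      have e2 : |φ u₀| * |ψ u - ψ u₀ - ⟪p, u - u₀⟫| ≤ d * (c * ‖u - u₀‖ ^ 2) :=
        mul_le_mul b2 (h' u hu) (abs_nonneg _) k0
      have e3 : |ψ u - ψ u₀| * |φ u - φ u₀| ≤ (3 * c * ‖u - u₀‖) * (3 * d * ‖u - u₀‖) :=
        mul_le_mul l1 l2 (abs_nonneg _) (by positivity)
      nlinarith

/-- Quantitative second order regularity of functions on a subset of the line. -/
structure Quad (s : Set ℝ) (g : ℝ → ℝ) (c : ℝ) : Prop where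
  nonneg : 0 ≤ c
  bound : ∀ x ∈ s, |g x| ≤ c
  taylor : ∀ x ∈ s, ∃ d : ℝ, |d| ≤ c ∧ ∀ y ∈ s, |g y - g x - d * (y - x)| ≤ c * (y - x) ^ 2

lemma C11.comp {ψ : E → ℝ} {c : ℝ} (h : C11 ψ c) {s : Set ℝ} {g : ℝ → ℝ} {d : ℝ} (hg : Quad s g d)
    (hs : ∀ u, ‖u‖ = 1 → ψ u ∈ s) : C11 (fun u => g (ψ u)) (d * (1 + 3 * c) ^ 2) where
  nonneg := mul_nonneg hg.nonneg (sq_nonneg _)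
  bound u hu := (hg.bound _ (hs u hu)).trans (by
    have h0 := h.nonneg
    refine le_mul_of_one_le_right hg.nonneg ?_
    nlinarith)
  taylor u₀ hu₀ := by
    have h0 := h.nonneg
    have g0 := hg.nonneg
    obtain ⟨p, hp, h'⟩ := h.taylor u₀ hu₀
    obtain ⟨e, he, k'⟩ := hg.taylor _ (hs u₀ hu₀)
    refine ⟨e • p, ?_, fun u hu => ?_⟩
    · rw [norm_smul, Real.norm_eq_abs]
      refine mul_le_mul he ?_ (norm_nonneg _) g0
      nlinarith
    · have l := h.lipschitz hu hu₀
      rw [real_inner_smul_left]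
      have e' : g (ψ u) - g (ψ u₀) - e * ⟪p, u - u₀⟫
          = (g (ψ u) - g (ψ u₀) - e * (ψ u - ψ u₀)) + e * (ψ u - ψ u₀ - ⟪p, u - u₀⟫) := by ring
      rw [e']
      refine (abs_add_le _ _).trans ?_
      rw [abs_mul e]
      have e1 := k' _ (hs u hu)
      have e2 : |e| * |ψ u - ψ u₀ - ⟪p, u - u₀⟫| ≤ d * (c * ‖u - u₀‖ ^ 2) :=
        mul_le_mul he (h' u hu) (abs_nonneg _) g0
      have e3 : (ψ u - ψ u₀) ^ 2 ≤ (3 * c * ‖u - u₀‖) ^ 2 := by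
        rw [← sq_abs]; gcongr
      have e4 : d * (ψ u - ψ u₀) ^ 2 ≤ d * (3 * c * ‖u - u₀‖) ^ 2 := by gcongr
      have : 0 ≤ d * ‖u - u₀‖ ^ 2 := by positivity
      nlinarith [mul_nonneg this h0]

/-- A function on the sphere which is supported from below by linear functions. -/
def LinSupp (F : E → ℝ) : Prop :=
  ∀ u₀, ‖u₀‖ = 1 → ∃ q : E, ⟪q, u₀⟫ = F u₀ ∧ ∀ u, ‖u‖ = 1 → ⟪q, u⟫ ≤ F u

lemma LinSupp.add_C11 {F φ : E → ℝ} {c : ℝ} (hF : LinSupp F) (h : C11 φ c) :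
    LinSupp fun u => F u + φ u + 4 * c := by
  intro u₀ hu₀
  obtain ⟨q, hq, hq'⟩ := hF u₀ hu₀
  obtain ⟨p, hp, hp'⟩ := h.taylor u₀ hu₀
  refine ⟨q + p + (φ u₀ + 4 * c - ⟪p, u₀⟫) • u₀, ?_, fun u hu => ?_⟩
  · rw [inner_add_left, inner_add_left, hq, real_inner_smul_left, real_inner_self_eq_norm_sq, hu₀]
    ring
  · rw [inner_add_left, inner_add_left, real_inner_smul_left]
    have h1 := hq' u hu
    have h2 := (abs_le.1 (hp' u hu)).1
    rw [inner_sub_right] at h2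
    have h3 : ‖u - u₀‖ ^ 2 = 2 - 2 * ⟪u₀, u⟫ := by
      rw [norm_sub_sq_real, hu, hu₀, real_inner_comm]; ring
    have h4 : ⟪u₀, u⟫ ≤ 1 := by
      have := (abs_le.1 (abs_real_inner_le_norm u₀ u)).2
      rwa [hu, hu₀, one_mul] at this
    have h5 := (abs_le.1 (h.bound u₀ hu₀)).1
    have h6 : ⟪p, u₀⟫ ≤ c := by
      have := (abs_le.1 (abs_real_inner_le_norm p u₀)).2
      rw [hu₀, mul_one] at this
      exact this.trans hp
    rw [h3] at h2
    nlinarith [mul_nonneg (sub_nonneg.2 h4) (show 0 ≤ φ u₀ + 4 * c - ⟪p, u₀⟫ - 2 * c by linarith)]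

variable [FiniteDimensional ℝ E]

lemma LinSupp.exists_body {F : E → ℝ} (hF : LinSupp F) {C : ℝ} (hb : ∀ u, ‖u‖ = 1 → F u ≤ C) :
    ∃ K : ConvexBody E, ∀ u, ‖u‖ = 1 → supp K u = F u := by
  refine UVal.exists_body ⟨C, hb⟩ hF ?_
  by_cases h : ∃ u₀ : E, ‖u₀‖ = 1
  · obtain ⟨u₀, hu₀⟩ := h
    obtain ⟨q, _, hq⟩ := hF u₀ hu₀
    exact ⟨q, hq⟩
  · exact ⟨0, fun u hu => (h ⟨u, hu⟩).elim⟩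

lemma exists_body_C11 {φ : E → ℝ} {c : ℝ} (h : C11 φ c) :
    ∃ K : ConvexBody E, ∀ u, ‖u‖ = 1 → supp K u = 4 * c + φ u := by
  have hF : LinSupp fun _ : E => (0 : ℝ) := fun u₀ _ => ⟨0, by simp, by simp⟩
  obtain ⟨K, hK⟩ := (hF.add_C11 h).exists_body (C := 5 * c) (fun u hu => by
    have := (abs_le.1 (h.bound u hu)).2
    linarith)
  exact ⟨K, fun u hu => by rw [hK u hu]; ring⟩

/-- Differences of support functions. -/
def DC (φ : E → ℝ) : Prop :=
  ∃ K L : ConvexBody E, ∀ u, ‖u‖ = 1 → φ u = supp K u - supp L u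

open Classical in
/-- The extension of the logarithm to differences of support functions. -/
def rlg (φ : E → ℝ) : BodyAlg E :=
  if h : DC φ then lg h.choose - lg h.choose_spec.choose else 0

lemma rlg_eq {φ : E → ℝ} {K L : ConvexBody E} (h : ∀ u, ‖u‖ = 1 → φ u = supp K u - supp L u) :
    rlg φ = lg K - lg L := by
  have hd : DC φ := ⟨K, L, h⟩
  rw [rlg, dif_pos hd]
  have h' := hd.choose_spec.choose_spec
  set K' := hd.choose
  set L' := hd.choose_spec.choose
  have : K' + L = K + L' := ext_supp fun u hu => by
    rw [supp_add, supp_add]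
    linarith [h u hu, h' u hu]
  have := congrArg lg this
  rw [lg_add, lg_add] at this
  linear_combination this

lemma rlg_supp (K : ConvexBody E) : rlg (supp K) = lg K := by
  rw [rlg_eq (K := K) (L := 0) (fun u _ => by rw [supp_zero, sub_zero])]
  have := lg_add (0 : ConvexBody E) 0
  rw [add_zero] at this
  linear_combination this

lemma rlg_congr {φ ψ : E → ℝ} (h : ∀ u, ‖u‖ = 1 → φ u = ψ u) : rlg φ = rlg ψ := by
  by_cases hd : DC ψ
  · obtain ⟨K, L, e⟩ := hd
    rw [rlg_eq e, rlg_eq fun u hu => (h u hu).trans (e u hu)]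
  · have hd' : ¬ DC φ := fun ⟨K, L, e⟩ => hd ⟨K, L, fun u hu => (h u hu).symm.trans (e u hu)⟩
    rw [rlg, rlg, dif_neg hd, dif_neg hd']

lemma rlg_add {φ ψ : E → ℝ} (h : DC φ) (k : DC ψ) : rlg (fun u => φ u + ψ u) = rlg φ + rlg ψ := by
  obtain ⟨K, L, h⟩ := h
  obtain ⟨K', L', k⟩ := k
  rw [rlg_eq h, rlg_eq k, rlg_eq (K := K + K') (L := L + L')
    (fun u hu => by simp only [supp_add, h u hu, k u hu]; ring), lg_add, lg_add]
  ring

lemma rlg_smul {φ : E → ℝ} (h : DC φ) (a : ℝ) : rlg (fun u => a * φ u) = (a : ℂ) • rlg φ := by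
  obtain ⟨K, L, h⟩ := h
  rcases le_total 0 a with ha | ha
  · rw [rlg_eq h, rlg_eq (K := a • K) (L := a • L)
      (fun u hu => by simp only [supp_smul _ ha, h u hu]; ring), lg_smul _ ha, lg_smul _ ha,
      smul_sub]
  · have ha' : 0 ≤ -a := by linarith
    rw [rlg_eq h, rlg_eq (K := (-a) • L) (L := (-a) • K)
      (fun u hu => by simp only [supp_smul _ ha', h u hu]; ring), lg_smul _ ha',
      lg_smul _ ha']
    push_cast
    module

lemma lg_smul_ballBody (c : ℝ) (hc : 0 ≤ c) {u : E} (hu : ‖u‖ = 1) :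
    supp (c • ballBody E) u = c := by
  rw [supp_smul _ hc, supp_ballBody hu, mul_one]

lemma C11.dc {φ : E → ℝ} {c : ℝ} (h : C11 φ c) : DC φ := by
  obtain ⟨K, hK⟩ := exists_body_C11 h
  have hc : 0 ≤ 4 * c := by linarith [h.nonneg]
  exact ⟨K, (4 * c) • ballBody E, fun u hu => by
    rw [hK u hu, lg_smul_ballBody _ hc hu]; ring⟩

lemma rlg_inner (p : E) : rlg (fun u : E => ⟪p, u⟫) = 0 := by
  let P : ConvexBody E := ⟨{p}, convex_singleton _, isCompact_singleton, singleton_nonempty _⟩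
  have hP : (P : Set E) = {p} := rfl
  have hs : ∀ u, supp P u = ⟪p, u⟫ := fun u => by
    obtain ⟨x, hx, e⟩ := exists_supp_eq P u
    rw [hP, mem_singleton_iff] at hx
    rw [← e, hx]
  have hc : cls P = cls (0 : ConvexBody E) := cls_translate (x := p) (by
    rw [hP, ConvexBody.coe_zero]; simp)
  rw [rlg_eq (K := P) (L := 0) (fun u _ => by rw [hs, supp_zero, sub_zero]), lg_of_cls_eq hc,
    sub_self]

lemma isUnit_cls (K : ConvexBody E) : IsUnit (cls K) := by
  have : IsNilpotent (cls K - 1) := ⟨_, cls_sub_one_pow K⟩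
  simpa using this.isUnit_add_one

open Polynomial in
/-- Functions with disjoint supports multiply to zero. -/
lemma rlg_mul_eq_zero {φ ψ : E → ℝ} {c : ℝ} (hφ : C11 φ c) (hψ : C11 ψ c)
    (h1 : ∀ u, ‖u‖ = 1 → 0 ≤ φ u) (h2 : ∀ u, ‖u‖ = 1 → 0 ≤ ψ u)
    (h0 : ∀ u, ‖u‖ = 1 → φ u * ψ u = 0) : rlg φ * rlg ψ = 0 := by
  have hc := hφ.nonneg
  have hX : ∀ s t : ℝ, ∃ X : ConvexBody E, 0 ≤ s → s ≤ 1 → 0 ≤ t → t ≤ 1 →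
      ∀ u, ‖u‖ = 1 → supp X u = 4 * (c + c) + (s * φ u + t * ψ u) := by
    intro s t
    by_cases h : 0 ≤ s ∧ s ≤ 1 ∧ 0 ≤ t ∧ t ≤ 1
    · obtain ⟨X, hX⟩ := exists_body_C11 (((hφ.smul s).add (hψ.smul t)).mono (c' := c + c) (by
        rw [abs_of_nonneg h.1, abs_of_nonneg h.2.2.1]
        nlinarith))
      exact ⟨X, fun _ _ _ _ => hX⟩
    · exact ⟨0, fun a b c d => (h ⟨a, b, c, d⟩).elim⟩
  choose X hX using hX
  set Z := X 0 0
  have hZ := hX 0 0 le_rfl zero_le_one le_rfl zero_le_one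
  have key : ∀ s t : ℝ, 0 ≤ s → s ≤ 1 → 0 ≤ t → t ≤ 1 →
      (cls (X s 0) - cls Z) * (cls (X 0 t) - cls Z) = 0 := by
    intro s t hs hs1 ht ht1
    have ha := hX s t hs hs1 ht ht1
    have hb := hX s 0 hs hs1 le_rfl zero_le_one
    have hc := hX 0 t le_rfl zero_le_one ht ht1
    have hcase : ∀ u, ‖u‖ = 1 → (φ u = 0 ∨ ψ u = 0) := fun u hu => mul_eq_zero.1 (h0 u hu)
    have hI : (Z : Set E) = (X s 0 : Set E) ∩ X 0 t := coe_inf_of_supp fun u hu => by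
      rw [hZ u hu, hb u hu, hc u hu]
      rcases hcase u hu with h | h
      · rw [h, min_eq_left]
        · ring
        · nlinarith [mul_nonneg ht (h2 u hu)]
      · rw [h, min_eq_right]
        · ring
        · nlinarith [mul_nonneg hs (h1 u hu)]
    have hU : (X s t : Set E) = (X s 0 : Set E) ∪ X 0 t := coe_sup_of_supp (I := Z) (fun u hu => by
      rw [hZ u hu, hb u hu, hc u hu]
      rcases hcase u hu with h | h
      · rw [h, min_eq_left]
        · ring
        · nlinarith [mul_nonneg ht (h2 u hu)]
      · rw [h, min_eq_right]
        · ring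
        · nlinarith [mul_nonneg hs (h1 u hu)]) (fun u hu => by
      rw [ha u hu, hb u hu, hc u hu]
      rcases hcase u hu with h | h
      · rw [h, max_eq_right]
        · ring
        · nlinarith [mul_nonneg ht (h2 u hu)]
      · rw [h, max_eq_left]
        · ring
        · nlinarith [mul_nonneg hs (h1 u hu)])
    have e1 := cls_union hU hI
    have e2 : X s t + Z = X s 0 + X 0 t := ext_supp fun u hu => by
      rw [supp_add, supp_add, ha u hu, hb u hu, hc u hu, hZ u hu]; ring
    have e3 := congrArg cls e2
    rw [cls_add, cls_add] at e3
    linear_combination cls Z * e1 - e3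
  have hsc : ∀ s : ℝ, 0 ≤ s → s ≤ 1 → (∀ x : ConvexBody E, x = X 1 0 → X s 0 + s • Z = s • x + Z) ∧
      X 0 s + s • Z = s • X 0 1 + Z := by
    intro s hs hs1
    constructor
    · rintro x rfl
      refine ext_supp fun u hu => ?_
      rw [supp_add, supp_add, supp_smul _ hs, supp_smul _ hs, hZ u hu,
        hX s 0 hs hs1 le_rfl zero_le_one u hu, hX 1 0 zero_le_one le_rfl le_rfl zero_le_one u hu]
      ring
    · refine ext_supp fun u hu => ?_
      rw [supp_add, supp_add, supp_smul _ hs, supp_smul _ hs, hZ u hu,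
        hX 0 s le_rfl zero_le_one hs hs1 u hu, hX 0 1 le_rfl zero_le_one zero_le_one le_rfl u hu]
      ring
  set P := mink (X 1 0) - mink Z with hP
  set Q := mink (X 0 1) - mink Z with hQ
  have hPQ : ∀ s t : ℝ, 0 ≤ s → s ≤ 1 → 0 ≤ t → t ≤ 1 →
      P.eval (algebraMap ℂ (BodyAlg E) s) * Q.eval (algebraMap ℂ (BodyAlg E) t) = 0 := by
    intro s t hs hs1 ht ht1
    have k := key s t hs hs1 ht ht1
    have k1 := congrArg cls ((hsc s hs hs1).1 _ rfl)
    have k2 := congrArg cls (hsc t ht ht1).2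
    rw [cls_add, cls_add] at k1 k2
    simp only [hP, hQ, eval_sub, eval_mink _ hs, eval_mink _ ht]
    have hz := ((isUnit_cls Z).mul (isUnit_cls Z))
    rw [← hz.mul_right_eq_zero]
    have e1 : cls Z * (cls (s • X 1 0) - cls (s • Z)) = (cls (X s 0) - cls Z) * cls (s • Z) := by
      linear_combination -k1
    have e2 : cls Z * (cls (t • X 0 1) - cls (t • Z)) = (cls (X 0 t) - cls Z) * cls (t • Z) := by
      linear_combination -k2
    calc _ = (cls Z * (cls (s • X 1 0) - cls (s • Z))) *
          (cls Z * (cls (t • X 0 1) - cls (t • Z))) := by ring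
      _ = ((cls (X s 0) - cls Z) * (cls (X 0 t) - cls Z)) * (cls (s • Z) * cls (t • Z)) := by
          rw [e1, e2]; ring
      _ = 0 := by rw [k, zero_mul]
  let S : Set ℂ := (fun x : ℝ => (x : ℂ)) '' Icc 0 1
  have hS : S.Infinite := (Icc_infinite zero_lt_one).image Complex.ofReal_injective.injOn
  have hPt : ∀ t : ℝ, 0 ≤ t → t ≤ 1 → P.coeff 1 * Q.eval (algebraMap ℂ (BodyAlg E) t) = 0 := by
    intro t ht ht1
    have : P * C (Q.eval (algebraMap ℂ (BodyAlg E) t)) = 0 := by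
      refine poly_unique hS ?_
      rintro _ ⟨s, hs, rfl⟩
      rw [eval_mul, eval_C, eval_zero, hPQ s t hs.1 hs.2 ht ht1]
    have := congrArg (fun p => coeff p 1) this
    simpa using this
  have hQ' : C (P.coeff 1) * Q = 0 := by
    refine poly_unique hS ?_
    rintro _ ⟨t, ht, rfl⟩
    rw [eval_mul, eval_C, eval_zero, hPt t ht.1 ht.2]
  have hfin : P.coeff 1 * Q.coeff 1 = 0 := by
    have := congrArg (fun p => coeff p 1) hQ'
    simpa using this
  have eP : rlg φ = P.coeff 1 := by
    rw [hP, coeff_sub]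
    refine rlg_eq fun u hu => ?_
    rw [hX 1 0 zero_le_one le_rfl le_rfl zero_le_one u hu, hZ u hu]
    ring
  have eQ : rlg ψ = Q.coeff 1 := by
    rw [hQ, coeff_sub]
    refine rlg_eq fun u hu => ?_
    rw [hX 0 1 le_rfl zero_le_one zero_le_one le_rfl u hu, hZ u hu]
    ring
  rw [eP, eQ, hfin]

/-- Functions multiplied by cutoffs with disjoint supports. -/
lemma rlg_mul_eq_zero_of_cutoff {f g χ ω : E → ℝ} {a b c d : ℝ} (hf : C11 f a) (hg : C11 g b)
    (hχ : C11 χ c) (hω : C11 ω d) (h1 : ∀ u, ‖u‖ = 1 → 0 ≤ χ u) (h2 : ∀ u, ‖u‖ = 1 → 0 ≤ ω u)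
    (h0 : ∀ u, ‖u‖ = 1 → χ u * ω u = 0) :
    rlg (fun u => f u * χ u) * rlg (fun u => g u * ω u) = 0 := by
  have pos : ∀ {f : E → ℝ} {a : ℝ}, C11 f a → ∀ u, ‖u‖ = 1 → 0 ≤ f u + a := fun h u hu => by
    linarith [(abs_le.1 (h.bound u hu)).1]
  have base : ∀ {f g : E → ℝ} {a b : ℝ}, C11 f a → C11 g b → (∀ u, ‖u‖ = 1 → 0 ≤ f u) →
      (∀ u, ‖u‖ = 1 → 0 ≤ g u) → rlg (fun u => f u * χ u) * rlg (fun u => g u * ω u) = 0 := by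
    intro f g a b hf hg hf0 hg0
    refine rlg_mul_eq_zero (c := max (11 * (a * c)) (11 * (b * d)))
      ((hf.mul hχ).mono (le_max_left _ _)) ((hg.mul hω).mono (le_max_right _ _))
      (fun u hu => mul_nonneg (hf0 u hu) (h1 u hu)) (fun u hu => mul_nonneg (hg0 u hu) (h2 u hu))
      fun u hu => ?_
    have := h0 u hu
    linear_combination f u * g u * this
  have split : ∀ {f χ : E → ℝ} {a c : ℝ}, C11 f a → C11 χ c → rlg (fun u => f u * χ u)
      = rlg (fun u => (f u + a) * χ u) - rlg (fun u => a * χ u) := by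
    intro f χ a c hf hχ
    have h : (fun u => (f u + a) * χ u) = fun u => f u * χ u + a * χ u := by ext; ring
    rw [h, rlg_add (hf.mul hχ).dc (hχ.smul a).dc]
    ring
  have ca : C11 (fun _ : E => a) |a| := C11.const a
  have cb : C11 (fun _ : E => b) |b| := C11.const b
  have hfa := hf.add ca
  have hgb := hg.add cb
  rw [split hf hχ, split hg hω]
  have e1 := base hfa hgb (pos hf) (pos hg)
  have e2 := base hfa cb (pos hf) (fun _ _ => hg.nonneg)
  have e3 := base ca hgb (fun _ _ => hf.nonneg) (pos hg)
  have e4 := base ca cb (fun _ _ => hf.nonneg) (fun _ _ => hg.nonneg)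
  linear_combination e1 - e2 - e3 + e4

lemma tendsto_ev_rlg_mul {ν : ConvexBody E → ℂ} (hν : IsVal ν) {φ ψ : ℕ → E → ℝ} {c : ℝ}
    (hφ : ∀ q, C11 (φ q) c) (hψ : ∀ q, C11 (ψ q) c) {ε : ℕ → ℝ} (hε : Tendsto ε atTop (𝓝 0))
    (h1 : ∀ q u, ‖u‖ = 1 → |φ q u| ≤ ε q) (h2 : ∀ q u, ‖u‖ = 1 → |ψ q u| ≤ ε q) :
    Tendsto (fun q => ev ν hν (rlg (φ q) * rlg (ψ q))) atTop (𝓝 0) := by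
  choose A hA using fun q => exists_body_C11 (hφ q)
  choose B hB using fun q => exists_body_C11 (hψ q)
  have hc : 0 ≤ 4 * c := by linarith [(hφ 0).nonneg]
  set Z := (4 * c) • ballBody E with hZ
  have hZs : ∀ u, ‖u‖ = 1 → supp Z u = 4 * c := fun u hu => lg_smul_ballBody _ hc hu
  have hlim : ∀ {φ : ℕ → E → ℝ} {A : ℕ → ConvexBody E}, (∀ q u, ‖u‖ = 1 → |φ q u| ≤ ε q) →
      (∀ q u, ‖u‖ = 1 → supp (A q) u = 4 * c + φ q u) → Tendsto A atTop (𝓝 Z) := by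
    intro φ A h hA
    rw [tendsto_iff_dist_tendsto_zero]
    have := hε.abs
    rw [abs_zero] at this
    refine squeeze_zero (fun _ => dist_nonneg) (fun q => ?_) this
    refine dist_le_of_supp (abs_nonneg _) fun u hu => ?_
    rw [hA q u hu, hZs u hu, add_sub_cancel_left]
    exact (h q u hu).trans (le_abs_self _)
  have lA := hlim h1 hA
  have lB := hlim h2 hB
  have hcont : Continuous fun K : ConvexBody E × ConvexBody E => ev ν hν (lg K.1 * lg K.2) := by
    simp only [lg_eq_aeval]
    exact continuous_ev_aeval_mul_aeval hν _ _
  have e : ∀ q, ev ν hν (rlg (φ q) * rlg (ψ q)) = ev ν hν (lg (A q) * lg (B q))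
      - ev ν hν (lg (A q) * lg Z) - ev ν hν (lg Z * lg (B q)) + ev ν hν (lg Z * lg Z) := by
    intro q
    rw [rlg_eq (K := A q) (L := Z) (fun u hu => by rw [hA q u hu, hZs u hu]; ring),
      rlg_eq (K := B q) (L := Z) (fun u hu => by rw [hB q u hu, hZs u hu]; ring), ← map_sub,
      ← map_sub, ← map_add]
    congr 1
    ring
  have t1 := (hcont.tendsto (Z, Z)).comp (lA.prodMk_nhds lB)
  have t2 := (hcont.tendsto (Z, Z)).comp (lA.prodMk_nhds (tendsto_const_nhds (x := Z)))
  have t3 := (hcont.tendsto (Z, Z)).comp ((tendsto_const_nhds (x := Z)).prodMk_nhds lB)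
  have := ((t1.sub t2).sub t3).add_const (ev ν hν (lg Z * lg Z))
  simp only [sub_self, zero_sub, neg_add_cancel] at this
  exact this.congr fun q => (e q).symm

end C11

section Line

lemma taylor_bound {s : Set ℝ} (hs : Convex ℝ s) {g g' g'' : ℝ → ℝ} {C : ℝ}
    (h1 : ∀ x ∈ s, HasDerivWithinAt g (g' x) s x) (h2 : ∀ x ∈ s, HasDerivWithinAt g' (g'' x) s x)
    (hb : ∀ x ∈ s, |g'' x| ≤ C) {x y : ℝ} (hx : x ∈ s) (hy : y ∈ s) :
    |g y - g x - g' x * (y - x)| ≤ C * (y - x) ^ 2 := by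
  have hC : 0 ≤ C := (abs_nonneg _).trans (hb x hx)
  have hseg : segment ℝ x y ⊆ s := hs.segment_subset hx hy
  have l : ∀ z ∈ segment ℝ x y, ‖g' z - g' x‖ ≤ C * |y - x| := by
    intro z hz
    have := hs.norm_image_sub_le_of_norm_hasDerivWithin_le (f := g') (f' := g'') h2 hb hx (hseg hz)
    refine this.trans ?_
    gcongr
    rw [Real.norm_eq_abs]
    rw [segment_eq_uIcc] at hz
    exact abs_sub_left_of_mem_uIcc hz
  have := (convex_segment x y).norm_image_sub_le_of_norm_hasDerivWithin_le
    (f := fun z => g z - g' x * z) (f' := fun z => g' z - g' x) (C := C * |y - x|) (fun z hz => by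
      have := ((h1 z (hseg hz)).mono hseg).fun_sub
        (((hasDerivWithinAt_id z (segment ℝ x y))).const_mul (g' x))
      simpa using this) l (left_mem_segment ℝ x y) (right_mem_segment ℝ x y)
  rw [Real.norm_eq_abs, Real.norm_eq_abs, mul_assoc, ← sq, sq_abs] at this
  calc _ = |g y - g' x * y - (g x - g' x * x)| := by ring_nf
    _ ≤ _ := this

/-- Smooth bump functions vanishing outside `[-1, 1]`. -/
structure Bump (κ : ℝ → ℝ) : Prop where
  smooth : ContDiff ℝ 2 κ
  zero : ∀ x, 1 ≤ |x| → κ x = 0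

lemma Bump.exists_bound {κ : ℝ → ℝ} (h : Bump κ) : ∃ (C : ℝ) (κ' : ℝ → ℝ), 0 ≤ C ∧
    (∀ x, |κ x| ≤ C) ∧ (∀ x, |κ' x| ≤ C) ∧ (∀ x, 3 / 2 ≤ |x| → κ' x = 0) ∧
    ∀ x y, |κ y - κ x - κ' x * (y - x)| ≤ C * (y - x) ^ 2 := by
  have hz : ∀ x, 3 / 2 ≤ |x| → κ =ᶠ[𝓝 x] fun _ => 0 := by
    intro x hx
    filter_upwards [(continuous_abs.isOpen_preimage _ (isOpen_Ioi (a := (1 : ℝ)))).mem_nhds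
      (show x ∈ abs ⁻¹' Ioi (1 : ℝ) by simp only [mem_preimage, mem_Ioi]; linarith)] with y hy
    exact h.zero y (le_of_lt hy)
  have h0 : ∀ x, 3 / 2 ≤ |x| → κ x = 0 := fun x hx => (hz x hx).eq_of_nhds
  have h1 : ∀ x, 3 / 2 ≤ |x| → deriv κ x = 0 := fun x hx => by
    rw [(hz x hx).deriv_eq]; simp
  have h2 : ∀ x, 3 / 2 ≤ |x| → deriv (deriv κ) x = 0 := fun x hx => by
    rw [((hz x hx).deriv).deriv_eq]; simp
  have d1 : ContDiff ℝ 1 (deriv κ) := h.smooth.deriv'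
  have d2 : Continuous (deriv (deriv κ)) := d1.continuous_deriv le_rfl
  have bd : ∀ f : ℝ → ℝ, Continuous f → (∀ x, 3 / 2 ≤ |x| → f x = 0) → ∃ C, ∀ x, |f x| ≤ C := by
    intro f hf h
    obtain ⟨C, hC⟩ := (isCompact_Icc (a := (-3 / 2 : ℝ)) (b := 3 / 2)).exists_bound_of_continuousOn
      hf.continuousOn
    refine ⟨max C 0, fun x => ?_⟩
    by_cases hx : 3 / 2 ≤ |x|
    · rw [h x hx, abs_zero]; exact le_max_right _ _
    · rw [not_le, abs_lt] at hx
      exact (hC x ⟨by linarith, by linarith⟩).trans (le_max_left _ _)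
  obtain ⟨C0, b0⟩ := bd κ h.smooth.continuous h0
  obtain ⟨C1, b1⟩ := bd _ d1.continuous h1
  obtain ⟨C2, b2⟩ := bd _ d2 h2
  have p0 := (abs_nonneg _).trans (b0 0)
  have p1 := (abs_nonneg _).trans (b1 0)
  have p2 := (abs_nonneg _).trans (b2 0)
  refine ⟨C0 + C1 + C2, deriv κ, by positivity, fun x => (b0 x).trans (by linarith),
    fun x => (b1 x).trans (by linarith), h1, fun x y => ?_⟩
  refine (taylor_bound convex_univ (g := κ) (g' := deriv κ) (g'' := deriv (deriv κ))
    (fun x _ => ((h.smooth.differentiable (by norm_num)) x).hasDerivAt.hasDerivWithinAt)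
    (fun x _ => ((d1.differentiable (by norm_num)) x).hasDerivAt.hasDerivWithinAt)
    (fun x _ => b2 x) (mem_univ x) (mem_univ y)).trans ?_
  gcongr
  linarith

lemma abs_sum_le_of_sparse {ι : Type*} (J : Finset ι) (a : ι → ℝ) (P : ι → Prop)
    (h0 : ∀ j ∈ J, ¬ P j → a j = 0) (hP : ∀ i ∈ J, ∀ j ∈ J, P i → P j → i = j) {C : ℝ}
    (hC : 0 ≤ C) (ha : ∀ j ∈ J, |a j| ≤ C) : |∑ j ∈ J, a j| ≤ C := by
  by_cases h : ∃ i ∈ J, P i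
  · obtain ⟨i, hi, hPi⟩ := h
    rw [Finset.sum_eq_single i]
    · exact ha i hi
    · intro j hj hji
      exact h0 j hj fun hPj => hji (hP j hj i hi hPj hPi)
    · exact fun h => (h hi).elim
  · push Not at h
    rw [Finset.sum_eq_zero fun j hj => h0 j hj (h j hj), abs_zero]
    exact hC

/-- A sum of translates of a bump function by multiples of three. -/
def comb (κ : ℝ → ℝ) (N c : ℕ) (x : ℝ) : ℝ :=
  ∑ j ∈ Finset.range (2 * N), κ (x - ((c + 3 * j - 3 * N : ℤ) : ℝ))

lemma Bump.quad_comb {κ : ℝ → ℝ} (h : Bump κ) : ∃ C : ℝ, 0 ≤ C ∧ ∀ (N c : ℕ) (q : ℝ), 1 ≤ q →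
    Quad univ (fun x => q⁻¹ ^ 2 * comb κ N c (q * x)) C ∧ ∀ x, |comb κ N c x| ≤ C := by
  obtain ⟨C, κ', hC, b0, b1, z1, ht⟩ := h.exists_bound
  have z0 : ∀ x, 3 / 2 ≤ |x| → κ x = 0 := fun x hx => h.zero x (by linarith)
  refine ⟨2 * C, by positivity, fun N c q hq => ?_⟩
  set p : ℕ → ℝ := fun j => ((c + 3 * j - 3 * N : ℤ) : ℝ) with hp
  have sep : ∀ x, ∀ i ∈ Finset.range (2 * N), ∀ j ∈ Finset.range (2 * N),
      ¬ 3 / 2 ≤ |x - p i| → ¬ 3 / 2 ≤ |x - p j| → i = j := by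
    intro x i _ j _ hi hj
    rw [not_le, abs_lt] at hi hj
    have e1 : p i - p j = 3 * ((i : ℝ) - j) := by simp only [hp]; push_cast; ring
    have l1 : ((i : ℝ) - j) < 1 := by linarith
    have l2 : -1 < ((i : ℝ) - j) := by linarith
    have l1' : (i : ℤ) - j < 1 := by exact_mod_cast l1
    have l2' : -1 < (i : ℤ) - j := by exact_mod_cast l2
    omega
  have B : ∀ x, |comb κ N c x| ≤ C := fun x =>
    abs_sum_le_of_sparse _ _ (fun j => ¬ 3 / 2 ≤ |x - p j|)
      (fun j _ hj => z0 _ (not_not.1 hj)) (sep x) hC fun j _ => b0 _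
  have qi : q⁻¹ ≤ 1 := inv_le_one_of_one_le₀ hq
  have q0 : 0 < q := by linarith
  have q1 : 0 ≤ q⁻¹ := by positivity
  refine ⟨⟨by positivity, fun x _ => ?_, fun x _ => ?_⟩, fun x => (B x).trans (by linarith)⟩
  · rw [abs_mul, abs_of_nonneg (by positivity)]
    have := B (q * x)
    have h2 : q⁻¹ ^ 2 ≤ 1 := pow_le_one₀ q1 qi
    nlinarith [abs_nonneg (comb κ N c (q * x))]
  · refine ⟨q⁻¹ * ∑ j ∈ Finset.range (2 * N), κ' (q * x - p j), ?_, fun y _ => ?_⟩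
    · rw [abs_mul, abs_of_nonneg q1]
      have := abs_sum_le_of_sparse (Finset.range (2 * N)) (fun j => κ' (q * x - p j))
        (fun j => ¬ 3 / 2 ≤ |q * x - p j|)
        (fun j _ hj => z1 _ (not_not.1 hj)) (sep (q * x)) hC fun j _ => b1 _
      nlinarith [abs_nonneg (∑ j ∈ Finset.range (2 * N), κ' (q * x - p j))]
    · have e : q⁻¹ ^ 2 * comb κ N c (q * y) - q⁻¹ ^ 2 * comb κ N c (q * x)
          - q⁻¹ * (∑ j ∈ Finset.range (2 * N), κ' (q * x - p j)) * (y - x)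
          = q⁻¹ ^ 2 * ∑ j ∈ Finset.range (2 * N), (κ (q * y - p j) - κ (q * x - p j)
            - κ' (q * x - p j) * (q * y - q * x)) := by
        simp only [Finset.sum_sub_distrib, ← Finset.sum_mul, comb]
        field_simp
        ring
      rw [e, abs_mul, abs_of_nonneg (by positivity)]
      have key : |∑ j ∈ Finset.range (2 * N), (κ (q * y - p j) - κ (q * x - p j)
            - κ' (q * x - p j) * (q * y - q * x))| ≤ 2 * (C * (q * y - q * x) ^ 2) := by
        classical
        have t : ∀ j, |κ (q * y - p j) - κ (q * x - p j) - κ' (q * x - p j) * (q * y - q * x)|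
            ≤ C * (q * y - q * x) ^ 2 := fun j => by
          have := ht (q * x - p j) (q * y - p j)
          rwa [sub_sub_sub_cancel_right] at this
        rw [← Finset.sum_filter_add_sum_filter_not (Finset.range (2 * N))
          (fun j => 3 / 2 ≤ |q * x - p j|)]
        refine (abs_add_le _ _).trans ?_
        rw [two_mul (C * (q * y - q * x) ^ 2)]
        refine add_le_add ?_ ?_
        · refine abs_sum_le_of_sparse _ _ (fun j => ¬ 3 / 2 ≤ |q * y - p j|) ?_ ?_
            (by positivity) fun j _ => t j
          · intro j hj hj'
            have hx := (Finset.mem_filter.1 hj).2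
            rw [z0 _ hx, z0 _ (not_not.1 hj'), z1 _ hx]
            ring
          · exact fun i hi j hj => sep _ i (Finset.mem_filter.1 hi).1 j (Finset.mem_filter.1 hj).1
        · refine abs_sum_le_of_sparse _ _ (fun _ => True) (fun _ _ h => (h trivial).elim) ?_
            (by positivity) fun j _ => t j
          exact fun i hi j hj _ _ => sep _ i (Finset.mem_filter.1 hi).1 j (Finset.mem_filter.1 hj).1
            (Finset.mem_filter.1 hi).2 (Finset.mem_filter.1 hj).2
      calc q⁻¹ ^ 2 * _ ≤ q⁻¹ ^ 2 * (2 * (C * (q * y - q * x) ^ 2)) := by gcongr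
        _ = 2 * C * (y - x) ^ 2 := by field_simp

/-- A smooth bump function whose integer translates sum up to one. -/
def bump (x : ℝ) : ℝ := Real.smoothTransition (x + 1) - Real.smoothTransition x

lemma bump_nonneg (x : ℝ) : 0 ≤ bump x := by
  rw [bump]
  rcases le_total x 0 with h | h
  · rw [Real.smoothTransition.zero_of_nonpos h, sub_zero]
    exact Real.smoothTransition.nonneg _
  · rw [Real.smoothTransition.one_of_one_le (by linarith)]
    linarith [Real.smoothTransition.le_one x]

lemma bump_zero {x : ℝ} (h : 1 ≤ |x|) : bump x = 0 := by
  rw [bump]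
  rcases le_abs.1 h with h | h
  · rw [Real.smoothTransition.one_of_one_le h, Real.smoothTransition.one_of_one_le (by linarith),
      sub_self]
  · rw [Real.smoothTransition.zero_of_nonpos (by linarith),
      Real.smoothTransition.zero_of_nonpos (by linarith), sub_self]

/-- The bump function multiplied by a power. -/
def pbump (m : ℕ) (d : ℤ) (x : ℝ) : ℝ := (x + d) ^ m * bump x

lemma bump_pbump (m : ℕ) (d : ℤ) : Bump (pbump m d) where
  smooth := by
    unfold pbump bump
    have h := Real.smoothTransition.contDiff (n := 2)
    have h1 : ContDiff ℝ 2 fun x : ℝ => Real.smoothTransition (x + 1) :=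
      h.comp (contDiff_id.add contDiff_const)
    exact ((contDiff_id.add contDiff_const).pow m).mul (h1.sub h)
  zero x hx := by rw [pbump, bump_zero hx, mul_zero]

lemma sum_bump {N : ℕ} {x : ℝ} (hx : |x| ≤ 3 * N - 1) :
    ∑ c ∈ Finset.range 3, ∑ j ∈ Finset.range (2 * N),
      bump (x - ((c + 3 * j - 3 * N : ℤ) : ℝ)) = 1 := by
  rw [Finset.sum_comm]
  have e : ∀ j : ℕ, ∑ c ∈ Finset.range 3, bump (x - ((c + 3 * j - 3 * N : ℤ) : ℝ))
      = Real.smoothTransition (x - 3 * j + 3 * N + 1)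
        - Real.smoothTransition (x - 3 * (j + 1 : ℕ) + 3 * N + 1) := by
    intro j
    simp only [Finset.sum_range_succ, Finset.sum_range_zero, bump]
    push_cast
    ring_nf
  simp only [e]
  rw [Finset.sum_range_sub']
  rw [abs_le] at hx
  push_cast
  rw [Real.smoothTransition.one_of_one_le (by linarith),
    Real.smoothTransition.zero_of_nonpos (by linarith), sub_zero]

end Line

open scoped TensorProduct

lemma Bump.quad {κ : ℝ → ℝ} (h : Bump κ) : ∃ C, Quad univ κ C := by
  obtain ⟨C, κ', hC, b0, b1, -, ht⟩ := h.exists_bound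
  exact ⟨C, hC, fun x _ => b0 x, fun x _ => ⟨κ' x, b1 x, fun y _ => ht x y⟩⟩

section Reg

variable {E : Type*} [NormedAddCommGroup E] [InnerProductSpace ℝ E]

/-- Real functions on the unit sphere which are regular to second order. -/
def RReg (f : sphere (0 : E) 1 → ℝ) : Prop := ∃ (φ : E → ℝ) (c : ℝ), C11 φ c ∧ ∀ u, f u = φ u

lemma RReg.add {f g : sphere (0 : E) 1 → ℝ} (hf : RReg f) (hg : RReg g) : RReg (f + g) := by
  obtain ⟨φ, c, h, e⟩ := hf
  obtain ⟨ψ, d, k, e'⟩ := hg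
  exact ⟨_, _, h.add k, fun u => by rw [Pi.add_apply, e, e']⟩

lemma RReg.mul {f g : sphere (0 : E) 1 → ℝ} (hf : RReg f) (hg : RReg g) : RReg (f * g) := by
  obtain ⟨φ, c, h, e⟩ := hf
  obtain ⟨ψ, d, k, e'⟩ := hg
  exact ⟨_, _, h.mul k, fun u => by rw [Pi.mul_apply, e, e']⟩

lemma RReg.const (a : ℝ) : RReg (fun _ : sphere (0 : E) 1 => a) :=
  ⟨_, _, C11.const a, fun _ => rfl⟩

lemma RReg.smul {f : sphere (0 : E) 1 → ℝ} (hf : RReg f) (a : ℝ) : RReg (fun u => a * f u) :=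
  (RReg.const a).mul hf

lemma RReg.neg {f : sphere (0 : E) 1 → ℝ} (hf : RReg f) : RReg (-f) := by
  obtain ⟨φ, c, h, e⟩ := hf
  exact ⟨_, _, h.neg, fun u => by rw [Pi.neg_apply, e]⟩

lemma RReg.sub {f g : sphere (0 : E) 1 → ℝ} (hf : RReg f) (hg : RReg g) : RReg (f - g) := by
  rw [sub_eq_add_neg]; exact hf.add hg.neg

/-- The algebra of complex functions on the unit sphere which are regular to second order. -/
def Reg (E : Type*) [NormedAddCommGroup E] [InnerProductSpace ℝ E] :
    Subalgebra ℂ (sphere (0 : E) 1 → ℂ) where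
  carrier := {f | RReg (fun u => (f u).re) ∧ RReg (fun u => (f u).im)}
  mul_mem' {f g} hf hg := by
    constructor
    · exact ((hf.1.mul hg.1).sub (hf.2.mul hg.2) :)
    · exact ((hf.1.mul hg.2).add (hf.2.mul hg.1) :)
  add_mem' {f g} hf hg := ⟨hf.1.add hg.1, hf.2.add hg.2⟩
  algebraMap_mem' r := ⟨RReg.const r.re, RReg.const r.im⟩

lemma mem_Reg {f : sphere (0 : E) 1 → ℂ} :
    f ∈ Reg E ↔ RReg (fun u => (f u).re) ∧ RReg (fun u => (f u).im) := Iff.rfl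

/-- A real regular function as an element of the complex algebra. -/
def rc (φ : E → ℝ) (h : ∃ c, C11 φ c) : Reg E :=
  ⟨fun u => (φ u : ℂ), mem_Reg.2 ⟨⟨φ, h.choose, h.choose_spec, fun _ => Complex.ofReal_re _⟩,
    by simpa using RReg.const 0⟩⟩

@[simp] lemma rc_apply (φ : E → ℝ) (h : ∃ c, C11 φ c) (u : sphere (0 : E) 1) :
    (rc φ h : sphere (0 : E) 1 → ℂ) u = φ u := rfl

lemma exists_rc (f : Reg E) : ∃ φ ψ : E → ℝ, ∃ h k, f = rc φ h + Complex.I • rc ψ k := by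
  obtain ⟨φ, c, h, e⟩ := (mem_Reg.1 f.2).1
  obtain ⟨ψ, d, k, e'⟩ := (mem_Reg.1 f.2).2
  refine ⟨φ, ψ, ⟨c, h⟩, ⟨d, k⟩, ?_⟩
  ext u
  simp only [Subalgebra.coe_add, Subalgebra.coe_smul, Pi.add_apply, rc_apply, Pi.smul_apply,
    smul_eq_mul]
  rw [← e, ← e', mul_comm, Complex.re_add_im]

variable [FiniteDimensional ℝ E]

/-- `rlg` for functions defined on the sphere. -/
def slg (f : sphere (0 : E) 1 → ℝ) : BodyAlg E := rlg (Function.extend (↑) f 0)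

lemma slg_eq {f : sphere (0 : E) 1 → ℝ} {φ : E → ℝ} (h : ∀ u, f u = φ u) : slg f = rlg φ :=
  rlg_congr fun u hu => by
    have : u = ((⟨u, by simpa using hu⟩ : sphere (0 : E) 1) : E) := rfl
    rw [this, Subtype.val_injective.extend_apply, h]

lemma slg_add {f g : sphere (0 : E) 1 → ℝ} (hf : RReg f) (hg : RReg g) :
    slg (f + g) = slg f + slg g := by
  obtain ⟨φ, c, h, e⟩ := hf
  obtain ⟨ψ, d, k, e'⟩ := hg
  rw [slg_eq e, slg_eq e', ← rlg_add h.dc k.dc]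
  exact slg_eq fun u => by rw [Pi.add_apply, e, e']

lemma slg_smul {f : sphere (0 : E) 1 → ℝ} (hf : RReg f) (a : ℝ) :
    slg (fun u => a * f u) = (a : ℂ) • slg f := by
  obtain ⟨φ, c, h, e⟩ := hf
  rw [slg_eq e, ← rlg_smul h.dc a]
  exact slg_eq fun u => by rw [e]

/-- The complex linear extension of `rlg`. -/
def cl : Reg E →ₗ[ℂ] BodyAlg E where
  toFun f := slg (fun u => ((f : sphere (0 : E) 1 → ℂ) u).re)
    + Complex.I • slg (fun u => ((f : sphere (0 : E) 1 → ℂ) u).im)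
  map_add' f g := by
    have h1 := slg_add (mem_Reg.1 f.2).1 (mem_Reg.1 g.2).1
    have h2 := slg_add (mem_Reg.1 f.2).2 (mem_Reg.1 g.2).2
    have e1 : (fun u => (((f + g : Reg E) : sphere (0 : E) 1 → ℂ) u).re)
      = (fun u => ((f : sphere (0 : E) 1 → ℂ) u).re)
        + fun u => ((g : sphere (0 : E) 1 → ℂ) u).re := rfl
    have e2 : (fun u => (((f + g : Reg E) : sphere (0 : E) 1 → ℂ) u).im)
      = (fun u => ((f : sphere (0 : E) 1 → ℂ) u).im)
        + fun u => ((g : sphere (0 : E) 1 → ℂ) u).im := rfl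
    rw [e1, e2, h1, h2, smul_add]
    abel
  map_smul' a f := by
    have e1 : (fun u => (((a • f : Reg E) : sphere (0 : E) 1 → ℂ) u).re)
      = (fun u => a.re * ((f : sphere (0 : E) 1 → ℂ) u).re)
        + fun u => (-a.im) * ((f : sphere (0 : E) 1 → ℂ) u).im := by
      ext u
      simp [sub_eq_add_neg]
    have e2 : (fun u => (((a • f : Reg E) : sphere (0 : E) 1 → ℂ) u).im)
      = (fun u => a.re * ((f : sphere (0 : E) 1 → ℂ) u).im)
        + fun u => a.im * ((f : sphere (0 : E) 1 → ℂ) u).re := by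
      ext u
      simp
    rw [e1, e2, slg_add (RReg.smul (mem_Reg.1 f.2).1 _) (RReg.smul (mem_Reg.1 f.2).2 _),
      slg_add (RReg.smul (mem_Reg.1 f.2).2 _) (RReg.smul (mem_Reg.1 f.2).1 _), slg_smul (mem_Reg.1 f.2).1,
      slg_smul (mem_Reg.1 f.2).2, slg_smul (mem_Reg.1 f.2).1, slg_smul (mem_Reg.1 f.2).2, RingHom.id_apply]
    conv_rhs => rw [← Complex.re_add_im a]
    simp only [smul_add, smul_smul, add_smul]
    have : (a.im : ℂ) * Complex.I * Complex.I = ((-a.im : ℝ) : ℂ) := by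
      rw [mul_assoc, Complex.I_mul_I]; push_cast; ring
    rw [add_mul, this, mul_comm Complex.I (a.re : ℂ), mul_comm Complex.I (a.im : ℂ), add_smul]
    abel

lemma cl_rc (φ : E → ℝ) (h : ∃ c, C11 φ c) : cl (rc φ h) = rlg φ := by
  change slg _ + Complex.I • slg _ = _
  rw [slg_eq (f := fun u => ((rc φ h : sphere (0 : E) 1 → ℂ) u).re) (φ := φ) fun u => by simp]
  have : slg (fun u => ((rc φ h : sphere (0 : E) 1 → ℂ) u).im) = 0 := by
    have h0 : slg (fun u => ((rc φ h : sphere (0 : E) 1 → ℂ) u).im)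
        = rlg (fun u : E => ⟪(0 : E), u⟫) := slg_eq fun u => by simp
    rw [h0, rlg_inner]
  rw [this, smul_zero, add_zero]

/-- The product of two values of `cl`, on the tensor square. -/
def cl₂ : Reg E ⊗[ℂ] Reg E →ₗ[ℂ] BodyAlg E :=
  TensorProduct.lift ((LinearMap.mul ℂ (BodyAlg E)).compl₁₂ cl cl)

@[simp] lemma cl₂_tmul (f g : Reg E) : cl₂ (f ⊗ₜ g) = cl f * cl g := rfl

lemma cl_mul_eq_zero_of_cutoff {χ ω : E → ℝ} (hχ : ∃ c, C11 χ c) (hω : ∃ c, C11 ω c)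
    (h1 : ∀ u, ‖u‖ = 1 → 0 ≤ χ u) (h2 : ∀ u, ‖u‖ = 1 → 0 ≤ ω u)
    (h0 : ∀ u, ‖u‖ = 1 → χ u * ω u = 0) (f g : Reg E) :
    cl (f * rc χ hχ) * cl (g * rc ω hω) = 0 := by
  have base : ∀ (φ ψ : E → ℝ) (h : ∃ c, C11 φ c) (k : ∃ c, C11 ψ c),
      cl (rc φ h * rc χ hχ) * cl (rc ψ k * rc ω hω) = 0 := by
    intro φ ψ h k
    have e1 : rc φ h * rc χ hχ = rc (fun u => φ u * χ u) ⟨_, h.choose_spec.mul hχ.choose_spec⟩ := by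
      ext u; simp
    have e2 : rc ψ k * rc ω hω = rc (fun u => ψ u * ω u) ⟨_, k.choose_spec.mul hω.choose_spec⟩ := by
      ext u; simp
    rw [e1, e2, cl_rc, cl_rc]
    exact rlg_mul_eq_zero_of_cutoff h.choose_spec k.choose_spec hχ.choose_spec hω.choose_spec
      h1 h2 h0
  obtain ⟨φ, ψ, h, k, rfl⟩ := exists_rc f
  obtain ⟨φ', ψ', h', k', rfl⟩ := exists_rc g
  simp only [add_mul, mul_add, smul_mul_assoc, map_add, map_smul, mul_smul_comm, base, smul_zero,
    add_zero]

lemma cl₂_mul_eq_zero_of_cutoff {χ ω : E → ℝ} (hχ : ∃ c, C11 χ c) (hω : ∃ c, C11 ω c)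
    (h1 : ∀ u, ‖u‖ = 1 → 0 ≤ χ u) (h2 : ∀ u, ‖u‖ = 1 → 0 ≤ ω u)
    (h0 : ∀ u, ‖u‖ = 1 → χ u * ω u = 0) (W : Reg E ⊗[ℂ] Reg E) :
    cl₂ (W * (rc χ hχ ⊗ₜ rc ω hω)) = 0 := by
  induction W with
  | zero => rw [zero_mul, map_zero]
  | tmul f g =>
    rw [Algebra.TensorProduct.tmul_mul_tmul, cl₂_tmul]
    exact cl_mul_eq_zero_of_cutoff hχ hω h1 h2 h0 f g
  | add x y hx hy => rw [add_mul, map_add, hx, hy, add_zero]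

end Reg

lemma bump_bump : Bump bump := by
  have := bump_pbump 0 0
  have e : pbump 0 0 = bump := by ext x; simp [pbump]
  rwa [e] at this

section Square
variable {A : Type*} [CommRing A] [Algebra ℂ A]

/-- The difference of two functions of the two factors, in the tensor square. -/
def diff₂ (x y : A) : A ⊗[ℂ] A := x ⊗ₜ 1 - 1 ⊗ₜ y

lemma diff₂_shift (x y : A) (p p' d : ℤ) (h : p' - p = d) :
    diff₂ x y = diff₂ (x - p) (y - p' + d) := by
  have e : y - (p' : A) + d = y - (p : A) := by rw [← h]; push_cast; ring
  have e1 : (p : A) ⊗ₜ[ℂ] (1 : A) = 1 ⊗ₜ (p : A) := by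
    rw [← zsmul_one, TensorProduct.smul_tmul]
  rw [diff₂, diff₂, e, TensorProduct.sub_tmul, TensorProduct.tmul_sub, e1]
  abel

lemma diff₂_pow_four_mul (x y a b : A) : diff₂ x y ^ 4 * (a ⊗ₜ b)
    = ∑ k ∈ Finset.range 5, ((-1 : ℂ) ^ k * (Nat.choose 4 k : ℂ)) •
      ((x ^ (4 - k) * a) ⊗ₜ[ℂ] (y ^ k * b)) := by
  have h2 : Nat.choose 4 2 = 6 := rfl
  have h3 : Nat.choose 4 3 = 4 := rfl
  have key : ∀ U V W : A ⊗[ℂ] A, (U - V) ^ 4 * W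
      = ∑ k ∈ Finset.range 5, ((-1 : ℂ) ^ k * (Nat.choose 4 k : ℂ)) • (U ^ (4 - k) * V ^ k * W) := by
    intro U V W
    simp only [Finset.sum_range_succ, Finset.sum_range_zero, Algebra.smul_def, map_mul, map_pow,
      map_neg, map_one, map_natCast, Nat.choose_zero_right, Nat.choose_one_right, Nat.choose_self,
      h2, h3]
    push_cast
    ring
  rw [diff₂, key]
  simp only [Algebra.TensorProduct.tmul_pow, Algebra.TensorProduct.tmul_mul_tmul, one_pow, one_mul,
    mul_one]
end Square

section Tile

variable {E : Type*} [NormedAddCommGroup E] [InnerProductSpace ℝ E]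

/-- A real linear function, as a regular function on the sphere. -/
def linReg (h : E) : Reg E := rc (fun u => ⟪h, u⟫) ⟨_, C11.inner h⟩

@[simp] lemma linReg_apply (h : E) (u : sphere (0 : E) 1) :
    (linReg h : sphere (0 : E) 1 → ℂ) u = (⟪h, (u : E)⟫ : ℝ) := rfl

lemma exists_C11_bump (h : E) (p : ℤ) : ∃ c, C11 (fun u : E => bump (⟪h, u⟫ - p)) c := by
  obtain ⟨C, hC⟩ := bump_bump.quad
  exact ⟨_, ((C11.inner h).sub (C11.const (p : ℝ))).comp hC fun u _ => mem_univ _⟩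

/-- The bump function centered at the level set `p` of a linear function. -/
def bumpReg (h : E) (p : ℤ) : Reg E := rc _ (exists_C11_bump h p)

lemma Bump.exists_C11_comb {κ : ℝ → ℝ} (hκ : Bump κ) (N c : ℕ) (h : E) :
    ∃ d, C11 (fun u : E => comb κ N c ⟪h, u⟫) d := by
  obtain ⟨C, -, hC⟩ := hκ.quad_comb
  have := (hC N c 1 le_rfl).1
  simp only [inv_one, one_pow, one_mul] at this
  exact ⟨_, (C11.inner h).comp this fun u _ => mem_univ _⟩

/-- A periodic sum of bumps in a linear function. -/
def combReg {κ : ℝ → ℝ} (hκ : Bump κ) (N c : ℕ) (h : E) : Reg E := rc _ (hκ.exists_C11_comb N c h)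

/-- The residue of `c' - c` modulo three, in `{-1, 0, 1}`. -/
def res3 (c c' : ℕ) : ℤ := ((c' - c + 1 : ℤ) % 3) - 1

lemma res3_spec (c c' N j j' : ℕ) :
    ((c' + 3 * j' - 3 * N : ℤ) - (c + 3 * j - 3 * N : ℤ) = res3 c c') ∨
    2 ≤ |(c' + 3 * j' - 3 * N : ℤ) - (c + 3 * j - 3 * N : ℤ)| := by
  rw [res3, le_abs]
  omega

lemma sum_bumpReg {N : ℕ} {h : E} (hN : ‖h‖ ≤ 3 * N - 1) :
    ∑ c ∈ Finset.range 3, ∑ j ∈ Finset.range (2 * N), bumpReg h (c + 3 * j - 3 * N) = 1 := by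
  ext u
  have hu : ‖(u : E)‖ = 1 := by simp
  have := sum_bump (N := N) (x := ⟪h, (u : E)⟫) ((abs_real_inner_le_norm _ _).trans
    (by rw [hu, mul_one]; exact hN))
  rw [Subalgebra.coe_one, Pi.one_apply]
  have this := congrArg (Complex.ofReal) this
  rw [Complex.ofReal_one] at this
  rw [← this]
  simp [AddSubmonoidClass.coe_finsetSum, Finset.sum_apply, bumpReg]

lemma sum_linReg_pow_mul_bumpReg (N c m : ℕ) (d : ℤ) (h : E) :
    ∑ j ∈ Finset.range (2 * N), (linReg h - ((c + 3 * j - 3 * N : ℤ) : Reg E) + d) ^ m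
      * bumpReg h (c + 3 * j - 3 * N) = combReg (bump_pbump m d) N c h := by
  ext u
  have e : ∀ p : ℤ, (((linReg h - p + d) ^ m * bumpReg h p : Reg E) : sphere (0 : E) 1 → ℂ) u
      = (pbump m d (⟪h, (u : E)⟫ - p) : ℝ) := fun p => by simp [bumpReg, pbump]
  rw [AddSubmonoidClass.coe_finsetSum, Finset.sum_apply]
  simp only [e, combReg, comb, rc_apply, Complex.ofReal_sum]

variable [FiniteDimensional ℝ E]

lemma cl₂_shift (h : E) (p p' d : ℤ) (hp : p' - p = d ∨ 2 ≤ |p' - p|) (f g : Reg E) :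
    cl₂ (diff₂ (linReg h) (linReg h) ^ 4 * ((f * bumpReg h p) ⊗ₜ (g * bumpReg h p')))
    = cl₂ (diff₂ (linReg h - p) (linReg h - p' + d) ^ 4
      * ((f * bumpReg h p) ⊗ₜ (g * bumpReg h p'))) := by
  rcases hp with hp | hp
  · rw [← diff₂_shift _ _ p p' d hp]
  · have z : ∀ W, cl₂ (W * ((f * bumpReg h p) ⊗ₜ (g * bumpReg h p'))) = 0 := by
      intro W
      rw [← Algebra.TensorProduct.tmul_mul_tmul, ← mul_assoc]
      refine cl₂_mul_eq_zero_of_cutoff _ _ (fun _ _ => bump_nonneg _) (fun _ _ => bump_nonneg _)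
        (fun u _ => ?_) _
      by_cases h1 : 1 ≤ |⟪h, u⟫ - p|
      · rw [bump_zero h1, zero_mul]
      · have hp' : (2 : ℝ) ≤ |(p' : ℝ) - p| := by exact_mod_cast hp
        have h2 : 1 ≤ |⟪h, u⟫ - p'| := by
          rw [not_le, abs_lt] at h1
          rw [le_abs] at hp' ⊢
          rcases hp' with h | h
          · right; linarith
          · left; linarith
        rw [bump_zero h2, mul_zero]
    rw [z, z]

lemma cl₂_diff_pow_four {N : ℕ} {h : E} (hN : ‖h‖ ≤ 3 * N - 1) (f g : Reg E) :
    cl₂ (diff₂ (linReg h) (linReg h) ^ 4 * (f ⊗ₜ g)) =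
    ∑ c ∈ Finset.range 3, ∑ c' ∈ Finset.range 3, ∑ k ∈ Finset.range 5,
      ((-1 : ℂ) ^ k * (Nat.choose 4 k : ℂ)) • (cl (f * combReg (bump_pbump (4 - k) 0) N c h)
        * cl (g * combReg (bump_pbump k (res3 c c')) N c' h)) := by
  have e : f ⊗ₜ[ℂ] g = ∑ c ∈ Finset.range 3, ∑ c' ∈ Finset.range 3,
      ∑ j ∈ Finset.range (2 * N), ∑ j' ∈ Finset.range (2 * N),
      (f * bumpReg h (c + 3 * j - 3 * N)) ⊗ₜ[ℂ] (g * bumpReg h (c' + 3 * j' - 3 * N)) := by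
    conv_lhs => rw [← mul_one f, ← mul_one g, ← sum_bumpReg hN]
    simp only [Finset.mul_sum, TensorProduct.sum_tmul, TensorProduct.tmul_sum]
    rw [Finset.sum_comm (s := Finset.range 3) (t := Finset.range 3)]
    refine Finset.sum_congr rfl fun c' _ => ?_
    rw [Finset.sum_comm (s := Finset.range (2 * N)) (t := Finset.range 3)]
    refine Finset.sum_congr rfl fun c _ => ?_
    rw [Finset.sum_comm]
  rw [e]
  simp only [Finset.mul_sum, map_sum]
  refine Finset.sum_congr rfl fun c _ => Finset.sum_congr rfl fun c' _ => ?_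
  have t : ∀ j j' : ℕ, cl₂ (diff₂ (linReg h) (linReg h) ^ 4 *
      ((f * bumpReg h (c + 3 * j - 3 * N)) ⊗ₜ[ℂ] (g * bumpReg h (c' + 3 * j' - 3 * N))))
      = ∑ k ∈ Finset.range 5, ((-1 : ℂ) ^ k * (Nat.choose 4 k : ℂ)) •
        (cl (f * ((linReg h - ((c + 3 * j - 3 * N : ℤ) : Reg E) + ((0 : ℤ) : Reg E)) ^ (4 - k)
          * bumpReg h (c + 3 * j - 3 * N))) *
        cl (g * ((linReg h - ((c' + 3 * j' - 3 * N : ℤ) : Reg E) + (res3 c c' : Reg E)) ^ k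
          * bumpReg h (c' + 3 * j' - 3 * N)))) := by
    intro j j'
    refine (cl₂_shift h _ _ _ (res3_spec c c' N j j') f g).trans ?_
    rw [diff₂_pow_four_mul, map_sum]
    refine Finset.sum_congr rfl fun k _ => ?_
    rw [map_smul, cl₂_tmul, Int.cast_zero, add_zero, mul_left_comm f, mul_left_comm g]
  have r : ∀ k, cl (f * combReg (bump_pbump (4 - k) 0) N c h)
        * cl (g * combReg (bump_pbump k (res3 c c')) N c' h) = _ := fun k => by
    rw [← sum_linReg_pow_mul_bumpReg, ← sum_linReg_pow_mul_bumpReg, Finset.mul_sum, Finset.mul_sum,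
      map_sum, map_sum, Finset.sum_mul_sum]
  simp only [t, r, Finset.smul_sum]
  symm
  rw [Finset.sum_comm]
  refine Finset.sum_congr rfl fun j _ => ?_
  rw [Finset.sum_comm]

end Tile

section TileLimit

variable {E : Type*} [NormedAddCommGroup E] [InnerProductSpace ℝ E]

lemma linReg_smul (q : ℝ) (e : E) : linReg (q • e) = (q : ℂ) • linReg e := by
  ext u
  simp [real_inner_smul_left]

/-- The rescaled periodic sums of bumps are bounded to second order. -/
lemma Bump.exists_C11_scaled {κ : ℝ → ℝ} (hκ : Bump κ) (e : E) {φ : E → ℝ} {a : ℝ} (hφ : C11 φ a) :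
    ∃ C, ∀ (N c : ℕ) (q : ℝ), 1 ≤ q →
      C11 (fun u => φ u * (q⁻¹ ^ 2 * comb κ N c (q * ⟪e, u⟫))) C ∧
      ∀ u, ‖u‖ = 1 → |φ u * (q⁻¹ ^ 2 * comb κ N c (q * ⟪e, u⟫))| ≤ C * q⁻¹ ^ 2 := by
  obtain ⟨C, hC, h⟩ := hκ.quad_comb
  have h1 : ∀ (N c : ℕ) (q : ℝ), 1 ≤ q → C11 _ _ := fun N c q hq =>
    hφ.mul ((C11.inner e).comp (h N c q hq).1 fun u _ => mem_univ _)
  refine ⟨_, fun N c q hq => ⟨(h1 N c q hq).mono (le_max_left _ (a * C)), fun u hu => ?_⟩⟩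
  rw [abs_mul, abs_mul, abs_of_nonneg (by positivity : (0 : ℝ) ≤ q⁻¹ ^ 2)]
  have b1 := hφ.bound u hu
  have b2 := (h N c q hq).2 (q * ⟪e, u⟫)
  calc |φ u| * (q⁻¹ ^ 2 * |comb κ N c (q * ⟪e, u⟫)|) ≤ a * (q⁻¹ ^ 2 * C) := by
        have := hφ.nonneg
        gcongr
    _ = a * C * q⁻¹ ^ 2 := by ring
    _ ≤ _ := by gcongr; exact le_max_right _ _

variable [FiniteDimensional ℝ E]

lemma cl_mul_combReg {κ : ℝ → ℝ} (hκ : Bump κ) (N c : ℕ) (e : E) {φ : E → ℝ} (hφ : ∃ a, C11 φ a)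
    (q : ℝ) : ((q : ℂ)⁻¹ ^ 2) • cl (rc φ hφ * combReg hκ N c (q • e))
      = rlg (fun u => φ u * (q⁻¹ ^ 2 * comb κ N c (q * ⟪e, u⟫))) := by
  obtain ⟨d, hd⟩ := hκ.exists_C11_comb N c (q • e)
  have hd' := (hφ.choose_spec.mul (hd.smul (q⁻¹ ^ 2)))
  simp only [real_inner_smul_left] at hd'
  rw [← cl_rc _ ⟨_, hd'⟩, ← map_smul]
  congr 1
  ext u
  simp [combReg, real_inner_smul_left]
  ring

lemma ev_diff₂_pow_four {ν : ConvexBody E → ℂ} (hν : IsVal ν) (e : E) {φ ψ : E → ℝ}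
    (hφ : ∃ a, C11 φ a) (hψ : ∃ a, C11 ψ a) :
    ev ν hν (cl₂ (diff₂ (linReg e) (linReg e) ^ 4 * (rc φ hφ ⊗ₜ rc ψ hψ))) = 0 := by
  set N : ℕ → ℕ := fun m => (m + 1) * ⌈‖e‖⌉₊ + 1
  have hN : ∀ m : ℕ, ‖((m + 1 : ℕ) : ℝ) • e‖ ≤ 3 * (N m : ℕ) - 1 := by
    intro m
    have h1 := Nat.le_ceil ‖e‖
    rw [norm_smul, Real.norm_natCast]
    have h2 : ((m + 1 : ℕ) : ℝ) * ‖e‖ ≤ ((m + 1 : ℕ) : ℝ) * (⌈‖e‖⌉₊ : ℝ) := by gcongr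
    have h3 : (0 : ℝ) ≤ ((m + 1 : ℕ) : ℝ) * (⌈‖e‖⌉₊ : ℝ) := by positivity
    simp only [N]
    push_cast at *
    linarith
  let G : ℕ → ℕ → ℕ → ℕ → BodyAlg E := fun c c' k m =>
    rlg (fun u => φ u * (((m + 1 : ℕ) : ℝ)⁻¹ ^ 2 *
      comb (pbump (4 - k) 0) (N m) c (((m + 1 : ℕ) : ℝ) * ⟪e, u⟫)))
    * rlg (fun u => ψ u * (((m + 1 : ℕ) : ℝ)⁻¹ ^ 2 *
      comb (pbump k (res3 c c')) (N m) c' (((m + 1 : ℕ) : ℝ) * ⟪e, u⟫)))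
  have hsum : ∀ m, ev ν hν (cl₂ (diff₂ (linReg e) (linReg e) ^ 4 * (rc φ hφ ⊗ₜ rc ψ hψ)))
      = ∑ c ∈ Finset.range 3, ∑ c' ∈ Finset.range 3, ∑ k ∈ Finset.range 5,
      ((-1 : ℂ) ^ k * (Nat.choose 4 k : ℂ)) * ev ν hν (G c c' k m) := by
    intro m
    have h := cl₂_diff_pow_four (hN m) (rc φ hφ) (rc ψ hψ)
    have hd : diff₂ (linReg (((m + 1 : ℕ) : ℝ) • e)) (linReg (((m + 1 : ℕ) : ℝ) • e))
        = (((m + 1 : ℕ) : ℝ) : ℂ) • diff₂ (linReg e) (linReg e) := by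
      rw [linReg_smul, diff₂, diff₂, smul_sub, TensorProduct.smul_tmul', TensorProduct.tmul_smul]
    rw [hd, smul_pow, smul_mul_assoc, map_smul] at h
    have h0 : ((((m + 1 : ℕ) : ℝ) : ℂ)) ≠ 0 := by exact_mod_cast Nat.succ_ne_zero m
    have h2 := congrArg (fun x => ((((m + 1 : ℕ) : ℝ) : ℂ)⁻¹ ^ 2 * (((m + 1 : ℕ) : ℝ) : ℂ)⁻¹ ^ 2) • x) h
    simp only [smul_smul] at h2
    rw [show ((((m + 1 : ℕ) : ℝ) : ℂ)⁻¹ ^ 2 * (((m + 1 : ℕ) : ℝ) : ℂ)⁻¹ ^ 2)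
      * (((m + 1 : ℕ) : ℝ) : ℂ) ^ 4 = 1 by field_simp, one_smul] at h2
    rw [h2]
    simp only [Finset.smul_sum, map_sum]
    refine Finset.sum_congr rfl fun c _ => Finset.sum_congr rfl fun c' _ =>
      Finset.sum_congr rfl fun k _ => ?_
    simp only [G]
    rw [← cl_mul_combReg (bump_pbump (4 - k) 0) (N m) c e hφ,
      ← cl_mul_combReg (bump_pbump k (res3 c c')) (N m) c' e hψ, smul_comm, map_smul, smul_eq_mul,
      smul_mul_smul_comm]
  have hlim : ∀ c c' k, Tendsto (fun m => ev ν hν (G c c' k m)) atTop (𝓝 0) := by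
    intro c c' k
    obtain ⟨C, hC⟩ := (bump_pbump (4 - k) 0).exists_C11_scaled e hφ.choose_spec
    obtain ⟨D, hD⟩ := (bump_pbump k (res3 c c')).exists_C11_scaled e hψ.choose_spec
    have hq : ∀ m : ℕ, (1 : ℝ) ≤ ((m + 1 : ℕ) : ℝ) := fun m => by
      exact_mod_cast Nat.succ_le_succ (Nat.zero_le m)
    have l0 : Tendsto (fun m : ℕ => ((m + 1 : ℕ) : ℝ)⁻¹) atTop (𝓝 0) := by
      simpa using tendsto_one_div_add_atTop_nhds_zero_nat (𝕜 := ℝ)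
    have l1 : Tendsto (fun m : ℕ => max C D * ((m + 1 : ℕ) : ℝ)⁻¹ ^ 2) atTop (𝓝 0) := by
      simpa using (l0.pow 2).const_mul (max C D)
    refine tendsto_ev_rlg_mul hν (c := max C D)
      (fun m => ((hC (N m) c _ (hq m)).1.mono (le_max_left _ _)))
      (fun m => ((hD (N m) c' _ (hq m)).1.mono (le_max_right _ _))) l1 ?_ ?_
    · intro m u hu
      refine ((hC (N m) c _ (hq m)).2 u hu).trans ?_
      gcongr
      exact le_max_left _ _
    · intro m u hu
      refine ((hD (N m) c' _ (hq m)).2 u hu).trans ?_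
      gcongr
      exact le_max_right _ _
  have l2 : Tendsto (fun m : ℕ => ∑ c ∈ Finset.range 3, ∑ c' ∈ Finset.range 3,
      ∑ k ∈ Finset.range 5, ((-1 : ℂ) ^ k * (Nat.choose 4 k : ℂ)) * ev ν hν (G c c' k m))
      atTop (𝓝 (∑ c ∈ Finset.range 3, ∑ c' ∈ Finset.range 3,
      ∑ k ∈ Finset.range 5, ((-1 : ℂ) ^ k * (Nat.choose 4 k : ℂ)) * 0)) :=
    tendsto_finsetSum _ fun c _ => tendsto_finsetSum _ fun c' _ => tendsto_finsetSum _ fun k _ =>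
      (hlim c c' k).const_mul _
  simp only [mul_zero, Finset.sum_const_zero] at l2
  exact tendsto_nhds_unique ((tendsto_congr hsum).1 tendsto_const_nhds) l2

/-- The fourth power of the difference of the two copies of a linear function is annihilated. -/
theorem cl₂_tile (e : E) (W : Reg E ⊗[ℂ] Reg E) :
    cl₂ (diff₂ (linReg e) (linReg e) ^ 4 * W) = 0 := by
  induction W with
  | zero => rw [mul_zero, map_zero]
  | tmul f g =>
    obtain ⟨φ, ψ, h, k, rfl⟩ := exists_rc f
    obtain ⟨φ', ψ', h', k', rfl⟩ := exists_rc g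
    have base : ∀ (φ ψ : E → ℝ) (hφ : ∃ a, C11 φ a) (hψ : ∃ a, C11 ψ a),
        cl₂ (diff₂ (linReg e) (linReg e) ^ 4 * (rc φ hφ ⊗ₜ rc ψ hψ)) = 0 := fun φ ψ hφ hψ =>
      eq_zero_of_ev fun ν hν => ev_diff₂_pow_four hν e hφ hψ
    simp only [TensorProduct.add_tmul, TensorProduct.tmul_add, TensorProduct.smul_tmul,
      TensorProduct.tmul_smul, mul_add, map_add, mul_smul_comm, map_smul, base, smul_zero, add_zero]
  | add x y hx hy => rw [mul_add, map_add, hx, hy, add_zero]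

end TileLimit

set_option linter.unusedSectionVars false

section Slots
variable {σ A B V : Type*} [Fintype σ] [DecidableEq σ] [CommRing A] [Algebra ℂ A] [CommRing B]
  [Algebra ℂ B] (c : A →ₗ[ℂ] B)

/-- The linear map `⨂ₛ A → B`, `⨂ₛ fₛ ↦ ∏ₛ c fₛ`. -/
def slotMap : (⨂[ℂ] _ : σ, A) →ₗ[ℂ] B :=
  PiTensorProduct.lift ((MultilinearMap.mkPiAlgebra ℂ σ B).compLinearMap fun _ => c)

@[simp] lemma slotMap_tprod (f : σ → A) :
    slotMap c (PiTensorProduct.tprod ℂ f) = ∏ s, c (f s) := by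
  simp [slotMap]

/-- The inclusion of `A` as the tensor factor with index `s`. -/
def slot (s : σ) : A →ₐ[ℂ] (⨂[ℂ] _ : σ, A) := PiTensorProduct.singleAlgHom (A := fun _ : σ => A) s

lemma tprod_mul_slot (f : σ → A) (s : σ) (a : A) :
    PiTensorProduct.tprod ℂ f * slot s a
      = PiTensorProduct.tprod ℂ (Function.update f s (f s * a)) := by
  rw [slot, PiTensorProduct.singleAlgHom_apply, PiTensorProduct.tprod_mul_tprod]
  congr 1
  ext t
  rcases eq_or_ne t s with rfl | h
  · simp
  · simp [h]

lemma slotMap_mul_slot {s : σ} {a : A} (ha : c a = 0) {Q : ⨂[ℂ] _ : σ, A}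
    (hQ : Q ∈ Algebra.adjoin ℂ {x : ⨂[ℂ] _ : σ, A | ∃ (t : σ) (b : A), t ≠ s ∧ x = slot t b}) :
    slotMap c (Q * slot s a) = 0 := by
  have key : Q ∈ Submodule.span ℂ
      {x : ⨂[ℂ] _ : σ, A | ∃ f : σ → A, f s = 1 ∧ x = PiTensorProduct.tprod ℂ f} := by
    rw [← Subalgebra.mem_toSubmodule, Algebra.adjoin_eq_span] at hQ
    refine Submodule.span_mono ?_ hQ
    intro x hx
    induction hx using Submonoid.closure_induction with
    | mem x hx =>
      obtain ⟨t, b, hts, rfl⟩ := hx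
      refine ⟨Pi.mulSingle t b, by simp [Ne.symm hts], ?_⟩
      simp [slot]
    | one => exact ⟨1, rfl, rfl⟩
    | mul x y _ _ hx hy =>
      obtain ⟨f, hf, rfl⟩ := hx
      obtain ⟨g, hg, rfl⟩ := hy
      exact ⟨f * g, by simp [hf, hg], PiTensorProduct.tprod_mul_tprod _ _⟩
  clear hQ
  induction key using Submodule.span_induction with
  | mem x hx =>
    obtain ⟨f, hf, rfl⟩ := hx
    rw [tprod_mul_slot, slotMap_tprod]
    exact Finset.prod_eq_zero (Finset.mem_univ s) (by simp [hf, ha])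
  | zero => simp
  | add x y _ _ hx hy => rw [add_mul, map_add, hx, hy, add_zero]
  | smul r x _ hx => rw [smul_mul_assoc, map_smul, hx, smul_zero]

/-- The ideal of those `x` with `T (Q * x) = 0` for all `Q`. -/
def annIdeal {M : Type*} [AddCommGroup M] [Module ℂ M] (T : A →ₗ[ℂ] M) : Ideal A where
  carrier := {x | ∀ Q, T (Q * x) = 0}
  add_mem' hx hy Q := by rw [mul_add, map_add, hx, hy, add_zero]
  zero_mem' Q := by simp
  smul_mem' r x hx Q := by rw [smul_eq_mul, ← mul_assoc]; exact hx _

lemma slotMap_mul_pair {s t : σ} (hst : s ≠ t) (f : σ → A) :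
    ∃ b : B, ∀ W : A ⊗[ℂ] A, 
      slotMap c (PiTensorProduct.tprod ℂ f * Algebra.TensorProduct.productMap (slot (A := A) s) (slot t) W)
        = b * LinearMap.mul' ℂ B (TensorProduct.map c c (W * (f s ⊗ₜ f t))) := by
  refine ⟨∏ r ∈ (Finset.univ.erase s).erase t, c (f r), fun W => ?_⟩
  induction W with
  | zero => simp
  | add x y hx hy => rw [map_add, mul_add, map_add, hx, hy, add_mul, map_add, map_add, mul_add]
  | tmul a b =>
    rw [Algebra.TensorProduct.productMap_apply_tmul, ← mul_assoc, tprod_mul_slot, tprod_mul_slot,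
      slotMap_tprod, ← Finset.mul_prod_erase _ _ (Finset.mem_univ s),
      ← Finset.mul_prod_erase _ _ (Finset.mem_erase.2 ⟨hst.symm, Finset.mem_univ t⟩)]
    rw [Algebra.TensorProduct.tmul_mul_tmul, TensorProduct.map_tmul, LinearMap.mul'_apply]
    have : ∀ r ∈ (Finset.univ.erase s).erase t, c (Function.update (Function.update f s (f s * a)) t
        ((Function.update f s (f s * a)) t * b) r) = c (f r) := by
      intro r hr
      rw [Finset.mem_erase, Finset.mem_erase] at hr
      rw [Function.update_of_ne hr.1, Function.update_of_ne hr.2.1]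
    rw [Finset.prod_congr rfl this]
    simp only [Function.update_self, Function.update_of_ne hst, Function.update_of_ne hst.symm]
    rw [mul_comm (f s), mul_comm (f t)]
    ring

lemma productMap_mem_annIdeal {s t : σ} (hst : s ≠ t) {W₀ : A ⊗[ℂ] A}
    (h : ∀ W, LinearMap.mul' ℂ B (TensorProduct.map c c (W₀ * W)) = 0) :
    Algebra.TensorProduct.productMap (slot (A := A) s) (slot t) W₀ ∈ annIdeal (slotMap (σ := σ) c) := by
  intro Q
  induction Q using PiTensorProduct.induction_on with
  | smul_tprod r f =>
    obtain ⟨b, hb⟩ := slotMap_mul_pair c hst f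
    rw [smul_mul_assoc, map_smul, hb, h, mul_zero, smul_zero]
  | add x y hx hy => rw [add_mul, map_add, hx, hy, add_zero]

omit [CommRing B] [Algebra ℂ B] in
lemma mul_mul_mul_mem_of_pow_four {I : Ideal A} {N : AddSubgroup A} (h : ∀ x ∈ N, x ^ 4 ∈ I)
    {x y z w : A} (hx : x ∈ N) (hy : y ∈ N) (hz : z ∈ N) (hw : w ∈ N) : x * y * z * w ∈ I := by
  have e : x * y * z * w = algebraMap ℂ A (1 / 192) *
      ((x + y + z + w) ^ 4 - (x + y + z - w) ^ 4 - (x + y - z + w) ^ 4 + (x + y - z - w) ^ 4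
       - (x - y + z + w) ^ 4 + (x - y + z - w) ^ 4 + (x - y - z + w) ^ 4 - (x - y - z - w) ^ 4) := by
    have : algebraMap ℂ A (1 / 192) * 192 = 1 := by
      rw [← map_ofNat (algebraMap ℂ A) 192, ← map_mul]; norm_num
    linear_combination (- x * y * z * w) * this
  rw [e]
  have H : ∀ {a}, a ∈ N → a ^ 4 ∈ I := fun ha => h _ ha
  refine I.mul_mem_left _ ?_
  refine I.sub_mem (I.add_mem (I.add_mem (I.sub_mem (I.add_mem (I.sub_mem (I.sub_mem (H ?_) (H ?_)) (H ?_)) (H ?_))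
     (H ?_)) (H ?_)) (H ?_)) (H ?_)
  all_goals
    first
      | exact N.add_mem (N.add_mem (N.add_mem hx hy) hz) hw
      | exact N.sub_mem (N.add_mem (N.add_mem hx hy) hz) hw
      | exact N.add_mem (N.sub_mem (N.add_mem hx hy) hz) hw
      | exact N.sub_mem (N.sub_mem (N.add_mem hx hy) hz) hw
      | exact N.add_mem (N.add_mem (N.sub_mem hx hy) hz) hw
      | exact N.sub_mem (N.add_mem (N.sub_mem hx hy) hz) hw
      | exact N.add_mem (N.sub_mem (N.sub_mem hx hy) hz) hw
      | exact N.sub_mem (N.sub_mem (N.sub_mem hx hy) hz) hw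

omit [CommRing B] [Algebra ℂ B] in
lemma mul_mul_mul_mem_of_span {I : Ideal A} {S : Set A}
    (h : ∀ x ∈ S, ∀ y ∈ S, ∀ z ∈ S, ∀ w ∈ S, x * y * z * w ∈ I)
    {x y z w : A} (hx : x ∈ Submodule.span ℂ S) (hy : y ∈ Submodule.span ℂ S)
    (hz : z ∈ Submodule.span ℂ S) (hw : w ∈ Submodule.span ℂ S) : x * y * z * w ∈ I := by
  have key : ∀ m : A, (∀ s ∈ S, m * s ∈ I) → ∀ a ∈ Submodule.span ℂ S, m * a ∈ I := by
    intro m hm a ha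
    induction ha using Submodule.span_induction with
    | mem x hx => exact hm x hx
    | zero => simp
    | add x y _ _ hx hy => rw [mul_add]; exact I.add_mem hx hy
    | smul r x _ hx =>
      rw [Algebra.mul_smul_comm, Algebra.smul_def]; exact I.mul_mem_left _ hx
  refine key _ (fun w hw => ?_) _ hw
  rw [mul_right_comm]
  refine key _ (fun z hz => ?_) _ hz
  rw [show x * y * w * z = x * w * z * y by ring]
  refine key _ (fun y hy => ?_) _ hy
  rw [show x * w * z * y = w * z * y * x by ring]
  refine key _ (fun x hx => ?_) _ hx
  exact h _ hw _ hz _ hy _ hx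

/-- The algebra automorphism of `⨂ₛ A` which permutes the factors. -/
def permAlgHom (e : Equiv.Perm σ) : (⨂[ℂ] _ : σ, A) →ₐ[ℂ] (⨂[ℂ] _ : σ, A) :=
  PiTensorProduct.liftAlgHom (MultilinearMap.domDomCongr e (PiTensorProduct.tprod ℂ)) rfl
    fun x y => by
      simp only [MultilinearMap.domDomCongr_apply]
      exact (PiTensorProduct.tprod_mul_tprod _ _).symm

lemma permAlgHom_tprod (e : Equiv.Perm σ) (f : σ → A) :
    permAlgHom e (PiTensorProduct.tprod ℂ f) = PiTensorProduct.tprod ℂ (fun s => f (e s)) := by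
  simp [permAlgHom, PiTensorProduct.liftAlgHom]

lemma permAlgHom_slot (e : Equiv.Perm σ) (s : σ) (a : A) :
    permAlgHom e (slot (e s) a) = slot s a := by
  rw [slot, slot, PiTensorProduct.singleAlgHom_apply, PiTensorProduct.singleAlgHom_apply,
    permAlgHom_tprod]
  congr 1
  ext t
  simp [Pi.mulSingle_apply]

lemma slotMap_permAlgHom (e : Equiv.Perm σ) (x : ⨂[ℂ] _ : σ, A) :
    slotMap c (permAlgHom e x) = slotMap c x := by
  induction x using PiTensorProduct.induction_on with
  | smul_tprod r f =>
    rw [map_smul, map_smul, map_smul, permAlgHom_tprod, slotMap_tprod, slotMap_tprod,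
      Equiv.prod_comp e (fun s => c (f s))]
  | add x y hx hy => rw [map_add, map_add, map_add, hx, hy]

/-- The substitution of `v d` in the factor `s` for the variable `(s, d)`. -/
def slotEval (v : V → A) : MvPolynomial (σ × V) ℂ →ₐ[ℂ] (⨂[ℂ] _ : σ, A) :=
  MvPolynomial.aeval fun p => slot p.1 (v p.2)

@[simp] lemma slotEval_X (v : V → A) (p : σ × V) :
    slotEval v (MvPolynomial.X p) = slot p.1 (v p.2) := by simp [slotEval]

/-- `slotMap` on polynomials. -/
def polySlot (v : V → A) : MvPolynomial (σ × V) ℂ →ₗ[ℂ] B := slotMap c ∘ₗ (slotEval v).toLinearMap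

lemma polySlot_apply (v : V → A) (P : MvPolynomial (σ × V) ℂ) :
    polySlot c v P = slotMap c (slotEval v P) := rfl

lemma polySlot_mul_X {v : V → A} (s : σ) (d : V) (hd : c (v d) = 0) {P : MvPolynomial (σ × V) ℂ}
    (hP : P ∈ MvPolynomial.supported ℂ {p : σ × V | p.1 ≠ s}) :
    polySlot c v (P * MvPolynomial.X (s, d)) = 0 := by
  rw [polySlot_apply, map_mul, slotEval_X]
  refine slotMap_mul_slot c hd ?_
  rw [MvPolynomial.supported] at hP
  have := (Subalgebra.mem_map (S := Algebra.adjoin ℂ _) (f := slotEval v)).2 ⟨P, hP, rfl⟩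
  rw [AlgHom.map_adjoin] at this
  refine Algebra.adjoin_mono ?_ this
  rintro _ ⟨_, ⟨p, hp, rfl⟩, rfl⟩
  exact ⟨p.1, v p.2, hp, slotEval_X _ _⟩

lemma polySlot_rename (v : V → A) (e : Equiv.Perm σ) (P : MvPolynomial (σ × V) ℂ) :
    polySlot c v (MvPolynomial.rename (fun p => (e p.1, p.2)) P) = polySlot c v P := by
  rw [polySlot_apply, ← slotMap_permAlgHom c e, polySlot_apply]
  congr 1
  have : ((permAlgHom e).comp (slotEval v)).comp (MvPolynomial.rename (fun p => (e p.1, p.2)))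
      = slotEval v := by
    ext p
    simp [permAlgHom_slot]
  exact DFunLike.congr_fun this P

/-- If `c ⊗ c` is annihilated by fourth powers of differences, then the induced functional on
polynomials is annihilated by the cubes of the diagonal ideals. -/
lemma polySlot_cubic {v : V → A} {N : AddSubgroup A} (hv : ∀ d, v d ∈ Submodule.span ℂ (N : Set A))
    (hN : ∀ x ∈ N, ∀ W, LinearMap.mul' ℂ B (TensorProduct.map c c (diff₂ x x ^ 4 * W)) = 0)
    {s t : σ} (hst : s ≠ t) (d₁ d₂ d₃ : V) (P : MvPolynomial (σ × V) ℂ) :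
    polySlot c v (P * ((MvPolynomial.X (s, d₁) - MvPolynomial.X (t, d₁)) *
      (MvPolynomial.X (s, d₂) - MvPolynomial.X (t, d₂)) *
      (MvPolynomial.X (s, d₃) - MvPolynomial.X (t, d₃)))) = 0 := by
  set Δ : A →ₗ[ℂ] (⨂[ℂ] _ : σ, A) := (slot s).toLinearMap - (slot t).toLinearMap with hΔ
  have hΔ' : ∀ a, Δ a = slot s a - slot t a := fun a => rfl
  have h4 : ∀ x ∈ N.map Δ.toAddMonoidHom, x ^ 4 ∈ annIdeal (slotMap (σ := σ) c) := by
    rintro _ ⟨x, hx, rfl⟩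
    have := productMap_mem_annIdeal (σ := σ) c hst (hN x hx)
    rw [map_pow] at this
    convert this using 2
    simp [diff₂, hΔ']
  have h5 : ∀ {a b c' d : A}, a ∈ Submodule.span ℂ (N : Set A) → b ∈ Submodule.span ℂ (N : Set A) →
      c' ∈ Submodule.span ℂ (N : Set A) → d ∈ Submodule.span ℂ (N : Set A) →
      Δ a * Δ b * Δ c' * Δ d ∈ annIdeal (slotMap (σ := σ) c) := by
    intro a b c' d ha hb hc hd
    have im : ∀ {a}, a ∈ Submodule.span ℂ (N : Set A) →
        Δ a ∈ Submodule.span ℂ ((N.map Δ.toAddMonoidHom : AddSubgroup _) : Set (⨂[ℂ] _ : σ, A)) := by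
      intro a ha
      have := Submodule.mem_map_of_mem (f := Δ) ha
      rw [Submodule.map_span] at this
      exact this
    exact mul_mul_mul_mem_of_span (fun x hx y hy z hz w hw => mul_mul_mul_mem_of_pow_four h4 hx hy hz hw)
      (im ha) (im hb) (im hc) (im hd)
  set Y : V → MvPolynomial (σ × V) ℂ := fun d => MvPolynomial.X (s, d) - MvPolynomial.X (t, d) with hY
  have hYe : ∀ d, slotEval v (Y d) = Δ (v d) := fun d => by simp [hY, hΔ']
  set e : Equiv.Perm σ := Equiv.swap s t
  set r := MvPolynomial.rename (R := ℂ) (fun p : σ × V => (e p.1, p.2)) with hr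
  have hrY : ∀ d, r (Y d) = - Y d := fun d => by simp [hr, hY, e]
  set J : Ideal (MvPolynomial (σ × V) ℂ) := Ideal.span (range Y) with hJ
  have hPJ : P - r P ∈ J := by
    rw [← Ideal.Quotient.mk_eq_mk_iff_sub_mem]
    have : (Ideal.Quotient.mkₐ ℂ J) = (Ideal.Quotient.mkₐ ℂ J).comp r := by
      ext p
      simp only [AlgHom.comp_apply, Ideal.Quotient.mkₐ_eq_mk, hr, MvPolynomial.rename_X]
      rw [Ideal.Quotient.mk_eq_mk_iff_sub_mem]
      obtain ⟨p, d⟩ := p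
      rcases eq_or_ne p s with rfl | h1
      · simpa [e] using Ideal.subset_span (mem_range_self (f := Y) d)
      rcases eq_or_ne p t with rfl | h2
      · have := J.neg_mem (Ideal.subset_span (mem_range_self (f := Y) d))
        simpa [e, hY] using this
      · simp [e, Equiv.swap_apply_of_ne_of_ne h1 h2]
    exact DFunLike.congr_fun this P
  have hq : ∀ Q ∈ J, Q * (Y d₁ * Y d₂ * Y d₃) ∈ annIdeal (polySlot (σ := σ) c v) := by
    intro Q hQ
    induction hQ using Submodule.span_induction with
    | mem x hx =>
      obtain ⟨d, rfl⟩ := hx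
      intro Q
      rw [polySlot_apply]
      simp only [map_mul, hYe]
      rw [← h5 (hv d) (hv d₁) (hv d₂) (hv d₃) (slotEval v Q)]
      congr 1
      ring
    | zero => simp
    | add x y _ _ hx hy => rw [add_mul]; exact Ideal.add_mem _ hx hy
    | smul a x _ hx => rw [smul_eq_mul, mul_assoc]; exact Ideal.mul_mem_left _ _ hx
  have h6 := hq _ hPJ 1
  rw [one_mul] at h6
  have h7 : polySlot c v (r P * (Y d₁ * Y d₂ * Y d₃)) = - polySlot c v (P * (Y d₁ * Y d₂ * Y d₃)) := by
    rw [← polySlot_rename c v e (P * _)]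
    change _ = - polySlot c v (r _)
    rw [← map_neg]
    congr 1
    simp only [map_mul, hrY]
    ring
  rw [sub_mul, map_sub, h7, sub_neg_eq_add, ← two_smul ℂ] at h6
  exact (smul_eq_zero_iff_right two_ne_zero).1 h6
end Slots

section Functoriality
variable {σ A B V : Type*} [Fintype σ] [DecidableEq σ] [CommRing A] [Algebra ℂ A] [CommRing B]
  [Algebra ℂ B]

lemma polySlot_map {c : A →ₗ[ℂ] B} {π : A →ₐ[ℂ] A} {a : B →ₐ[ℂ] B} (h : ∀ x, a (c x) = c (π x))
    (v : V → A) (P : MvPolynomial (σ × V) ℂ) :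
    a (polySlot c v P) = polySlot c (fun d => π (v d)) P := by
  set F : (⨂[ℂ] _ : σ, A) →ₐ[ℂ] (⨂[ℂ] _ : σ, A) :=
    PiTensorProduct.liftAlgHom
      ((PiTensorProduct.tprod ℂ).compLinearMap fun _ => π.toLinearMap)
      (by
        rw [MultilinearMap.compLinearMap_apply]
        congr 1
        ext s
        simp)
      (fun x y => by
        simp only [MultilinearMap.compLinearMap_apply]
        rw [PiTensorProduct.tprod_mul_tprod]
        congr 1
        ext s
        simp) with hF
  have hFt : ∀ f : σ → A, F (PiTensorProduct.tprod ℂ f) = PiTensorProduct.tprod ℂ fun s => π (f s) :=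
    fun f => by simp [hF, PiTensorProduct.liftAlgHom]
  have h1 : ∀ x, a (slotMap c x) = slotMap c (F x) := by
    intro x
    induction x using PiTensorProduct.induction_on with
    | smul_tprod r f =>
      simp only [map_smul, slotMap_tprod, hFt, map_prod, h]
    | add x y hx hy => simp only [map_add, hx, hy]
  have h2 : F.comp (slotEval v) = slotEval fun d => π (v d) := by
    ext p
    simp only [AlgHom.comp_apply, slotEval_X]
    rw [slot, PiTensorProduct.singleAlgHom_apply, PiTensorProduct.singleAlgHom_apply, hFt]
    congr 1
    ext t
    rcases eq_or_ne t p.1 with e | e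
    · simp [e]
    · simp [e]
  rw [polySlot_apply, h1, polySlot_apply, ← h2]
  rfl

lemma polySlot_subst (c : A →ₗ[ℂ] B) {v v' : V → A} {q : V → MvPolynomial V ℂ}
    (h : ∀ d, v' d = MvPolynomial.aeval v (q d)) (P : MvPolynomial (σ × V) ℂ) :
    polySlot c v' P = polySlot c v
      (MvPolynomial.aeval (fun p : σ × V => MvPolynomial.rename (Prod.mk p.1) (q p.2)) P) := by
  rw [polySlot_apply, polySlot_apply]
  congr 1
  have : slotEval v' = (slotEval v).comp
      (MvPolynomial.aeval (fun p : σ × V => MvPolynomial.rename (Prod.mk p.1) (q p.2))) := by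
    ext p
    simp only [AlgHom.comp_apply, slotEval_X, MvPolynomial.aeval_X, h]
    have : (slot p.1).comp (MvPolynomial.aeval v)
        = (slotEval v).comp (MvPolynomial.rename (Prod.mk p.1)) := by
      ext d
      simp
    exact DFunLike.congr_fun this _
  exact DFunLike.congr_fun this P

lemma hasDerivAt_subst {ι : Type*} {c : ι → ℝ → ℂ} {d : ι → ℂ} (a : ι → MvPolynomial ι ℂ)
    (h0 : ∀ i, c i 0 = 0) (hc : ∀ i, HasDerivAt (c i) (d i) 0) (P : MvPolynomial ι ℂ)
    (T : MvPolynomial ι ℂ →ₗ[ℂ] ℂ) :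
    HasDerivAt (fun θ => T (MvPolynomial.aeval (fun i => MvPolynomial.X i + c i θ • a i) P))
      (T (MvPolynomial.mkDerivation ℂ (fun i => d i • a i) P)) 0 := by
  induction P using MvPolynomial.induction_on generalizing T with
  | C r => simpa using hasDerivAt_const _ _
  | add p q hp hq => simp only [map_add]; exact (hp T).add (hq T)
  | mul_X p i hp =>
    have e0 : MvPolynomial.aeval (fun i => MvPolynomial.X i + c i 0 • a i) p = p := by
      simp [h0]
    have h1 := hp (T ∘ₗ LinearMap.mulRight ℂ (MvPolynomial.X i))
    have h2 := (hc i).mul (hp (T ∘ₗ LinearMap.mulRight ℂ (a i)))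
    refine (h1.add h2).congr_deriv ?_ |>.congr_of_eventuallyEq (.of_forall fun θ => ?_)
    · rw [e0]
      simp only [h0, LinearMap.comp_apply, LinearMap.mulRight_apply, Derivation.leibniz,
        MvPolynomial.mkDerivation_X, smul_eq_mul, map_add, zero_mul, add_zero]
      rw [mul_smul_comm, map_smul, smul_eq_mul, mul_comm (MvPolynomial.X i)]
      ring
    · simp only [map_mul, MvPolynomial.aeval_X, mul_add, map_add, mul_smul_comm, map_smul,
        LinearMap.comp_apply, LinearMap.mulRight_apply, Pi.add_apply, Pi.mul_apply, smul_eq_mul]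

end Functoriality

section Action
variable {E : Type*} [NormedAddCommGroup E] [InnerProductSpace ℝ E]

/-- The image of a convex body under a linear isometry. -/
def mapBody (g : E ≃ₗᵢ[ℝ] E) (K : ConvexBody E) : ConvexBody E where
  carrier := g '' K
  convex' := K.convex.is_linear_image g.toLinearEquiv.toLinearMap.isLinear
  isCompact' := K.isCompact.image g.continuous
  nonempty' := K.nonempty.image _

lemma coe_mapBody (g : E ≃ₗᵢ[ℝ] E) (K : ConvexBody E) : (mapBody g K : Set E) = g '' K := rfl

lemma mapBody_add (g : E ≃ₗᵢ[ℝ] E) (K L : ConvexBody E) :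
    mapBody g (K + L) = mapBody g K + mapBody g L := by
  apply ConvexBody.ext
  rw [ConvexBody.coe_add, coe_mapBody, coe_mapBody, coe_mapBody, ConvexBody.coe_add]
  exact image_add g

/-- `mapBody` as an additive homomorphism. -/
def mapBodyHom (g : E ≃ₗᵢ[ℝ] E) : ConvexBody E →+ ConvexBody E where
  toFun := mapBody g
  map_zero' := ConvexBody.ext (by
    rw [coe_mapBody, ConvexBody.coe_zero, ← singleton_zero, image_singleton, map_zero])
  map_add' := mapBody_add g

@[simp] lemma mapBodyHom_apply (g : E ≃ₗᵢ[ℝ] E) (K : ConvexBody E) :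
    mapBodyHom g K = mapBody g K := rfl

lemma continuous_mapBody (g : E ≃ₗᵢ[ℝ] E) : Continuous (mapBody g) :=
  Isometry.continuous <| Isometry.of_dist_eq fun _ _ => hausdorffDist_image g.isometry

lemma IsVal.mapBody {ν : ConvexBody E → ℂ} (hν : IsVal ν) (g : E ≃ₗᵢ[ℝ] E) :
    IsVal fun K => ν (mapBody g K) where
  add K L U I hU hI := hν.add _ _ _ _ (by simp only [coe_mapBody, hU, image_union])
    (by simp only [coe_mapBody, hI, image_inter g.injective])
  cont := hν.cont.comp (continuous_mapBody g)
  trans x K L h := hν.trans (g x) _ _ (by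
    simp only [coe_mapBody, h, image_image, map_add])

lemma supp_mapBody (g : E ≃ₗᵢ[ℝ] E) (K : ConvexBody E) (u : E) :
    supp (mapBody g K) u = supp K (g.symm u) := by
  rw [supp, supp, coe_mapBody, image_image]
  congr 1
  refine image_congr fun x _ => ?_
  rw [← g.inner_map_map x, g.apply_symm_apply]

lemma C11.comp_isometry {φ : E → ℝ} {c : ℝ} (h : C11 φ c) (g : E ≃ₗᵢ[ℝ] E) :
    C11 (fun u => φ (g u)) c where
  nonneg := h.nonneg
  bound u hu := h.bound _ (by rw [g.norm_map, hu])
  taylor u₀ hu₀ := by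
    obtain ⟨p, hp, h'⟩ := h.taylor (g u₀) (by rw [g.norm_map, hu₀])
    refine ⟨g.symm p, by rwa [g.symm.norm_map], fun u hu => ?_⟩
    rw [← g.inner_map_map, g.apply_symm_apply, map_sub, ← g.norm_map (u - u₀), map_sub]
    exact h' _ (by rw [g.norm_map, hu])

/-- A linear isometry on the unit sphere. -/
def sphereMap (g : E ≃ₗᵢ[ℝ] E) (u : sphere (0 : E) 1) : sphere (0 : E) 1 :=
  ⟨g u, by rw [mem_sphere_zero_iff_norm, g.norm_map]; exact mem_sphere_zero_iff_norm.1 u.2⟩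

/-- Composition with a linear isometry, on regular functions. -/
def pull (g : E ≃ₗᵢ[ℝ] E) : Reg E →ₐ[ℂ] Reg E where
  toFun f := ⟨fun u => (f : sphere (0 : E) 1 → ℂ) (sphereMap g u), by
    obtain ⟨⟨φ, c, h, e⟩, ⟨ψ, d, k, e'⟩⟩ := mem_Reg.1 f.2
    exact mem_Reg.2 ⟨⟨_, c, h.comp_isometry g, fun u => e (sphereMap g u)⟩,
      ⟨_, d, k.comp_isometry g, fun u => e' (sphereMap g u)⟩⟩⟩
  map_one' := rfl
  map_mul' _ _ := rfl
  map_zero' := rfl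
  map_add' _ _ := rfl
  commutes' _ := rfl

@[simp] lemma pull_apply (g : E ≃ₗᵢ[ℝ] E) (f : Reg E) (u : sphere (0 : E) 1) :
    (pull g f : sphere (0 : E) 1 → ℂ) u = (f : sphere (0 : E) 1 → ℂ) (sphereMap g u) := rfl

variable [FiniteDimensional ℝ E]

/-- The action of a linear isometry on the body algebra. -/
def act (g : E ≃ₗᵢ[ℝ] E) : BodyAlg E →ₐ[ℂ] BodyAlg E :=
  Ideal.quotientMapₐ (relIdeal E)
    (AddMonoidAlgebra.mapDomainAlgHom ℂ ℂ
      (mapBodyHom g))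
    (by
      intro a ha ν hν
      have : ∀ a, pre ν (AddMonoidAlgebra.mapDomainAlgHom ℂ ℂ
          (mapBodyHom g) a)
            = pre (fun K => ν (mapBody g K)) a := by
        intro a
        induction a using AddMonoidAlgebra.induction_linear with
        | zero => simp
        | add f g hf hg => simp only [map_add, hf, hg]
        | single K r => simp [pre_single]
      change pre ν _ = 0
      rw [this]
      exact ha _ (hν.mapBody g))

lemma act_cls (g : E ≃ₗᵢ[ℝ] E) (K : ConvexBody E) : act g (cls K) = cls (mapBody g K) := by
  have : act g (cls K) = toBodyAlg (AddMonoidAlgebra.mapDomainAlgHom ℂ ℂ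
      (mapBodyHom g)
      (AddMonoidAlgebra.single K 1)) := rfl
  rw [this]
  simp [cls]

lemma act_lg (g : E ≃ₗᵢ[ℝ] E) (K : ConvexBody E) : act g (lg K) = lg (mapBody g K) := by
  rw [lg_eq_aeval, lg_eq_aeval, ← Polynomial.aeval_algHom_apply, act_cls]

lemma act_rlg (g : E ≃ₗᵢ[ℝ] E) {φ : E → ℝ} (h : DC φ) :
    act g (rlg φ) = rlg fun u => φ (g.symm u) := by
  obtain ⟨K, L, e⟩ := h
  rw [rlg_eq e, map_sub, act_lg, act_lg]
  refine (rlg_eq fun u hu => ?_).symm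
  rw [supp_mapBody, supp_mapBody, e _ (by rw [g.symm.norm_map, hu])]

lemma act_cl (g : E ≃ₗᵢ[ℝ] E) (f : Reg E) : act g (cl f) = cl (pull g.symm f) := by
  obtain ⟨φ, ψ, h, k, rfl⟩ := exists_rc f
  have : ∀ φ h, act g (cl (rc φ h)) = cl (pull g.symm (rc φ h)) := by
    rintro φ ⟨c, h⟩
    have e : pull g.symm (rc φ ⟨c, h⟩) = rc (fun u => φ (g.symm u)) ⟨c, h.comp_isometry g.symm⟩ := rfl
    rw [e, cl_rc, cl_rc, act_rlg g h.dc]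
  rw [map_add, map_smul, map_add, map_smul, this, this, map_add, map_smul, map_add, map_smul]

lemma ev_act {ν : ConvexBody E → ℂ} (hν : IsVal ν) (g : E ≃ₗᵢ[ℝ] E) {r : ℂ}
    (h : ∀ K, ν (mapBody g K) = r * ν K) (x : BodyAlg E) : ev ν hν (act g x) = r * ev ν hν x := by
  refine bodyAlg_induction (p := fun x => ev ν hν (act g x) = r * ev ν hν x) x (by rw [map_zero, map_zero, mul_zero]) (fun x y hx hy => ?_)
    fun c K => ?_
  · rw [map_add, map_add, map_add, hx, hy, mul_add]
  · rw [map_smul, map_smul, map_smul, act_cls, ev_cls, ev_cls, h, smul_eq_mul, smul_eq_mul]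
    ring

end Action

section Coordinates
variable {n : ℕ} {σ : Type*} [Fintype σ] [DecidableEq σ]

lemma linReg_add {E : Type*} [NormedAddCommGroup E] [InnerProductSpace ℝ E] (a b : E) :
    linReg (a + b) = linReg a + linReg b := by
  ext u
  simp [inner_add_left]

lemma cl_linReg {E : Type*} [NormedAddCommGroup E] [InnerProductSpace ℝ E]
    [FiniteDimensional ℝ E] (a : E) : cl (linReg a) = 0 := by
  rw [linReg, cl_rc, rlg_inner]

/-- The real linear functions, as an additive subgroup. -/
def linRegs (E : Type*) [NormedAddCommGroup E] [InnerProductSpace ℝ E] : AddSubgroup (Reg E) :=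
  AddMonoidHom.range (AddMonoidHom.mk' linReg linReg_add)

/-- The complex coordinate functions and their conjugates. -/
def cv (n : ℕ) (d : Fin n × Bool) : Reg (Cn n) :=
  linReg (EuclideanSpace.single d.1 1) +
    (if d.2 then -Complex.I else Complex.I) • linReg (EuclideanSpace.single d.1 Complex.I)

lemma inner_single_one (i : Fin n) (u : Cn n) :
    ⟪(EuclideanSpace.single i 1 : Cn n), u⟫ = (u i).re := by
  rw [PiLp.inner_apply, Finset.sum_eq_single i]
  · simp [Complex.inner]
  · intro j _ h; simp [h]
  · simp

lemma inner_single_I (i : Fin n) (u : Cn n) :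
    ⟪(EuclideanSpace.single i Complex.I : Cn n), u⟫ = (u i).im := by
  rw [PiLp.inner_apply, Finset.sum_eq_single i]
  · simp [Complex.inner]
  · intro j _ h; simp [h]
  · simp

lemma cv_false (i : Fin n) (u : sphere (0 : Cn n) 1) :
    (cv n (i, false) : sphere (0 : Cn n) 1 → ℂ) u = (u : Cn n) i := by
  simp only [cv, Subalgebra.coe_add, Subalgebra.coe_smul, Pi.add_apply, Pi.smul_apply,
    linReg_apply, inner_single_one, inner_single_I]
  apply Complex.ext <;> simp

lemma cv_true (i : Fin n) (u : sphere (0 : Cn n) 1) :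
    (cv n (i, true) : sphere (0 : Cn n) 1 → ℂ) u = star ((u : Cn n) i) := by
  simp only [cv, Subalgebra.coe_add, Subalgebra.coe_smul, Pi.add_apply, Pi.smul_apply,
    linReg_apply, inner_single_one, inner_single_I]
  apply Complex.ext <;> simp

lemma cl_cv (d : Fin n × Bool) : cl (cv n d) = 0 := by
  rw [cv, map_add, map_smul, cl_linReg, cl_linReg, smul_zero, add_zero]

lemma cv_mem_span (d : Fin n × Bool) :
    cv n d ∈ Submodule.span ℂ (linRegs (Cn n) : Set (Reg (Cn n))) :=
  Submodule.add_mem _ (Submodule.subset_span ⟨_, rfl⟩)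
    (Submodule.smul_mem _ _ (Submodule.subset_span ⟨_, rfl⟩))

lemma sum_cv : ∑ i, cv n (i, false) * cv n (i, true) = 1 := by
  ext u
  rw [AddSubmonoidClass.coe_finsetSum, Finset.sum_apply]
  simp only [Subalgebra.coe_mul, Pi.mul_apply, cv_false, cv_true]
  have h : ‖(u : Cn n)‖ ^ 2 = 1 := by rw [mem_sphere_zero_iff_norm.1 u.2, one_pow]
  rw [EuclideanSpace.norm_sq_eq] at h
  have : ∀ z : ℂ, z * star z = ((‖z‖ ^ 2 : ℝ) : ℂ) := fun z => by
    rw [← Complex.normSq_eq_norm_sq]; exact Complex.mul_conj z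
  simp only [this]
  rw [← Complex.ofReal_sum, h]
  rfl

/-- A unitary matrix as a linear isometry. -/
def unitaryIso (U : Matrix (Fin n) (Fin n) ℂ) (h1 : U * star U = 1) (h2 : star U * U = 1) :
    Cn n ≃ₗᵢ[ℝ] Cn n where
  toLinearEquiv := LinearEquiv.ofLinearMap
    ((Matrix.toEuclideanLin U).restrictScalars ℝ) ((Matrix.toEuclideanLin (star U)).restrictScalars ℝ)
    (by
      ext1 x
      simp [Matrix.toLpLin_apply, h1])
    (by
      ext1 x
      simp [Matrix.toLpLin_apply, h2])
  norm_map' x := by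
    have : inner ℂ (Matrix.toEuclideanLin U x) (Matrix.toEuclideanLin U x) = inner ℂ x x := by
      rw [← LinearMap.adjoint_inner_right, ← Matrix.toEuclideanLin_conjTranspose_eq_adjoint]
      congr 1
      rw [← Matrix.star_eq_conjTranspose]
      simp [Matrix.toLpLin_apply, h2]
    rw [inner_self_eq_norm_sq_to_K, inner_self_eq_norm_sq_to_K] at this
    change ‖Matrix.toEuclideanLin U x‖ = ‖x‖
    have h3 : ‖Matrix.toEuclideanLin U x‖ ^ 2 = ‖x‖ ^ 2 := by exact_mod_cast this
    exact (pow_left_inj₀ (norm_nonneg _) (norm_nonneg _) two_ne_zero).1 h3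

lemma unitaryIso_symm_apply (U : Matrix (Fin n) (Fin n) ℂ) (h1 : U * star U = 1)
    (h2 : star U * U = 1) (x : Cn n) (i : Fin n) :
    (unitaryIso U h1 h2).symm x i = ∑ j, star (U j i) * x j := rfl

open Matrix in
/-- The unitary matrix with eigenvalue `e^{iθ}` in direction `v`, and `1` orthogonally to it. -/
def twist (v : Fin n → ℂ) (c : ℂ) : Matrix (Fin n) (Fin n) ℂ := 1 + (c - 1) • vecMulVec v (star v)

lemma star_twist (v : Fin n → ℂ) (c : ℂ) : star (twist v c) = twist v (star c) := by
  rw [twist, twist, star_add, star_one, star_smul, Matrix.star_eq_conjTranspose,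
    Matrix.conjTranspose_vecMulVec, star_star, star_sub, star_one]

lemma twist_mul {v : Fin n → ℂ} (hv : star v ⬝ᵥ v = 1) (c c' : ℂ) :
    twist v c * twist v c' = twist v (c * c') := by
  rw [twist, twist, twist, add_mul, mul_add, mul_add, one_mul, mul_one, one_mul, smul_mul_smul_comm,
    Matrix.vecMulVec_mul_vecMulVec, hv, one_smul]
  module

lemma twist_one (v : Fin n → ℂ) : twist v 1 = 1 := by simp [twist]

lemma det_twist {v : Fin n → ℂ} (hv : star v ⬝ᵥ v = 1) (c : ℂ) : (twist v c).det = c := by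
  rw [twist, Matrix.vecMulVec_eq Unit, ← Matrix.smul_mul,
    Matrix.det_one_add_mul_comm, Matrix.mul_smul, Matrix.det_unique]
  simp [Matrix.mul_apply, Matrix.replicateRow, Matrix.replicateCol]
  rw [dotProduct] at hv
  simp at hv
  rw [hv]
  ring

lemma twist_apply (v : Fin n → ℂ) (c : ℂ) (i j : Fin n) :
    twist v c i j = (1 : Matrix (Fin n) (Fin n) ℂ) i j + (c - 1) * (v i * star (v j)) := by
  simp [twist, Matrix.vecMulVec_apply]

lemma sum_star_twist (v : Fin n → ℂ) (c : ℂ) (x : Fin n → ℂ) (i : Fin n) :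
    ∑ j, star (twist v c j i) * x j = x i + (star c - 1) * ∑ j, v i * star (v j) * x j := by
  have : ∀ j, star (twist v c j i) * x j
      = (1 : Matrix (Fin n) (Fin n) ℂ) i j * x j + (star c - 1) * (v i * star (v j) * x j) := by
    intro j
    rw [← Matrix.star_apply (twist v c), star_twist, twist_apply]
    ring
  rw [Finset.sum_congr rfl fun j _ => this j, Finset.sum_add_distrib, Finset.mul_sum]
  simp [Matrix.one_apply]

/-- The values of a functional on a polynomial in the coordinates of several points of the sphere. -/
def slotFun (σ : Type*) [Fintype σ] [DecidableEq σ] {μ : ConvexBody (Cn n) → ℂ} (hμ : IsVal μ) :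
    MvPolynomial (σ × Fin n × Bool) ℂ →ₗ[ℂ] ℂ := ev μ hμ ∘ₗ polySlot cl (cv n)

/-- The directions of the infinitesimal action of `v v^*`. -/
def twistDir (v : Fin n → ℂ) (p : σ × Fin n × Bool) : MvPolynomial (σ × Fin n × Bool) ℂ :=
  if p.2.2 then ∑ j, (star (v p.2.1) * v j) • MvPolynomial.X (p.1, j, true)
  else ∑ j, (v p.2.1 * star (v j)) • MvPolynomial.X (p.1, j, false)

variable {μ : ConvexBody (Cn n) → ℂ} (hμ : IsVal μ) {l : ℤ}

lemma slotFun_twist (hl : HasWeight l μ) {v : Fin n → ℂ} (hv : star v ⬝ᵥ v = 1) {c : ℂ}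
    (hc : c * star c = 1) (P : MvPolynomial (σ × Fin n × Bool) ℂ) :
    slotFun σ hμ (MvPolynomial.aeval (fun p => MvPolynomial.X p +
      (if p.2.2 then c - 1 else star c - 1) • twistDir v p) P) = c ^ l * slotFun σ hμ P := by
  have h1 : twist v c * star (twist v c) = 1 := by
    rw [star_twist, twist_mul hv, hc, twist_one]
  have h2 : star (twist v c) * twist v c = 1 := by
    rw [star_twist, twist_mul hv, mul_comm, hc, twist_one]
  set g := unitaryIso (twist v c) h1 h2 with hg
  have h3 : ∀ K, μ (mapBody g K) = c ^ l * μ K := fun K => by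
    rw [hl (twist v c) ⟨h2, h1⟩ K (mapBody g K) rfl, det_twist hv]
  set q : Fin n × Bool → MvPolynomial (Fin n × Bool) ℂ := fun d =>
    if d.2 then MvPolynomial.X d + (c - 1) • ∑ j, (star (v d.1) * v j) • MvPolynomial.X (j, true)
    else MvPolynomial.X d + (star c - 1) • ∑ j, (v d.1 * star (v j)) • MvPolynomial.X (j, false) with hq
  have h4 : ∀ d, pull g.symm (cv n d) = MvPolynomial.aeval (cv n) (q d) := by
    rintro ⟨i, b⟩
    ext u
    have hu := unitaryIso_symm_apply (twist v c) h1 h2 u i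
    rw [← hg, sum_star_twist] at hu
    cases b
    · simp only [pull_apply, cv_false, hq, sphereMap, hu, map_add, map_smul, map_sum,
        MvPolynomial.aeval_X, Bool.false_eq_true, if_false, Subalgebra.coe_add, Subalgebra.coe_smul,
        AddSubmonoidClass.coe_finsetSum, Finset.sum_apply, Pi.add_apply, Pi.smul_apply, smul_eq_mul]
    · simp only [pull_apply, cv_true, hq, sphereMap, hu, map_add, map_smul, map_sum,
        MvPolynomial.aeval_X, if_true, Subalgebra.coe_add, Subalgebra.coe_smul,
        AddSubmonoidClass.coe_finsetSum, Finset.sum_apply, Pi.add_apply, Pi.smul_apply, smul_eq_mul,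
        star_add, star_mul', star_sub, star_one, star_star, star_sum]
  have h5 : act g (polySlot cl (cv n) P) = _ :=
    (polySlot_map (act_cl g) (cv n) P).trans (polySlot_subst cl h4 P)
  have h6 := ev_act hμ g h3 (polySlot cl (cv n) P)
  rw [h5] at h6
  have h7 : (fun p : σ × Fin n × Bool => MvPolynomial.X p +
      (if p.2.2 then c - 1 else star c - 1) • twistDir v p)
      = fun p => MvPolynomial.rename (Prod.mk p.1) (q p.2) := by
    ext1 p
    obtain ⟨s, i, b⟩ := p
    cases b
    · simp only [hq, twistDir, Bool.false_eq_true, if_false, map_add, map_smul, map_sum,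
        MvPolynomial.rename_X]
    · simp only [hq, twistDir, if_true, map_add, map_smul, map_sum, MvPolynomial.rename_X]
  rw [h7]
  exact h6

lemma slotFun_twist_deriv (hl : HasWeight l μ) {v : Fin n → ℂ} (hv : star v ⬝ᵥ v = 1)
    (P : MvPolynomial (σ × Fin n × Bool) ℂ) :
    slotFun σ hμ (MvPolynomial.mkDerivation ℂ
      (fun p => (if p.2.2 then (-1 : ℂ) else 1) • twistDir v p) P) = -l * slotFun σ hμ P := by
  have hexp : ∀ a : ℂ, HasDerivAt (fun θ : ℝ => Complex.exp (a * θ) - 1) a 0 := by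
    intro a
    have h1 : HasDerivAt (fun θ : ℝ => a * (θ : ℂ)) a 0 := by
      simpa using (Complex.ofRealCLM.hasDerivAt (x := 0)).const_mul a
    simpa using (h1.cexp).sub_const 1
  have h1 := hasDerivAt_subst
    (c := fun (p : σ × Fin n × Bool) (θ : ℝ) =>
      if p.2.2 then Complex.exp (Complex.I * θ) - 1 else Complex.exp (-Complex.I * θ) - 1)
    (d := fun p => if p.2.2 then Complex.I else -Complex.I) (twistDir v)
    (fun p => by simp) (fun p => by
      rcases p with ⟨s, i, _ | _⟩
      · simpa using hexp (-Complex.I)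
      · simpa using hexp Complex.I) P (slotFun σ hμ)
  have h2 : ∀ θ : ℝ, slotFun σ hμ (MvPolynomial.aeval (fun p => MvPolynomial.X p +
      (if p.2.2 then Complex.exp (Complex.I * θ) - 1 else Complex.exp (-Complex.I * θ) - 1)
        • twistDir v p) P) = Complex.exp (l * Complex.I * θ) * slotFun σ hμ P := by
    intro θ
    have hs : star (Complex.exp (Complex.I * θ)) = Complex.exp (-Complex.I * θ) := by
      rw [Complex.star_def, ← Complex.exp_conj]
      simp
    have := slotFun_twist (σ := σ) hμ hl hv (c := Complex.exp (Complex.I * θ))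
      (by rw [hs, ← Complex.exp_add]; simp) P
    rw [hs] at this
    rw [this, ← Complex.exp_int_mul, mul_assoc]
  simp only [h2] at h1
  have h3 : HasDerivAt (fun θ : ℝ => Complex.exp (l * Complex.I * θ) * slotFun σ hμ P)
      (l * Complex.I * slotFun σ hμ P) 0 := by
    have := ((hexp (l * Complex.I)).add_const 1).mul_const (slotFun σ hμ P)
    simpa using this
  have h4 := h1.unique h3
  have h5 : MvPolynomial.mkDerivation ℂ
      (fun p => (if p.2.2 then (-1 : ℂ) else 1) • twistDir v p) P = Complex.I •
      MvPolynomial.mkDerivation ℂ (fun p : σ × Fin n × Bool =>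
        (if p.2.2 then Complex.I else -Complex.I) • twistDir v p) P := by
    rw [← Derivation.smul_apply]
    congr 1
    apply MvPolynomial.derivation_ext
    intro p
    rw [Derivation.smul_apply, MvPolynomial.mkDerivation_X, MvPolynomial.mkDerivation_X, smul_smul]
    split_ifs <;> simp
  rw [h5, map_smul, h4, smul_eq_mul]
  linear_combination (l * slotFun σ hμ P) * Complex.I_mul_I

/-- The derivation `z_k ↦ δ_{ki} z_j`, `w_k ↦ -δ_{kj} w_i`. -/
def gen (i j : Fin n) : Derivation ℂ (MvPolynomial (σ × Fin n × Bool) ℂ)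
    (MvPolynomial (σ × Fin n × Bool) ℂ) :=
  MvPolynomial.mkDerivation ℂ fun p =>
    if p.2.2 then (if p.2.1 = j then -MvPolynomial.X (p.1, i, true) else 0)
    else (if p.2.1 = i then MvPolynomial.X (p.1, j, false) else 0)

lemma mkDerivation_twistDir (v : Fin n → ℂ) :
    MvPolynomial.mkDerivation ℂ
      (fun p : σ × Fin n × Bool => (if p.2.2 then (-1 : ℂ) else 1) • twistDir v p)
      = ∑ i, ∑ j, (v i * star (v j)) • gen i j := by
  apply MvPolynomial.derivation_ext
  rintro ⟨s, k, b⟩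
  have hs : ∀ f : Fin n → Fin n → Derivation ℂ (MvPolynomial (σ × Fin n × Bool) ℂ)
    (MvPolynomial (σ × Fin n × Bool) ℂ), ∀ P, (∑ i, ∑ j, f i j) P = ∑ i, ∑ j, f i j P := by
    intro f P
    simp only [← Derivation.coeFnAddMonoidHom_apply, map_sum, Finset.sum_apply]
  rw [hs]
  simp only [MvPolynomial.mkDerivation_X, Derivation.smul_apply, gen, twistDir]
  cases b
  · simp
  · simp [mul_comm]

lemma slotFun_gen (hl : HasWeight l μ) (i j : Fin n) (P : MvPolynomial (σ × Fin n × Bool) ℂ) :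
    slotFun σ hμ (gen i j P) = if i = j then -l * slotFun σ hμ P else 0 := by
  have key : ∀ v : Fin n → ℂ, star v ⬝ᵥ v = 1 →
      ∑ a, ∑ b, (v a * star (v b)) * slotFun σ hμ (gen a b P) = -l * slotFun σ hμ P := by
    intro v hv
    have hs : ∀ f : Fin n → Fin n → Derivation ℂ (MvPolynomial (σ × Fin n × Bool) ℂ)
      (MvPolynomial (σ × Fin n × Bool) ℂ), ∀ P, (∑ i, ∑ j, f i j) P = ∑ i, ∑ j, f i j P := by
      intro f P
      simp only [← Derivation.coeFnAddMonoidHom_apply, map_sum, Finset.sum_apply]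
    rw [← slotFun_twist_deriv hμ hl hv, mkDerivation_twistDir, hs]
    simp only [Derivation.smul_apply, map_sum, map_smul, smul_eq_mul]
  set G := fun a b => slotFun σ hμ (gen a b P) with hG
  have hsum : ∀ (a b : Fin n) (x y : ℂ), ∑ p, ∑ q, ((Pi.single a x + Pi.single b y : Fin n → ℂ) p *
      star ((Pi.single a x + Pi.single b y : Fin n → ℂ) q)) * G p q
      = x * star x * G a a + x * star y * G a b + y * star x * G b a + y * star y * G b b := by
    intro a b x y
    have h1 : ∀ p, ∑ q, ((Pi.single a x + Pi.single b y : Fin n → ℂ) p *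
      star ((Pi.single a x + Pi.single b y : Fin n → ℂ) q)) * G p q
      = (Pi.single a x + Pi.single b y : Fin n → ℂ) p * (star x * G p a + star y * G p b) := by
      intro p
      simp_rw [mul_assoc, ← Finset.mul_sum]
      have : ∀ q, star ((Pi.single a x + Pi.single b y : Fin n → ℂ) q)
          = (if q = a then star x else 0) + (if q = b then star y else 0) := by
        intro q
        rw [Pi.add_apply, star_add, Pi.single_apply, Pi.single_apply, apply_ite star, apply_ite star,
          star_zero]
      simp only [this, add_mul, ite_mul, zero_mul, Finset.sum_add_distrib, Finset.sum_ite_eq',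
        Finset.mem_univ, if_true]
    simp_rw [h1]
    simp only [Pi.add_apply, Pi.single_apply, add_mul, ite_mul, zero_mul, Finset.sum_add_distrib,
      Finset.sum_ite_eq', Finset.mem_univ, if_true]
    ring
  have hdiag : ∀ a, G a a = -l * slotFun σ hμ P := by
    intro a
    have h1 := key (Pi.single a 1) (by simp)
    have h2 := hsum a a 1 0
    simp only [Pi.single_zero, add_zero] at h2
    rw [h2] at h1
    simpa using h1
  split_ifs with h
  · rw [← h]; exact hdiag i
  · have hd : ∀ x y : ℂ, star x * x + star y * y = 1 →
        star (Pi.single i x + Pi.single j y : Fin n → ℂ) ⬝ᵥ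
          (Pi.single i x + Pi.single j y : Fin n → ℂ) = 1 := by
      intro x y hxy
      rw [star_add, add_dotProduct, dotProduct_add, dotProduct_add]
      simp [h, Ne.symm h, ← hxy]
    have h1 := key _ (hd (3 / 5) (4 / 5) (by simp; norm_num))
    have h2 := key _ (hd (3 / 5) (4 / 5 * Complex.I) (by
      simp; ring_nf; simp [Complex.I_sq]; norm_num))
    erw [hsum] at h1 h2
    rw [hdiag, hdiag] at h1 h2
    change G i j = 0
    have e3 : star (3 / 5 : ℂ) = 3 / 5 := by simp
    have e4 : star (4 / 5 : ℂ) = 4 / 5 := by simp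
    have e5 : star (4 / 5 * Complex.I) = -(4 / 5 * Complex.I) := by simp
    rw [e3, e4] at h1
    rw [e3, e5] at h2
    linear_combination 25 / 24 * h1 + 25 / 24 * Complex.I * h2 +
      (25 / 24 * Complex.I * (16 / 25) * (-l * slotFun σ hμ P) + 1 / 2 * G i j - 1 / 2 * G j i) *
        Complex.I_mul_I

lemma slotFun_sphere (P : MvPolynomial (σ × Fin n × Bool) ℂ) (s : σ) :
    slotFun σ hμ (P * ∑ i, MvPolynomial.X (s, i, false) * MvPolynomial.X (s, i, true))
      = slotFun σ hμ P := by
  have h : slotEval (cv n)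
      (∑ i, MvPolynomial.X (s, i, false) * MvPolynomial.X (s, i, true)) = 1 := by
    simp only [map_sum, map_mul, slotEval_X]
    simp only [← map_mul, ← map_sum]
    rw [sum_cv, map_one]
  simp only [slotFun, LinearMap.comp_apply, polySlot_apply]
  rw [map_mul (slotEval (cv n)), h, mul_one]

lemma slotFun_mul_X (s : σ) (d : Fin n × Bool) {P : MvPolynomial (σ × Fin n × Bool) ℂ}
    (hP : P ∈ MvPolynomial.supported ℂ {p : σ × Fin n × Bool | p.1 ≠ s}) :
    slotFun σ hμ (P * MvPolynomial.X (s, d)) = 0 := by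
  rw [slotFun, LinearMap.comp_apply, polySlot_mul_X cl s d (cl_cv d) hP, map_zero]

lemma slotFun_cubic {s t : σ} (hst : s ≠ t) (d₁ d₂ d₃ : Fin n × Bool)
    (P : MvPolynomial (σ × Fin n × Bool) ℂ) :
    slotFun σ hμ (P * ((MvPolynomial.X (s, d₁) - MvPolynomial.X (t, d₁)) *
      (MvPolynomial.X (s, d₂) - MvPolynomial.X (t, d₂)) *
      (MvPolynomial.X (s, d₃) - MvPolynomial.X (t, d₃)))) = 0 := by
  rw [slotFun, LinearMap.comp_apply, polySlot_cubic cl cv_mem_span ?_ hst, map_zero]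
  rintro _ ⟨e, rfl⟩ W
  have key : ∀ W : Reg (Cn n) ⊗[ℂ] Reg (Cn n),
      LinearMap.mul' ℂ (BodyAlg (Cn n)) (TensorProduct.map cl cl W) = cl₂ W := by
    intro W
    induction W with
    | zero => rw [map_zero, map_zero, map_zero]
    | add x y hx hy => rw [map_add, map_add, hx, hy, map_add]
    | tmul a b => rw [TensorProduct.map_tmul, LinearMap.mul'_apply, cl₂_tmul]
  rw [key]
  exact cl₂_tile e W

end Coordinates

section Relations
variable {R ι : Type*} [CommRing R] [Algebra ℂ R] {I : Ideal R}

lemma mem_of_mul_mem {c : ℂ} (hc : c ≠ 0) {x : R} (h : algebraMap ℂ R c * x ∈ I) : x ∈ I := by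
  have := I.mul_mem_left (algebraMap ℂ R c⁻¹) h
  rwa [← mul_assoc, ← map_mul, inv_mul_cancel₀ hc, map_one, one_mul] at this

lemma mem_of_natCast_mul_mem {k : ℕ} (hk : k ≠ 0) {x : R} (h : (k : R) * x ∈ I) : x ∈ I :=
  mem_of_mul_mem (c := k) (by exact_mod_cast hk) (by rwa [map_natCast])

variable {a b c : ι → R} (ha : ∀ i j k, a i * a j * a k ∈ I) (hb : ∀ i j k, b i * b j * b k ∈ I)
  (hab : ∀ i j k, (a i - b i) * (a j - b j) * (a k - b k) ∈ I)
include ha hb hab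

omit [Algebra ℂ R] in
lemma cross_mem (i j k m : ι) :
    a i * a j * (b k * b m) + a i * a k * (b j * b m) + a j * a k * (b i * b m) ∈ I := by
  have e : a i * a j * (b k * b m) + a i * a k * (b j * b m) + a j * a k * (b i * b m)
      = b m * (a i * a j * a k) + a i * (b j * b k * b m) + a j * (b i * b k * b m)
        + a k * (b i * b j * b m) - b m * (b i * b j * b k)
        - b m * ((a i - b i) * (a j - b j) * (a k - b k)) := by ring
  rw [e]
  exact I.sub_mem (I.sub_mem (I.add_mem (I.add_mem (I.add_mem (I.mul_mem_left _ (ha _ _ _))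
    (I.mul_mem_left _ (hb _ _ _))) (I.mul_mem_left _ (hb _ _ _)))
    (I.mul_mem_left _ (hb _ _ _))) (I.mul_mem_left _ (hb _ _ _))) (I.mul_mem_left _ (hab _ _ _))

lemma sq_mul_mem (z r : ι) : a z * a z * (b z * b r) ∈ I := by
  have hba : ∀ i j k, (b i - a i) * (b j - a j) * (b k - a k) ∈ I := fun i j k => by
    rw [show (b i - a i) * (b j - a j) * (b k - a k)
      = -((a i - b i) * (a j - b j) * (a k - b k)) by ring]
    exact I.neg_mem (hab i j k)
  have h1 := cross_mem ha hb hab z z r z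
  have h2 := cross_mem hb ha hba z z r z
  refine mem_of_natCast_mul_mem (k := 3) (by norm_num) ?_
  rw [show ((3 : ℕ) : R) * (a z * a z * (b z * b r))
    = 2 * (b z * b z * (a r * a z) + b z * b r * (a z * a z) + b z * b r * (a z * a z))
      - (a z * a z * (b r * b z) + a z * a r * (b z * b z) + a z * a r * (b z * b z)) by
    push_cast; ring]
  exact I.sub_mem (I.mul_mem_left _ h2) h1

lemma triple_mul_mem (hc : ∀ i j k, c i * c j * c k ∈ I)
    (hac : ∀ i j k, (a i - c i) * (a j - c j) * (a k - c k) ∈ I) (z r s t : ι) :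
    a z * a r * (b z * b s) * (c z * c t) ∈ I := by
  have h1 := cross_mem ha hb hab z z s r
  have h2 := cross_mem ha hb hab z z r s
  have h3 := sq_mul_mem ha hc hac z t
  refine mem_of_natCast_mul_mem (k := 2) (by norm_num) ?_
  rw [show ((2 : ℕ) : R) * (a z * a r * (b z * b s) * (c z * c t))
    = c z * c t * (a z * a z * (b r * b s) + a z * a r * (b z * b s) + a z * a r * (b z * b s))
      - b r * b s * (a z * a z * (c z * c t)) by push_cast; ring]
  exact I.sub_mem (I.mul_mem_left _ h2) (I.mul_mem_left _ h3)

end Relations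

section Weights
variable {R ι σ : Type*} [CommRing R] [Algebra ℂ R] {I : Ideal R}

lemma prod_mem_of_weight [DecidableEq σ] {L : σ → ι → R} {U : Finset σ}
    (h1 : ∀ s ∈ U, ∀ i j k, L s i * L s j * L s k ∈ I)
    (h2 : ∀ s ∈ U, ∀ t ∈ U, s ≠ t → ∀ i j k,
      (L s i - L t i) * (L s j - L t j) * (L s k - L t k) ∈ I)
    {wt : ι → ℤ} {z : ι} (hz : wt z = 1) (hwt : ∀ i, i ≠ z → wt i ≤ 0) (α β : σ → ι)
    (h : 3 ≤ ∑ s ∈ U, (wt (α s) + wt (β s))) : ∏ s ∈ U, L s (α s) * L s (β s) ∈ I := by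
  classical
  have hle : ∀ i, wt i ≤ 1 := fun i => by
    rcases eq_or_ne i z with rfl | hi
    · exact hz.le
    · exact (hwt i hi).trans zero_le_one
  set V := U.filter fun s => α s = z ∨ β s = z with hV
  have hVU : V ⊆ U := Finset.filter_subset _ _
  have hL : ∀ s ∈ V, ∃ r, L s (α s) * L s (β s) = L s z * L s r := by
    intro s hs
    rcases (Finset.mem_filter.1 hs).2 with h | h
    · exact ⟨β s, by rw [h]⟩
    · exact ⟨α s, by rw [h, mul_comm]⟩
  have hsum : 3 ≤ ∑ s ∈ V, (wt (α s) + wt (β s)) := by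
    refine h.trans ?_
    rw [hV, Finset.sum_filter]
    refine Finset.sum_le_sum fun s _ => ?_
    split_ifs with hs
    · exact le_rfl
    · rw [not_or] at hs
      exact add_nonpos (hwt _ hs.1) (hwt _ hs.2)
  have hdvd := Finset.prod_dvd_prod_of_subset V U (fun s => L s (α s) * L s (β s)) hVU
  have fin : ∀ W : Finset σ, W ⊆ U → ∏ s ∈ W, L s (α s) * L s (β s) ∈ I →
      ∏ s ∈ U, L s (α s) * L s (β s) ∈ I := fun W hW hm =>
    I.mem_of_dvd (Finset.prod_dvd_prod_of_subset W U (fun s => L s (α s) * L s (β s)) hW) hm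
  rcases lt_or_ge 2 V.card with hc | hc
  · obtain ⟨a, b, c, ha, hb, hc, hab, hac, hbc⟩ := Finset.two_lt_card_iff.1 hc
    refine fin {a, b, c} ?_ ?_
    · intro x hx
      simp only [Finset.mem_insert, Finset.mem_singleton] at hx
      rcases hx with rfl | rfl | rfl
      exacts [hVU ha, hVU hb, hVU hc]
    · rw [Finset.prod_insert (by simp [hab, hac]), Finset.prod_insert (by simp [hbc]),
        Finset.prod_singleton, ← mul_assoc]
      obtain ⟨r, hr⟩ := hL a ha
      obtain ⟨s, hs⟩ := hL b hb
      obtain ⟨t, ht⟩ := hL c hc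
      rw [hr, hs, ht]
      exact triple_mul_mem (h1 a (hVU ha)) (h1 b (hVU hb)) (h2 a (hVU ha) b (hVU hb) hab)
        (h1 c (hVU hc)) (h2 a (hVU ha) c (hVU hc) hac) z r s t
  · have hlt : 1 < V.card := by
      by_contra hcon
      have h3 : ∑ s ∈ V, (wt (α s) + wt (β s)) ≤ V.card • (2 : ℤ) :=
        Finset.sum_le_card_nsmul _ _ _ fun s _ => by linarith [hle (α s), hle (β s)]
      have : (V.card : ℤ) ≤ 1 := by exact_mod_cast not_lt.1 hcon
      rw [nsmul_eq_mul] at h3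
      linarith
    obtain ⟨a, b, hab, hVab⟩ := Finset.card_eq_two.1 (le_antisymm hc hlt)
    refine fin V hVU ?_
    have ha : a ∈ V := by simp [hVab]
    have hb : b ∈ V := by simp [hVab]
    have h2' : ∀ s : σ, 2 ≤ wt (α s) + wt (β s) → α s = z ∧ β s = z := by
      intro s hs
      constructor
      · by_contra hn
        linarith [hwt _ hn, hle (β s)]
      · by_contra hn
        linarith [hwt _ hn, hle (α s)]
    obtain ⟨r, hr⟩ := hL a ha
    obtain ⟨s, hs⟩ := hL b hb
    rw [hVab, Finset.sum_pair hab] at hsum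
    rw [hVab, Finset.prod_pair hab]
    have hsum' : 2 ≤ wt (α a) + wt (β a) ∨ 2 ≤ wt (α b) + wt (β b) := by omega
    rcases hsum' with h | h
    · rw [(h2' a h).1, (h2' a h).2, hs]
      exact sq_mul_mem (h1 a (hVU ha)) (h1 b (hVU hb)) (h2 a (hVU ha) b (hVU hb) hab) z s
    · rw [(h2' b h).1, (h2' b h).2, hr, mul_comm]
      exact sq_mul_mem (h1 b (hVU hb)) (h1 a (hVU ha)) (h2 b (hVU hb) a (hVU ha) hab.symm) z r

end Weights

/-- Polynomials in the coordinates `z, w` (with `w` the conjugates) of vectors indexed by `σ`. -/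
abbrev SlotPoly (σ : Type*) (n : ℕ) := MvPolynomial (σ × Fin n × Bool) ℂ

/-- The properties of `slotFun` from which its vanishing is derived. -/
structure IsSlotFun {σ : Type*} {n : ℕ} (l : ℤ) (T : SlotPoly σ n →ₗ[ℂ] ℂ) : Prop where
  gen : ∀ i j P, T (gen i j P) = if i = j then -l * T P else 0
  sphere : ∀ P s, T (P * ∑ i, MvPolynomial.X (s, i, false) * MvPolynomial.X (s, i, true)) = T P
  mul_X : ∀ s d, ∀ P ∈ MvPolynomial.supported ℂ {p : σ × Fin n × Bool | p.1 ≠ s},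
    T (P * MvPolynomial.X (s, d)) = 0
  cubic : ∀ s t, s ≠ t → ∀ d₁ d₂ d₃ P,
    T (P * ((MvPolynomial.X (s, d₁) - MvPolynomial.X (t, d₁)) *
      (MvPolynomial.X (s, d₂) - MvPolynomial.X (t, d₂)) *
      (MvPolynomial.X (s, d₃) - MvPolynomial.X (t, d₃)))) = 0

section Invariants
variable {σ : Type*} {n : ℕ} (o : σ) (i j : Fin n)

local notation "Z" => fun (s : σ) (k : Fin n) => (MvPolynomial.X (s, k, false) : SlotPoly σ n)
local notation "W" => fun (s : σ) (k : Fin n) => (MvPolynomial.X (s, k, true) : SlotPoly σ n)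

/-- The vector `(z_j, -z_i)` of the slot `o`, up to sign. -/
def zp (k : Fin n) : SlotPoly σ n := (if k = j then Z o i else 0) - if k = i then Z o j else 0

/-- The vector `(w_j, -w_i)` of the slot `o`, up to sign. -/
def wp (k : Fin n) : SlotPoly σ n := (if k = j then W o i else 0) - if k = i then W o j else 0

/-- The minor of the `z`-coordinates `i, j` of the slots `o, s`. -/
def zeta (s : σ) : SlotPoly σ n := Z o i * Z s j - Z o j * Z s i

/-- The minor of the `w`-coordinates `i, j` of the slots `o, s`. -/
def zetaBar (s : σ) : SlotPoly σ n := W o i * W s j - W o j * W s i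

/-- The squared length of the `i, j` coordinates of the slot `o`. -/
def rho : SlotPoly σ n := Z o i * W o i + Z o j * W o j

/-- The derivation rotating the `i, j` coordinates so that the slot `o` is fixed. -/
def rot : Derivation ℂ (SlotPoly σ n) (SlotPoly σ n) :=
  ∑ a, ∑ b, (wp o i j a * zp o i j b) • gen a b

lemma rot_apply (P : SlotPoly σ n) :
    rot o i j P = ∑ a, ∑ b, wp o i j a * zp o i j b * gen a b P := by
  have : ∀ (S : Finset (Fin n)) (f : Fin n → Derivation ℂ (SlotPoly σ n) (SlotPoly σ n)),
      (∑ a ∈ S, f a) P = ∑ a ∈ S, f a P := fun S f => by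
    rw [← Derivation.coeFnAddMonoidHom_apply, map_sum, Finset.sum_apply]; rfl
  simp only [rot, this, Derivation.smul_apply, smul_eq_mul]

lemma gen_Z (a b : Fin n) (s : σ) (k : Fin n) :
    gen a b (Z s k) = if k = a then Z s b else 0 := by
  simp [gen, MvPolynomial.mkDerivation_X]

lemma gen_W (a b : Fin n) (s : σ) (k : Fin n) :
    gen a b (W s k) = if k = b then - W s a else 0 := by
  simp [gen, MvPolynomial.mkDerivation_X]

lemma sum_zp_mul (s : σ) : ∑ b, zp o i j b * Z s b = zeta o i j s := by
  simp [zp, zeta, sub_mul, Finset.sum_sub_distrib]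

lemma sum_wp_mul (s : σ) : ∑ a, wp o i j a * W s a = zetaBar o i j s := by
  simp [wp, zetaBar, sub_mul, Finset.sum_sub_distrib]

lemma rot_Z (s : σ) (k : Fin n) : rot o i j (Z s k) = wp o i j k * zeta o i j s := by
  rw [rot_apply]
  have : ∀ a b, gen a b (Z s k) = if k = a then Z s b else 0 := fun a b => gen_Z a b s k
  simp only [this, mul_ite, mul_zero]
  rw [Finset.sum_comm]
  simp only [Finset.sum_ite_eq, Finset.mem_univ, if_true, mul_assoc, ← Finset.mul_sum]
  rw [← sum_zp_mul]

lemma rot_W (s : σ) (k : Fin n) : rot o i j (W s k) = -(zp o i j k * zetaBar o i j s) := by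
  rw [rot_apply]
  have : ∀ a b, gen a b (W s k) = if k = b then - W s a else 0 := fun a b => gen_W a b s k
  simp only [this, mul_ite, mul_zero]
  simp only [Finset.sum_ite_eq, Finset.mem_univ, if_true]
  rw [← sum_wp_mul, Finset.mul_sum, ← Finset.sum_neg_distrib]
  exact Finset.sum_congr rfl fun a _ => by ring

lemma zeta_self : zeta o i j o = 0 := by simp only [zeta]; ring
lemma zetaBar_self : zetaBar o i j o = 0 := by simp only [zetaBar]; ring

lemma rot_Z_self (k : Fin n) : rot o i j (Z o k) = 0 := by
  rw [rot_Z, zeta_self, mul_zero]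

lemma rot_W_self (k : Fin n) : rot o i j (W o k) = 0 := by
  rw [rot_W, zetaBar_self, mul_zero, neg_zero]

lemma rot_of_supported {c : SlotPoly σ n}
    (hc : c ∈ MvPolynomial.supported ℂ {p : σ × Fin n × Bool | p.1 = o}) : rot o i j c = 0 := by
  induction hc using Algebra.adjoin_induction with
  | mem x hx =>
    obtain ⟨⟨s, k, b⟩, rfl, rfl⟩ := hx
    cases b
    · exact rot_Z_self _ i j k
    · exact rot_W_self _ i j k
  | algebraMap r => exact Derivation.map_algebraMap _ r
  | add x y _ _ hx hy => rw [map_add, hx, hy, add_zero]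
  | mul x y _ _ hx hy => rw [Derivation.leibniz, hx, hy, smul_zero, smul_zero, add_zero]

section
variable {i j} (hij : i ≠ j)
include hij

lemma zp_left : zp o i j i = -Z o j := by simp [zp, hij]
lemma zp_right : zp o i j j = Z o i := by simp [zp, hij.symm]
lemma wp_left : wp o i j i = -W o j := by simp [wp, hij]
lemma wp_right : wp o i j j = W o i := by simp [wp, hij.symm]

lemma rot_zeta (s : σ) : rot o i j (zeta o i j s) = rho o i j * zeta o i j s := by
  have h1 := rot_Z_self o i j i
  have h2 := rot_Z_self o i j j
  have h3 := rot_Z o i j s i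
  have h4 := rot_Z o i j s j
  rw [wp_left o hij] at h3
  rw [wp_right o hij] at h4
  conv_lhs => rw [zeta]
  simp only [map_sub, Derivation.leibniz, smul_eq_mul] at *
  rw [h1, h2, h3, h4, rho]
  ring

lemma rot_zetaBar (s : σ) : rot o i j (zetaBar o i j s) = -(rho o i j * zetaBar o i j s) := by
  have h1 := rot_W_self o i j i
  have h2 := rot_W_self o i j j
  have h3 := rot_W o i j s i
  have h4 := rot_W o i j s j
  rw [zp_left o hij] at h3
  rw [zp_right o hij] at h4
  conv_lhs => rw [zetaBar]
  simp only [map_sub, Derivation.leibniz, smul_eq_mul] at *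
  rw [h1, h2, h3, h4, rho]
  ring

lemma sum_wp_mul_zp : ∑ a, wp o i j a * zp o i j a = rho o i j := by
  rw [Finset.sum_eq_add_of_mem i j (Finset.mem_univ _) (Finset.mem_univ _) hij]
  · rw [zp_left o hij, zp_right o hij, wp_left o hij, wp_right o hij, rho]; ring
  · rintro c - ⟨h1, h2⟩
    simp [zp, h1, h2]

lemma sum_gen_wp_mul_zp : ∑ a, ∑ b, gen a b (wp o i j a * zp o i j b) = 0 := by
  have hz : ∀ a b, gen a b (zp o i j b)
      = (if b = j then if i = a then Z o b else 0 else 0)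
        - if b = i then if j = a then Z o b else 0 else 0 := by
    intro a b
    rw [zp, map_sub]
    congr 1 <;> split_ifs <;> simp_all [gen_Z]
  have hw : ∀ a b, gen a b (wp o i j a)
      = (if i = b then if a = j then -W o a else 0 else 0)
        - if j = b then if a = i then -W o a else 0 else 0 := by
    intro a b
    rw [wp, map_sub]
    congr 1 <;> split_ifs <;> simp_all [gen_W]
  simp only [Derivation.leibniz, smul_eq_mul, hz, hw, Finset.sum_add_distrib, mul_sub,
    Finset.sum_sub_distrib, mul_ite, mul_zero, Finset.sum_ite_eq, Finset.sum_ite_eq',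
    Finset.mem_univ, if_true]
  rw [zp_left o hij, zp_right o hij, wp_left o hij, wp_right o hij]
  ring

lemma IsSlotFun.apply_rot {l : ℤ} {T : SlotPoly σ n →ₗ[ℂ] ℂ} (hT : IsSlotFun l T)
    (P : SlotPoly σ n) : T (rot o i j P) = -l * T (rho o i j * P) := by
  have h1 : rot o i j P = ∑ a, ∑ b, UVal.gen a b (wp o i j a * zp o i j b * P) := by
    rw [rot_apply]
    have h2 : ∀ a b, UVal.gen a b (wp o i j a * zp o i j b * P)
        = wp o i j a * zp o i j b * UVal.gen a b P + P * UVal.gen a b (wp o i j a * zp o i j b) :=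
      fun a b => by rw [Derivation.leibniz, smul_eq_mul, smul_eq_mul]
    simp only [h2, Finset.sum_add_distrib, ← Finset.mul_sum]
    rw [sum_gen_wp_mul_zp o hij, mul_zero, add_zero]
  rw [h1]
  simp only [map_sum, hT.gen, Finset.sum_ite_eq, Finset.mem_univ, if_true]
  rw [← Finset.mul_sum, ← map_sum, ← Finset.sum_mul, sum_wp_mul_zp o hij]

end

/-- A spanning family, up to powers of `rho`, of the differences of the slots `s` and `o`,
consisting of eigenvectors of `rot`. -/
def eigenForm (s : σ) : Bool ⊕ (Fin n × Bool) → SlotPoly σ n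
  | .inl false => zeta o i j s
  | .inl true => zetaBar o i j s
  | .inr (k, false) => rho o i j * (Z s k - Z o k) - wp o i j k * zeta o i j s
  | .inr (k, true) => rho o i j * (W s k - W o k) - zp o i j k * zetaBar o i j s

/-- The eigenvalues of `rot` on `eigenForm`, in units of `rho`. -/
def formWt : Bool ⊕ (Fin n × Bool) → ℤ
  | .inl false => 1
  | .inl true => -1
  | .inr _ => 0

lemma zp_mem : ∀ k, zp o i j k ∈ MvPolynomial.supported ℂ {p : σ × Fin n × Bool | p.1 = o} := by
  intro k
  have h : ∀ k b, (MvPolynomial.X (o, k, b) : SlotPoly σ n) ∈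
      MvPolynomial.supported ℂ {p : σ × Fin n × Bool | p.1 = o} := fun k b =>
    Algebra.subset_adjoin ⟨_, rfl, rfl⟩
  rw [zp]
  refine Subalgebra.sub_mem _ ?_ ?_ <;> split_ifs <;> simp [h]

lemma wp_mem : ∀ k, wp o i j k ∈ MvPolynomial.supported ℂ {p : σ × Fin n × Bool | p.1 = o} := by
  intro k
  have h : ∀ k b, (MvPolynomial.X (o, k, b) : SlotPoly σ n) ∈
      MvPolynomial.supported ℂ {p : σ × Fin n × Bool | p.1 = o} := fun k b =>
    Algebra.subset_adjoin ⟨_, rfl, rfl⟩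
  rw [wp]
  refine Subalgebra.sub_mem _ ?_ ?_ <;> split_ifs <;> simp [h]

lemma rho_mem : rho o i j ∈ MvPolynomial.supported ℂ {p : σ × Fin n × Bool | p.1 = o} := by
  have h : ∀ k b, (MvPolynomial.X (o, k, b) : SlotPoly σ n) ∈
      MvPolynomial.supported ℂ {p : σ × Fin n × Bool | p.1 = o} := fun k b =>
    Algebra.subset_adjoin ⟨_, rfl, rfl⟩
  exact Subalgebra.add_mem _ (Subalgebra.mul_mem _ (h _ _) (h _ _))
    (Subalgebra.mul_mem _ (h _ _) (h _ _))

variable {i j}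

lemma rot_eigenForm (hij : i ≠ j) (s : σ) (α : Bool ⊕ (Fin n × Bool)) :
    rot o i j (eigenForm o i j s α) = formWt α • (rho o i j * eigenForm o i j s α) := by
  match α with
  | .inl false => rw [eigenForm, rot_zeta o hij, formWt, one_smul]
  | .inl true => rw [eigenForm, rot_zetaBar o hij, formWt, neg_smul, one_smul]
  | .inr (k, false) =>
    have h1 := rot_Z o i j s k
    have h2 := rot_Z_self o i j k
    simp only [eigenForm, formWt, map_sub, Derivation.leibniz, smul_eq_mul, zero_smul] at *
    rw [h1, h2, rot_zeta o hij, rot_of_supported o i j (wp_mem o i j k),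
      rot_of_supported o i j (rho_mem o i j)]
    ring
  | .inr (k, true) =>
    have h1 := rot_W o i j s k
    have h2 := rot_W_self o i j k
    simp only [eigenForm, formWt, map_sub, Derivation.leibniz, smul_eq_mul, zero_smul] at *
    rw [h1, h2, rot_zetaBar o hij, rot_of_supported o i j (zp_mem o i j k),
      rot_of_supported o i j (rho_mem o i j)]
    ring

lemma eigenForm_self (α : Bool ⊕ (Fin n × Bool)) : eigenForm o i j o α = 0 := by
  match α with
  | .inl false => exact zeta_self o i j
  | .inl true => exact zetaBar_self o i j
  | .inr (k, false) => simp only [eigenForm]; rw [zeta_self]; ring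
  | .inr (k, true) => simp only [eigenForm]; rw [zetaBar_self]; ring

lemma eigenForm_sub_mem (s t : σ) (α : Bool ⊕ (Fin n × Bool)) :
    eigenForm o i j s α - eigenForm o i j t α ∈
      Ideal.span (Set.range fun d => (MvPolynomial.X (s, d) - MvPolynomial.X (t, d)
        : SlotPoly σ n)) := by
  set I := Ideal.span (Set.range fun d => (MvPolynomial.X (s, d) - MvPolynomial.X (t, d)
        : SlotPoly σ n))
  have h : ∀ d, (MvPolynomial.X (s, d) - MvPolynomial.X (t, d) : SlotPoly σ n) ∈ I := fun d =>
    Ideal.subset_span ⟨d, rfl⟩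
  have h1 : zeta o i j s - zeta o i j t ∈ I := by
    rw [show zeta o i j s - zeta o i j t = Z o i * (Z s j - Z t j) - Z o j * (Z s i - Z t i) by
      simp only [zeta]; ring]
    exact I.sub_mem (I.mul_mem_left _ (h _)) (I.mul_mem_left _ (h _))
  have h2 : zetaBar o i j s - zetaBar o i j t ∈ I := by
    rw [show zetaBar o i j s - zetaBar o i j t = W o i * (W s j - W t j) - W o j * (W s i - W t i) by
      simp only [zetaBar]; ring]
    exact I.sub_mem (I.mul_mem_left _ (h _)) (I.mul_mem_left _ (h _))
  match α with
  | .inl false => exact h1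
  | .inl true => exact h2
  | .inr (k, false) =>
    rw [show eigenForm o i j s (.inr (k, false)) - eigenForm o i j t (.inr (k, false))
      = rho o i j * (Z s k - Z t k) - wp o i j k * (zeta o i j s - zeta o i j t) by
      simp only [eigenForm]; ring]
    exact I.sub_mem (I.mul_mem_left _ (h _)) (I.mul_mem_left _ h1)
  | .inr (k, true) =>
    rw [show eigenForm o i j s (.inr (k, true)) - eigenForm o i j t (.inr (k, true))
      = rho o i j * (W s k - W t k) - zp o i j k * (zetaBar o i j s - zetaBar o i j t) by
      simp only [eigenForm]; ring]
    exact I.sub_mem (I.mul_mem_left _ (h _)) (I.mul_mem_left _ h2)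

end Invariants

lemma Derivation.apply_prod_eigen {R ι : Type*} [CommRing R] [Algebra ℂ R] (D : Derivation ℂ R R)
    (r : R) (U : Finset ι) (f : ι → R) (k : ι → ℤ) (h : ∀ s, D (f s) = k s • (r * f s)) :
    D (∏ s ∈ U, f s) = (∑ s ∈ U, k s) • (r * ∏ s ∈ U, f s) := by
  classical
  induction U using Finset.induction_on with
  | empty => simp
  | insert a U ha ih =>
    rw [Finset.prod_insert ha, Finset.sum_insert ha, Derivation.leibniz, ih, h]
    simp only [smul_eq_mul, zsmul_eq_mul]
    push_cast
    ring

lemma cube_mem_of_span {R : Type*} [CommRing R] {I : Ideal R} {S : Set R}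
    (h : ∀ x ∈ S, ∀ y ∈ S, ∀ z ∈ S, x * y * z ∈ I) {x y z : R} (hx : x ∈ Ideal.span S)
    (hy : y ∈ Ideal.span S) (hz : z ∈ Ideal.span S) : x * y * z ∈ I := by
  have h1 : Ideal.span S * Ideal.span S * Ideal.span S ≤ I := by
    rw [Ideal.span_mul_span', Ideal.span_mul_span', Ideal.span_le]
    rintro _ ⟨_, ⟨x, hx, y, hy, rfl⟩, z, hz, rfl⟩
    exact h x hx y hy z hz
  exact h1 (Ideal.mul_mem_mul (Ideal.mul_mem_mul hx hy) hz)

lemma mul_formWt_nonpos {n : ℕ} {ε : ℤ} (hε : ε = 1 ∨ ε = -1) (a : Bool ⊕ (Fin n × Bool))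
    (ha : a ≠ .inl (decide (ε = -1))) : ε * formWt a ≤ 0 := by
  rcases hε with rfl | rfl <;> rcases a with (_ | _) | a <;> simp_all [formWt]

section SlotFun
variable {σ : Type*} {n : ℕ} {l : ℤ} {T : SlotPoly σ n →ₗ[ℂ] ℂ} (hT : IsSlotFun l T)
include hT

lemma IsSlotFun.cube_mem {s t : σ} (hst : s ≠ t) {x y z : SlotPoly σ n}
    (hx : x ∈ Ideal.span (Set.range fun d => (MvPolynomial.X (s, d) - MvPolynomial.X (t, d)
      : SlotPoly σ n)))
    (hy : y ∈ Ideal.span (Set.range fun d => (MvPolynomial.X (s, d) - MvPolynomial.X (t, d)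
      : SlotPoly σ n)))
    (hz : z ∈ Ideal.span (Set.range fun d => (MvPolynomial.X (s, d) - MvPolynomial.X (t, d)
      : SlotPoly σ n))) : x * y * z ∈ annIdeal T := by
  refine cube_mem_of_span ?_ hx hy hz
  rintro _ ⟨d₁, rfl⟩ _ ⟨d₂, rfl⟩ _ ⟨d₃, rfl⟩ Q
  exact hT.cubic s t hst d₁ d₂ d₃ Q

variable (o : σ) {i j : Fin n} (hij : i ≠ j)

lemma IsSlotFun.prod_mem [DecidableEq σ] {U : Finset σ} (hU : o ∉ U) {ε : ℤ} (hε : ε = 1 ∨ ε = -1)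
    (α β : σ → Bool ⊕ (Fin n × Bool))
    (h : 3 ≤ ∑ s ∈ U, (ε * formWt (α s) + ε * formWt (β s))) :
    ∏ s ∈ U, eigenForm o i j s (α s) * eigenForm o i j s (β s) ∈ annIdeal T := by
  have h1 : ∀ s t : σ, s ≠ t → ∀ a b c, (eigenForm o i j s a - eigenForm o i j t a) *
      (eigenForm o i j s b - eigenForm o i j t b) *
      (eigenForm o i j s c - eigenForm o i j t c) ∈ annIdeal T := fun s t hst a b c =>
    hT.cube_mem hst (eigenForm_sub_mem o s t a) (eigenForm_sub_mem o s t b)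
      (eigenForm_sub_mem o s t c)
  refine prod_mem_of_weight (fun s hs a b c => ?_) (fun s _ t _ hst => h1 s t hst)
    (wt := fun a => ε * formWt a) (z := .inl (decide (ε = -1))) ?_
    (mul_formWt_nonpos hε) α β h
  · have := h1 s o (by rintro rfl; exact hU hs) a b c
    simpa only [eigenForm_self, sub_zero] using this
  · rcases hε with rfl | rfl <;> simp [formWt]

include hij in
lemma IsSlotFun.apply_rho_mul_prod [DecidableEq σ] (hl : 3 ≤ |l|) {U : Finset σ} (hU : o ∉ U)
    {c : SlotPoly σ n} (hc : c ∈ MvPolynomial.supported ℂ {p : σ × Fin n × Bool | p.1 = o})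
    (α β : σ → Bool ⊕ (Fin n × Bool)) :
    T (rho o i j * (c * ∏ s ∈ U, eigenForm o i j s (α s) * eigenForm o i j s (β s))) = 0 := by
  set Q := ∏ s ∈ U, eigenForm o i j s (α s) * eigenForm o i j s (β s) with hQ
  set k := ∑ s ∈ U, (formWt (α s) + formWt (β s)) with hk
  have hrot : rot o i j (c * Q) = k • (rho o i j * (c * Q)) := by
    have hD := Derivation.apply_prod_eigen (rot o i j) (rho o i j) U
      (fun s => eigenForm o i j s (α s) * eigenForm o i j s (β s))
      (fun s => formWt (α s) + formWt (β s)) fun s => by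
        rw [Derivation.leibniz, rot_eigenForm o hij, rot_eigenForm o hij]
        simp only [smul_eq_mul, zsmul_eq_mul]
        push_cast
        ring
    rw [← hQ, ← hk] at hD
    rw [Derivation.leibniz, hD, rot_of_supported o i j hc]
    simp only [smul_eq_mul, zsmul_eq_mul]
    ring
  have h1 := hT.apply_rot o hij (c * Q)
  rw [hrot, map_zsmul, zsmul_eq_mul] at h1
  by_cases hkl : k = -l
  · have hmem : Q ∈ annIdeal T := by
      rcases le_abs.1 hl with h | h
      · refine hT.prod_mem o hU (.inr rfl) α β ?_
        simp only [← mul_add, ← Finset.mul_sum]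
        rw [← hk, hkl]; linarith
      · refine hT.prod_mem o hU (.inl rfl) α β ?_
        simp only [← mul_add, ← Finset.mul_sum]
        rw [← hk, hkl]; linarith
    rw [← mul_assoc]
    exact hmem _
  · have h2 : ((k + l : ℤ) : ℂ) * T (rho o i j * (c * Q)) = 0 := by
      push_cast
      linear_combination h1
    refine (mul_eq_zero.1 h2).resolve_left fun h0 => hkl ?_
    have := Int.cast_eq_zero.1 h0
    omega

lemma IsSlotFun.apply_mul_eq_zero_of_quadratic {s : σ} (hs : s ≠ o) {U : Finset σ} (hU : o ∉ U)
    {Q : SlotPoly σ n} (hQ : Q ∈ MvPolynomial.supported ℂ {p : σ × Fin n × Bool | p.1 ≠ s})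
    (h : ∀ c ∈ MvPolynomial.supported ℂ {p : σ × Fin n × Bool | p.1 ≠ s ∧ p.1 ∉ U}, ∀ d e,
      T (c * ((MvPolynomial.X (s, d) - MvPolynomial.X (o, d)) *
        (MvPolynomial.X (s, e) - MvPolynomial.X (o, e))) * Q) = 0) :
    ∀ c ∈ MvPolynomial.supported ℂ {p : σ × Fin n × Bool | p.1 ∉ U}, T (c * Q) = 0 := by
  set A := MvPolynomial.supported ℂ {p : σ × Fin n × Bool | p.1 ≠ s ∧ p.1 ∉ U} with hA
  have hAs : A ≤ MvPolynomial.supported ℂ {p : σ × Fin n × Bool | p.1 ≠ s} :=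
    MvPolynomial.supported_mono fun p hp => hp.1
  have hXo : ∀ d, (MvPolynomial.X (o, d) : SlotPoly σ n) ∈ A := fun d =>
    Algebra.subset_adjoin ⟨_, ⟨hs.symm, hU⟩, rfl⟩
  set y : Fin n × Bool → SlotPoly σ n := fun d => MvPolynomial.X (s, d) - MvPolynomial.X (o, d)
    with hy
  have c0 : ∀ c ∈ A, T (c * Q) = 0 := by
    intro c hc
    have hcQ := Subalgebra.mul_mem _ (hAs hc) hQ
    have e1 : T (c * Q * ∑ k, y (k, false) * y (k, true)) = 0 := by
      rw [Finset.mul_sum, map_sum]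
      refine Finset.sum_eq_zero fun k _ => ?_
      rw [mul_right_comm]
      exact h c hc _ _
    have e2 : c * Q * ∑ k, y (k, false) * y (k, true)
        = c * Q * (∑ k, MvPolynomial.X (s, k, false) * MvPolynomial.X (s, k, true))
        + c * Q * (∑ k, MvPolynomial.X (o, k, false) * MvPolynomial.X (o, k, true))
        - ∑ k, ((c * Q * MvPolynomial.X (o, k, true)) * MvPolynomial.X (s, k, false)
          + (c * Q * MvPolynomial.X (o, k, false)) * MvPolynomial.X (s, k, true)) := by
      simp only [hy, Finset.mul_sum, ← Finset.sum_add_distrib, ← Finset.sum_sub_distrib]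
      exact Finset.sum_congr rfl fun k _ => by ring
    rw [e2, map_sub, map_add, hT.sphere, hT.sphere, map_sum, Finset.sum_eq_zero, sub_zero,
      ← two_smul ℂ] at e1
    · exact (smul_eq_zero_iff_right two_ne_zero).1 e1
    · intro k _
      rw [map_add, hT.mul_X _ _ _ (Subalgebra.mul_mem _ hcQ (hAs (hXo _))),
        hT.mul_X _ _ _ (Subalgebra.mul_mem _ hcQ (hAs (hXo _))), add_zero]
  have c1 : ∀ c ∈ A, ∀ d, T (c * y d * Q) = 0 := by
    intro c hc d
    rw [show c * y d * Q = c * Q * MvPolynomial.X (s, d) - c * MvPolynomial.X (o, d) * Q by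
      simp only [hy]; ring, map_sub, hT.mul_X _ _ _ (Subalgebra.mul_mem _ (hAs hc) hQ),
      c0 _ (Subalgebra.mul_mem _ hc (hXo d)), sub_zero]
  have c3 : ∀ c d e f, T (c * (y d * y e * y f) * Q) = 0 := by
    intro c d e f
    rw [mul_right_comm]
    exact hT.cubic s o hs d e f _
  have hsupp : MvPolynomial.supported ℂ {p : σ × Fin n × Bool | p.1 ∉ U}
      ≤ Algebra.adjoin ℂ ((A : Set (SlotPoly σ n)) ∪ Set.range y) := by
    refine Algebra.adjoin_le ?_
    rintro _ ⟨⟨t, d⟩, ht, rfl⟩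
    rcases eq_or_ne t s with rfl | hts
    · have e : (MvPolynomial.X (t, d) : SlotPoly σ n) = y d + MvPolynomial.X (o, d) := by
        simp only [hy]; ring
      rw [e]
      exact Subalgebra.add_mem _ (Algebra.subset_adjoin (.inr ⟨d, rfl⟩))
        (Algebra.subset_adjoin (.inl (hXo d)))
    · exact Algebra.subset_adjoin (.inl (Algebra.subset_adjoin ⟨_, ⟨hts, ht⟩, rfl⟩))
  intro c hc
  have hc' := hsupp hc
  rw [← Subalgebra.mem_toSubmodule, Algebra.adjoin_eq_span] at hc'
  clear hc
  induction hc' using Submodule.span_induction with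
  | zero => rw [zero_mul, map_zero]
  | add x z _ _ hx hz => rw [add_mul, map_add, hx, hz, add_zero]
  | smul r x _ hx => rw [smul_mul_assoc, map_smul, hx, smul_zero]
  | mem x hx =>
    have key : x ∈ A ∨ (∃ c ∈ A, ∃ d, x = c * y d) ∨ (∃ c ∈ A, ∃ d e, x = c * (y d * y e)) ∨
        ∃ c d e f, x = c * (y d * y e * y f) := by
      induction hx using Submonoid.closure_induction_left with
      | one => exact .inl (Subalgebra.one_mem _)
      | mul_left a ha x _ ih =>
        rcases ha with ha | ⟨d, rfl⟩
        · rcases ih with ih | ⟨c, hc, d, rfl⟩ | ⟨c, hc, d, e, rfl⟩ | ⟨c, d, e, f, rfl⟩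
          · exact .inl (Subalgebra.mul_mem _ ha ih)
          · exact .inr (.inl ⟨a * c, Subalgebra.mul_mem _ ha hc, d, by ring⟩)
          · exact .inr (.inr (.inl ⟨a * c, Subalgebra.mul_mem _ ha hc, d, e, by ring⟩))
          · exact .inr (.inr (.inr ⟨a * c, d, e, f, by ring⟩))
        · rcases ih with ih | ⟨c, hc, e, rfl⟩ | ⟨c, hc, e, f, rfl⟩ | ⟨c, e, f, g, rfl⟩
          · exact .inr (.inl ⟨x, ih, d, by ring⟩)
          · exact .inr (.inr (.inl ⟨c, hc, d, e, by ring⟩))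
          · exact .inr (.inr (.inr ⟨c, d, e, f, by ring⟩))
          · exact .inr (.inr (.inr ⟨y d * c, e, f, g, by ring⟩))
    rcases key with h0 | ⟨c, hc, d, rfl⟩ | ⟨c, hc, d, e, rfl⟩ | ⟨c, d, e, f, rfl⟩
    exacts [c0 _ h0, c1 _ hc _, h _ hc _ _, c3 _ _ _ _]

omit hT in
lemma exists_rho_mul_eq (s : σ) (d : Fin n × Bool) :
    ∃ c ∈ MvPolynomial.supported ℂ {p : σ × Fin n × Bool | p.1 = o}, ∃ a b,
      rho o i j * (MvPolynomial.X (s, d) - MvPolynomial.X (o, d))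
        = eigenForm o i j s a + c * eigenForm o i j s b := by
  obtain ⟨k, _ | _⟩ := d
  · exact ⟨_, wp_mem o i j k, .inr (k, false), .inl false, by simp only [eigenForm]; ring⟩
  · exact ⟨_, zp_mem o i j k, .inr (k, true), .inl true, by simp only [eigenForm]; ring⟩

omit hT in
lemma eigenForm_mem (s : σ) (a : Bool ⊕ (Fin n × Bool)) :
    eigenForm o i j s a ∈ MvPolynomial.supported ℂ {p : σ × Fin n × Bool | p.1 = s ∨ p.1 = o} := by
  have h : ∀ d, (MvPolynomial.X (s, d) : SlotPoly σ n) ∈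
      MvPolynomial.supported ℂ {p : σ × Fin n × Bool | p.1 = s ∨ p.1 = o} := fun d =>
    Algebra.subset_adjoin ⟨_, .inl rfl, rfl⟩
  have h' : ∀ d, (MvPolynomial.X (o, d) : SlotPoly σ n) ∈
      MvPolynomial.supported ℂ {p : σ × Fin n × Bool | p.1 = s ∨ p.1 = o} := fun d =>
    Algebra.subset_adjoin ⟨_, .inr rfl, rfl⟩
  have hle : MvPolynomial.supported ℂ {p : σ × Fin n × Bool | p.1 = o} ≤
      MvPolynomial.supported ℂ {p : σ × Fin n × Bool | p.1 = s ∨ p.1 = o} :=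
    MvPolynomial.supported_mono fun p hp => .inr hp
  have hz : zeta o i j s ∈
      MvPolynomial.supported ℂ {p : σ × Fin n × Bool | p.1 = s ∨ p.1 = o} :=
    Subalgebra.sub_mem _ (Subalgebra.mul_mem _ (h' _) (h _)) (Subalgebra.mul_mem _ (h' _) (h _))
  have hw : zetaBar o i j s ∈
      MvPolynomial.supported ℂ {p : σ × Fin n × Bool | p.1 = s ∨ p.1 = o} :=
    Subalgebra.sub_mem _ (Subalgebra.mul_mem _ (h' _) (h _)) (Subalgebra.mul_mem _ (h' _) (h _))
  match a with
  | .inl false => exact hz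
  | .inl true => exact hw
  | .inr (k, false) =>
    exact Subalgebra.sub_mem _ (Subalgebra.mul_mem _ (hle (rho_mem o i j))
      (Subalgebra.sub_mem _ (h _) (h' _))) (Subalgebra.mul_mem _ (hle (wp_mem o i j k)) hz)
  | .inr (k, true) =>
    exact Subalgebra.sub_mem _ (Subalgebra.mul_mem _ (hle (rho_mem o i j))
      (Subalgebra.sub_mem _ (h _) (h' _))) (Subalgebra.mul_mem _ (hle (zp_mem o i j k)) hw)

include hij in
lemma IsSlotFun.apply_rho_pow_mul_prod [Fintype σ] [DecidableEq σ] (hl : 3 ≤ |l|) (k : ℕ) :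
    ∀ U : Finset σ, o ∉ U → (Finset.univ.erase o \ U).card = k →
    ∀ c ∈ MvPolynomial.supported ℂ {p : σ × Fin n × Bool | p.1 ∉ U}, ∀ α β : σ → Bool ⊕ (Fin n × Bool),
    T (c * (rho o i j ^ (1 + 2 * k) *
      ∏ s ∈ U, eigenForm o i j s (α s) * eigenForm o i j s (β s))) = 0 := by
  induction k with
  | zero =>
    intro U hU hk c hc α β
    rw [Finset.card_eq_zero, Finset.sdiff_eq_empty_iff_subset] at hk
    have := hT.apply_rho_mul_prod o hij hl hU (c := c)
      (MvPolynomial.supported_mono (fun p hp => by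
        by_contra hne
        exact hp (hk (Finset.mem_erase.2 ⟨hne, Finset.mem_univ _⟩))) hc) α β
    rw [← this]
    congr 1
    ring
  | succ k ih =>
    intro U hU hk c hc α β
    obtain ⟨s, hs⟩ : (Finset.univ.erase o \ U).Nonempty := by
      rw [← Finset.card_pos, hk]; omega
    rw [Finset.mem_sdiff, Finset.mem_erase] at hs
    have hU' : o ∉ insert s U := by
      rw [Finset.mem_insert, not_or]; exact ⟨hs.1.1.symm, hU⟩
    have hcard : (Finset.univ.erase o \ insert s U).card = k := by
      rw [Finset.sdiff_insert, Finset.card_erase_of_mem, hk]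
      · rfl
      · rw [Finset.mem_sdiff, Finset.mem_erase]; exact hs
    set Q := ∏ t ∈ U, eigenForm o i j t (α t) * eigenForm o i j t (β t) with hQ
    have hos : MvPolynomial.supported ℂ {p : σ × Fin n × Bool | p.1 = o}
        ≤ MvPolynomial.supported ℂ {p : σ × Fin n × Bool | p.1 ≠ s ∧ p.1 ∉ U} :=
      MvPolynomial.supported_mono fun p hp => by
        rw [mem_ofPred_eq] at hp ⊢
        rw [hp]; exact ⟨hs.1.1.symm, hU⟩
    have IH : ∀ c ∈ MvPolynomial.supported ℂ {p : σ × Fin n × Bool | p.1 ≠ s ∧ p.1 ∉ U}, ∀ a b,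
        T (c * (rho o i j ^ (1 + 2 * k) * (eigenForm o i j s a * eigenForm o i j s b * Q))) = 0 := by
      intro c hc a b
      have := ih _ hU' hcard c (MvPolynomial.supported_mono (fun p hp => by
        simpa [Finset.mem_insert] using hp) hc) (Function.update α s a) (Function.update β s b)
      have hprod : ∏ t ∈ U, eigenForm o i j t (Function.update α s a t) *
          eigenForm o i j t (Function.update β s b t) = Q := by
        refine Finset.prod_congr rfl fun t ht => ?_
        have hts : t ≠ s := by rintro rfl; exact hs.2 ht
        rw [Function.update_of_ne hts, Function.update_of_ne hts]
      rw [Finset.prod_insert hs.2, Function.update_self, Function.update_self, hprod] at this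
      exact this
    refine hT.apply_mul_eq_zero_of_quadratic o hs.1.1 hU ?_ ?_ c hc
    · have hos' : MvPolynomial.supported ℂ {p : σ × Fin n × Bool | p.1 = o}
        ≤ MvPolynomial.supported ℂ {p : σ × Fin n × Bool | p.1 ≠ s} :=
        hos.trans (MvPolynomial.supported_mono fun p hp => hp.1)
      refine Subalgebra.mul_mem _ (Subalgebra.pow_mem _ (hos' (rho_mem o i j)) _)
        (Subalgebra.prod_mem _ fun t ht => ?_)
      have hle : MvPolynomial.supported ℂ {p : σ × Fin n × Bool | p.1 = t ∨ p.1 = o}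
          ≤ MvPolynomial.supported ℂ {p : σ × Fin n × Bool | p.1 ≠ s} :=
        MvPolynomial.supported_mono fun p hp => by
          rw [mem_ofPred_eq] at hp ⊢
          rcases hp with hp | hp <;> rw [hp]
          · rintro rfl; exact hs.2 ht
          · exact hs.1.1.symm
      exact Subalgebra.mul_mem _ (hle (eigenForm_mem o t _)) (hle (eigenForm_mem o t _))
    · intro c hc d e
      obtain ⟨x, hx, a, b, hd⟩ := exists_rho_mul_eq (i := i) (j := j) o s d
      obtain ⟨x', hx', a', b', he⟩ := exists_rho_mul_eq (i := i) (j := j) o s e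
      rw [show c * ((MvPolynomial.X (s, d) - MvPolynomial.X (o, d)) *
        (MvPolynomial.X (s, e) - MvPolynomial.X (o, e))) * (rho o i j ^ (1 + 2 * (k + 1)) * Q)
        = c * (rho o i j ^ (1 + 2 * k) * (rho o i j * (MvPolynomial.X (s, d) - MvPolynomial.X (o, d)) *
        (rho o i j * (MvPolynomial.X (s, e) - MvPolynomial.X (o, e))) * Q)) by ring, hd, he]
      rw [show ∀ r A B C D : SlotPoly σ n, c * (r * ((A + x * B) * (C + x' * D) * Q))
        = c * (r * (A * C * Q)) + c * x' * (r * (A * D * Q)) + c * x * (r * (B * C * Q))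
          + c * x * x' * (r * (B * D * Q)) from fun r A B C D => by ring,
        map_add, map_add, map_add, IH c hc, IH _ (Subalgebra.mul_mem _ hc (hos hx')),
        IH _ (Subalgebra.mul_mem _ hc (hos hx)),
        IH _ (Subalgebra.mul_mem _ (Subalgebra.mul_mem _ hc (hos hx)) (hos hx'))]
      simp

/-- A functional with these properties vanishes if the weight is at least three. -/
theorem IsSlotFun.eq_zero [Finite σ] (o : σ) (hn : 2 ≤ n) (hl : 3 ≤ |l|) (P : SlotPoly σ n) :
    T P = 0 := by
  classical
  cases nonempty_fintype σ
  set J := (annIdeal T).radical with hJ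
  set r : Fin n → SlotPoly σ n := fun k => MvPolynomial.X (o, k, false) * MvPolynomial.X (o, k, true)
    with hr
  have h1 : ∀ i j, i ≠ j → r i + r j ∈ J := fun i j hij =>
    ⟨_, fun Q => by
      have := hT.apply_rho_pow_mul_prod o hij hl _ ∅ (by simp) rfl Q
        (by simp [MvPolynomial.supported_univ]) (fun _ => .inl false) (fun _ => .inl false)
      rw [Finset.prod_empty, mul_one] at this
      exact this⟩
  have h2 : ∑ k, r k - 1 ∈ J := Ideal.le_radical fun Q => by
    rw [mul_sub, mul_one, map_sub, hT.sphere, sub_self]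
  have h3 : ∑ i, ∑ j ∈ Finset.univ.erase i, (r i + r j) ∈ J :=
    Ideal.sum_mem _ fun i _ => Ideal.sum_mem _ fun j hj => h1 i j (Finset.mem_erase.1 hj).1.symm
  have h4 : ∑ i, ∑ j ∈ Finset.univ.erase i, (r i + r j)
      = ((2 * (n - 1) : ℕ) : SlotPoly σ n) * ∑ k, r k := by
    have : ∀ i, ∑ j ∈ Finset.univ.erase i, (r i + r j)
        = ((n - 1 : ℕ) : SlotPoly σ n) * r i + (∑ k, r k - r i) := by
      intro i
      rw [Finset.sum_add_distrib, Finset.sum_const, Finset.card_erase_of_mem (Finset.mem_univ _),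
        Finset.sum_erase_eq_sub (Finset.mem_univ _), Finset.card_univ, Fintype.card_fin,
        nsmul_eq_mul]
    simp only [this, Finset.sum_add_distrib, ← Finset.mul_sum, Finset.sum_sub_distrib,
      Finset.sum_const, Finset.card_univ, Fintype.card_fin, nsmul_eq_mul]
    push_cast [Nat.cast_sub (by omega : 1 ≤ n)]
    ring
  have h5 : (1 : SlotPoly σ n) ∈ J := by
    have h6 := mem_of_natCast_mul_mem (by omega : 2 * (n - 1) ≠ 0) (h4 ▸ h3)
    have := J.sub_mem h6 h2
    rwa [sub_sub_cancel] at this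
  obtain ⟨m, hm⟩ := h5
  have := hm P
  rwa [one_pow, mul_one] at this

end SlotFun

lemma exists_polynomial_derivative_eq (r : Polynomial ℝ) : ∃ R, Polynomial.derivative R = r := by
  induction r using Polynomial.induction_on' with
  | add p q hp hq =>
    obtain ⟨P, rfl⟩ := hp
    obtain ⟨Q, rfl⟩ := hq
    exact ⟨P + Q, Polynomial.derivative_add⟩
  | monomial k a =>
    refine ⟨Polynomial.monomial (k + 1) (a / (k + 1)), ?_⟩
    rw [Polynomial.derivative_monomial, Nat.add_sub_cancel]
    congr 1
    push_cast
    field_simp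

lemma exists_polynomial_quad {a b : ℝ} (hab : a ≤ b) {g g' g'' : ℝ → ℝ}
    (h1 : ∀ x ∈ Icc a b, HasDerivWithinAt g (g' x) (Icc a b) x)
    (h2 : ∀ x ∈ Icc a b, HasDerivWithinAt g' (g'' x) (Icc a b) x)
    (h3 : ContinuousOn g'' (Icc a b)) {η : ℝ} (hη : 0 < η) :
    ∃ q : Polynomial ℝ, Quad (Icc a b) (fun x => g x - q.eval x) η := by
  set M := 1 + (b - a) + (b - a) ^ 2 with hM
  have hba : 0 ≤ b - a := sub_nonneg.2 hab
  have hMpos : 0 < M := by positivity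
  set δ := η / M with hδ
  have hδ0 : 0 < δ := by positivity
  have hδM : δ * M = η := by rw [hδ]; field_simp
  obtain ⟨r, hr⟩ := exists_polynomial_near_of_continuousOn a b g'' h3 δ hδ0
  obtain ⟨R, hR⟩ := exists_polynomial_derivative_eq r
  set R₁ := R + Polynomial.C (g' a - R.eval a) with hR₁
  obtain ⟨Q, hQ⟩ := exists_polynomial_derivative_eq R₁
  set Q₁ := Q + Polynomial.C (g a - Q.eval a) with hQ₁
  have d1 : ∀ x ∈ Icc a b, HasDerivWithinAt (fun x => g x - Q₁.eval x) (g' x - R₁.eval x)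
      (Icc a b) x := fun x hx => by
    have := Q₁.hasDerivAt x
    rw [hQ₁, Polynomial.derivative_add, Polynomial.derivative_C, add_zero, hQ] at this
    exact (h1 x hx).sub this.hasDerivWithinAt
  have d2 : ∀ x ∈ Icc a b, HasDerivWithinAt (fun x => g' x - R₁.eval x) (g'' x - r.eval x)
      (Icc a b) x := fun x hx => by
    have := R₁.hasDerivAt x
    rw [hR₁, Polynomial.derivative_add, Polynomial.derivative_C, add_zero, hR] at this
    exact (h2 x hx).sub this.hasDerivWithinAt
  have b2 : ∀ x ∈ Icc a b, |g'' x - r.eval x| ≤ δ := fun x hx => by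
    rw [abs_sub_comm]; exact (hr x hx).le
  have ha : a ∈ Icc a b := left_mem_Icc.2 hab
  have b1 : ∀ x ∈ Icc a b, |g' x - R₁.eval x| ≤ δ * (b - a) := fun x hx => by
    have := (convex_Icc a b).norm_image_sub_le_of_norm_hasDerivWithin_le d2 b2 ha hx
    simp only [hR₁, Polynomial.eval_add, Polynomial.eval_C] at this ⊢
    rw [Real.norm_eq_abs, Real.norm_eq_abs, add_sub_cancel, sub_self, sub_zero] at this
    refine this.trans ?_
    gcongr
    rw [abs_of_nonneg (sub_nonneg.2 hx.1)]
    linarith [hx.2]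
  have b0 : ∀ x ∈ Icc a b, |g x - Q₁.eval x| ≤ δ * (b - a) * (b - a) := fun x hx => by
    have := (convex_Icc a b).norm_image_sub_le_of_norm_hasDerivWithin_le d1 b1 ha hx
    simp only [hQ₁, Polynomial.eval_add, Polynomial.eval_C] at this ⊢
    rw [Real.norm_eq_abs, Real.norm_eq_abs, add_sub_cancel, sub_self, sub_zero] at this
    refine this.trans ?_
    gcongr
    rw [abs_of_nonneg (sub_nonneg.2 hx.1)]
    linarith [hx.2]
  refine ⟨Q₁, hη.le, fun x hx => (b0 x hx).trans ?_, fun x hx =>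
    ⟨g' x - R₁.eval x, (b1 x hx).trans ?_, fun y hy =>
      (taylor_bound (convex_Icc a b) d1 d2 b2 hx hy).trans ?_⟩⟩
  · rw [← hδM, hM]; nlinarith [mul_nonneg hδ0.le hba, hδ0]
  · rw [← hδM, hM]; nlinarith [mul_nonneg hδ0.le (sq_nonneg (b - a)), hδ0]
  · gcongr
    rw [← hδM, hM]; nlinarith [mul_nonneg hδ0.le (sq_nonneg (b - a)), mul_nonneg hδ0.le hba]

section Poly
variable {E : Type*} [NormedAddCommGroup E] [InnerProductSpace ℝ E]

variable (E) in
/-- Polynomial functions on `E`. -/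
def polyFun : Subalgebra ℝ (E → ℝ) := Algebra.adjoin ℝ (range fun (x : E) (u : E) => ⟪x, u⟫)

lemma inner_mem_polyFun (x : E) : (fun u => ⟪x, u⟫) ∈ polyFun E :=
  Algebra.subset_adjoin ⟨x, rfl⟩

lemma exists_C11_of_mem_polyFun {P : E → ℝ} (hP : P ∈ polyFun E) : ∃ c, C11 P c := by
  induction hP using Algebra.adjoin_induction with
  | mem x hx => obtain ⟨x, rfl⟩ := hx; exact ⟨_, C11.inner x⟩
  | algebraMap r => exact ⟨_, C11.const r⟩
  | add x y _ _ hx hy => exact ⟨_, hx.choose_spec.add hy.choose_spec⟩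
  | mul x y _ _ hx hy => exact ⟨_, hx.choose_spec.mul hy.choose_spec⟩

/-- Functions which can be approximated by polynomials up to second order on the sphere. -/
def PolyApprox (ψ : E → ℝ) : Prop := ∀ η > 0, ∃ P ∈ polyFun E, C11 (fun u => ψ u - P u) η

lemma C11.zero {η : ℝ} (hη : 0 ≤ η) : C11 (fun _ : E => (0 : ℝ)) η := by
  simpa using (C11.const (E := E) 0).mono (by simpa using hη)

lemma polyApprox_of_mem {P : E → ℝ} (hP : P ∈ polyFun E) : PolyApprox P := fun _ hη =>
  ⟨P, hP, (C11.zero hη.le).congr fun _ _ => sub_self _⟩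

lemma PolyApprox.exists_C11 {ψ : E → ℝ} (h : PolyApprox ψ) : ∃ c, C11 ψ c := by
  obtain ⟨P, hP, hc⟩ := h 1 one_pos
  obtain ⟨c, hP'⟩ := exists_C11_of_mem_polyFun hP
  exact ⟨_, (hc.add hP').congr fun u _ => by ring⟩

lemma PolyApprox.add {ψ φ : E → ℝ} (h : PolyApprox ψ) (k : PolyApprox φ) :
    PolyApprox fun u => ψ u + φ u := fun η hη => by
  obtain ⟨P, hP, hc⟩ := h (η / 2) (by positivity)
  obtain ⟨Q, hQ, hd⟩ := k (η / 2) (by positivity)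
  exact ⟨P + Q, Subalgebra.add_mem _ hP hQ, ((hc.add hd).mono (by linarith)).congr fun u _ => by
    rw [Pi.add_apply]; ring⟩

lemma PolyApprox.mul {ψ φ : E → ℝ} (h : PolyApprox ψ) (k : PolyApprox φ) :
    PolyApprox fun u => ψ u * φ u := fun η hη => by
  obtain ⟨c, hc⟩ := h.exists_C11
  obtain ⟨d, hd⟩ := k.exists_C11
  have := hc.nonneg
  have := hd.nonneg
  set δ := min 1 (η / (11 * (c + d + 1))) with hδ
  have hδ0 : 0 < δ := by positivity
  have hδ1 : δ ≤ 1 := min_le_left _ _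
  have hδ2 : δ * (11 * (c + d + 1)) ≤ η := by
    rw [← le_div_iff₀ (by positivity)]; exact min_le_right _ _
  obtain ⟨P, hP, hc'⟩ := h δ hδ0
  obtain ⟨Q, hQ, hd'⟩ := k δ hδ0
  refine ⟨P * Q, Subalgebra.mul_mem _ hP hQ,
    ((((hc'.mul hd).add (hc.mul hd')).sub (hc'.mul hd')).mono ?_).congr fun u _ => by
      rw [Pi.mul_apply]; ring⟩
  nlinarith

lemma PolyApprox.const (a : ℝ) : PolyApprox fun _ : E => a :=
  polyApprox_of_mem (Subalgebra.algebraMap_mem (polyFun E) a)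

lemma PolyApprox.eval {ψ : E → ℝ} (h : PolyApprox ψ) (q : Polynomial ℝ) :
    PolyApprox fun u => q.eval (ψ u) := by
  induction q using Polynomial.induction_on' with
  | add p q hp hq => simpa only [Polynomial.eval_add] using hp.add hq
  | monomial k a =>
    simp only [Polynomial.eval_monomial]
    refine (PolyApprox.const a).mul ?_
    induction k with
    | zero => simpa only [pow_zero] using PolyApprox.const 1
    | succ k ih => simpa only [pow_succ] using ih.mul h

lemma PolyApprox.sum {ι : Type*} (s : Finset ι) {ψ : ι → E → ℝ} (h : ∀ i ∈ s, PolyApprox (ψ i)) :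
    PolyApprox fun u => ∑ i ∈ s, ψ i u := by
  classical
  induction s using Finset.induction_on with
  | empty => simpa using PolyApprox.const 0
  | insert a s ha ih =>
    simp only [Finset.sum_insert ha]
    exact (h a (by simp)).add (ih fun i hi => h i (by simp [hi]))

lemma PolyApprox.comp {ψ : E → ℝ} (h : PolyApprox ψ) {a b : ℝ} (hab : a ≤ b)
    (hψ : ∀ u, ‖u‖ = 1 → ψ u ∈ Icc a b) {g g' g'' : ℝ → ℝ}
    (h1 : ∀ x ∈ Icc a b, HasDerivAt g (g' x) x)
    (h2 : ∀ x ∈ Icc a b, HasDerivAt g' (g'' x) x)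
    (h3 : ContinuousOn g'' (Icc a b)) : PolyApprox fun u => g (ψ u) := fun η hη => by
  obtain ⟨c, hc⟩ := h.exists_C11
  have := hc.nonneg
  obtain ⟨q, hq⟩ := exists_polynomial_quad hab (fun x hx => (h1 x hx).hasDerivWithinAt)
    (fun x hx => (h2 x hx).hasDerivWithinAt) h3
    (η := η / 2 / (1 + 3 * c) ^ 2) (by positivity)
  obtain ⟨P, hP, hP'⟩ := h.eval q (η / 2) (by positivity)
  refine ⟨P, hP, (((hc.comp hq hψ).add hP').mono ?_).congr fun u _ => by ring⟩
  rw [div_mul_cancel₀ _ (by positivity)]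
  linarith

end Poly

section LogSumExp
variable {ι : Type*} (s : Finset ι)

lemma log_sum_exp_tangent (hs : s.Nonempty) (a b : ι → ℝ) :
    Real.log (∑ i ∈ s, Real.exp (b i)) +
      ∑ i ∈ s, Real.exp (b i) / (∑ j ∈ s, Real.exp (b j)) * (a i - b i)
      ≤ Real.log (∑ i ∈ s, Real.exp (a i)) := by
  set S := ∑ j ∈ s, Real.exp (b j) with hS
  have hS0 : 0 < S := Finset.sum_pos (fun i _ => Real.exp_pos _) hs
  set t := ∑ i ∈ s, Real.exp (b i) / S * (a i - b i) with ht
  have hsum : ∑ i ∈ s, Real.exp (b i) / S = 1 := by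
    rw [← Finset.sum_div, ← hS, div_self hS0.ne']
  rw [Real.le_log_iff_exp_le (Finset.sum_pos (fun i _ => Real.exp_pos _) hs), Real.exp_add,
    Real.exp_log hS0]
  have h1 : ∑ i ∈ s, Real.exp (b i) / S * (1 + (a i - b i - t))
      ≤ ∑ i ∈ s, Real.exp (b i) / S * Real.exp (a i - b i - t) :=
    Finset.sum_le_sum fun i _ => mul_le_mul_of_nonneg_left
      (by linarith [Real.add_one_le_exp (a i - b i - t)]) (by positivity)
  have h2 : ∑ i ∈ s, Real.exp (b i) / S * (1 + (a i - b i - t)) = 1 := by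
    have : ∀ i, Real.exp (b i) / S * (1 + (a i - b i - t))
        = Real.exp (b i) / S * (a i - b i) + Real.exp (b i) / S * (1 - t) := fun i => by ring
    simp only [this, Finset.sum_add_distrib, ← Finset.sum_mul]
    rw [hsum, ← ht]; ring
  have h3 : ∑ i ∈ s, Real.exp (b i) / S * Real.exp (a i - b i - t)
      = (∑ i ∈ s, Real.exp (a i)) / (S * Real.exp t) := by
    rw [Finset.sum_div]
    refine Finset.sum_congr rfl fun i _ => ?_
    rw [Real.exp_sub, Real.exp_sub]
    field_simp
  rw [h2, h3, le_div_iff₀ (by positivity), one_mul] at h1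
  exact h1

end LogSumExp

section Density
variable {E : Type*} [NormedAddCommGroup E] [InnerProductSpace ℝ E]

/-- The rescaled logarithm of a sum of exponentials, a smooth approximation of the maximum. -/
def softMax (s : Finset E) (m : ℝ) (u : E) : ℝ :=
  m⁻¹ * Real.log (∑ x ∈ s, Real.exp (m * ⟪x, u⟫))

variable {s : Finset E} {m : ℝ}

lemma inner_le_softMax (hm : 0 < m) {x : E} (hx : x ∈ s) (u : E) : ⟪x, u⟫ ≤ softMax s m u := by
  rw [softMax, le_inv_mul_iff₀ hm, Real.le_log_iff_exp_le
    (Finset.sum_pos (fun i _ => Real.exp_pos _) ⟨x, hx⟩)]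
  exact Finset.single_le_sum (f := fun x => Real.exp (m * ⟪x, u⟫)) (fun i _ => (Real.exp_pos _).le) hx

lemma softMax_le (hs : s.Nonempty) (hm : 0 < m) {u : E} {c : ℝ} (h : ∀ x ∈ s, ⟪x, u⟫ ≤ c) :
    softMax s m u ≤ c + m⁻¹ * Real.log s.card := by
  have h1 : ∑ x ∈ s, Real.exp (m * ⟪x, u⟫) ≤ s.card * Real.exp (m * c) := by
    rw [← nsmul_eq_mul]
    refine Finset.sum_le_card_nsmul _ _ _ fun x hx => ?_
    gcongr
    exact h x hx
  have hc : (0 : ℝ) < s.card := by exact_mod_cast hs.card_pos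
  have h2 := Real.log_le_log (Finset.sum_pos (fun i _ => Real.exp_pos _) hs) h1
  rw [Real.log_mul hc.ne' (Real.exp_ne_zero _), Real.log_exp] at h2
  rw [softMax]
  calc m⁻¹ * _ ≤ m⁻¹ * (Real.log s.card + m * c) := by gcongr
    _ = _ := by field_simp; ring

lemma linSupp_softMax (hs : s.Nonempty) (hm : 0 < m) : LinSupp (softMax s m) := by
  intro u₀ hu₀
  set S := ∑ x ∈ s, Real.exp (m * ⟪x, u₀⟫) with hS
  have hS0 : 0 < S := Finset.sum_pos (fun i _ => Real.exp_pos _) hs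
  set p : E := ∑ x ∈ s, (Real.exp (m * ⟪x, u₀⟫) / S) • x with hp
  have hpu : ∀ u, ⟪p, u⟫ = ∑ x ∈ s, Real.exp (m * ⟪x, u₀⟫) / S * ⟪x, u⟫ := fun u => by
    rw [hp, sum_inner]
    exact Finset.sum_congr rfl fun x _ => real_inner_smul_left _ _ _
  set c := softMax s m u₀ - ⟪p, u₀⟫ with hc
  have hc0 : 0 ≤ c := by
    rw [hc, sub_nonneg, hpu]
    calc _ ≤ ∑ x ∈ s, Real.exp (m * ⟪x, u₀⟫) / S * softMax s m u₀ :=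
          Finset.sum_le_sum fun x hx => mul_le_mul_of_nonneg_left (inner_le_softMax hm hx u₀)
            (by positivity)
      _ = softMax s m u₀ := by
          rw [← Finset.sum_mul, ← Finset.sum_div, ← hS, div_self hS0.ne', one_mul]
  have hconv : ∀ u, softMax s m u₀ + (⟪p, u⟫ - ⟪p, u₀⟫) ≤ softMax s m u := by
    intro u
    have h := log_sum_exp_tangent s hs (fun x => m * ⟪x, u⟫) (fun x => m * ⟪x, u₀⟫)
    have e : ∑ x ∈ s, Real.exp (m * ⟪x, u₀⟫) / S * (m * ⟪x, u⟫ - m * ⟪x, u₀⟫)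
        = m * (⟪p, u⟫ - ⟪p, u₀⟫) := by
      rw [hpu, hpu, mul_sub, Finset.mul_sum, Finset.mul_sum, ← Finset.sum_sub_distrib]
      exact Finset.sum_congr rfl fun x _ => by ring
    rw [← hS, e] at h
    rw [softMax, softMax, ← hS, ← mul_le_mul_iff_right₀ hm]
    rw [mul_add, ← mul_assoc, ← mul_assoc, mul_inv_cancel₀ hm.ne', one_mul, one_mul]
    exact h
  have huu : ⟪u₀, u₀⟫ = (1 : ℝ) := by rw [real_inner_self_eq_norm_sq, hu₀, one_pow]
  refine ⟨p + c • u₀, ?_, fun u hu => ?_⟩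
  · rw [inner_add_left, real_inner_smul_left, huu, hc]; ring
  · rw [inner_add_left, real_inner_smul_left]
    have h1 : ⟪u₀, u⟫ ≤ 1 := by
      have := real_inner_le_norm u₀ u
      rwa [hu₀, hu, one_mul] at this
    have h2 := hconv u
    have h3 : c * ⟪u₀, u⟫ ≤ c := mul_le_of_le_one_right hc0 h1
    linarith

lemma polyApprox_softMax (hs : s.Nonempty) (hm : 0 < m) : PolyApprox (softMax s m) := by
  obtain ⟨R, hR⟩ : ∃ R : ℝ, ∀ x ∈ s, ‖x‖ ≤ R := by
    obtain ⟨R, hR⟩ := (s.finite_toSet.image norm).bddAbove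
    exact ⟨R, fun x hx => hR ⟨x, hx, rfl⟩⟩
  have hin : ∀ x ∈ s, ∀ u : E, ‖u‖ = 1 → m * ⟪x, u⟫ ∈ Icc (-(m * R)) (m * R) := by
    intro x hx u hu
    have h1 := abs_real_inner_le_norm x u
    rw [hu, mul_one] at h1
    rw [mem_Icc, ← abs_le, abs_mul, abs_of_pos hm]
    exact mul_le_mul_of_nonneg_left (h1.trans (hR x hx)) hm.le
  have hR0 : 0 ≤ R := by
    obtain ⟨x, hx⟩ := hs
    exact (norm_nonneg x).trans (hR x hx)
  have hexp : PolyApprox fun u : E => ∑ x ∈ s, Real.exp (m * ⟪x, u⟫) := by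
    refine PolyApprox.sum s fun x hx => ?_
    refine ((PolyApprox.const m).mul (polyApprox_of_mem (inner_mem_polyFun x))).comp
      (g := Real.exp) (g' := Real.exp) (g'' := Real.exp)
      (a := -(m * R)) (b := m * R) (by linarith [mul_nonneg hm.le hR0]) (hin x hx)
      (fun x _ => Real.hasDerivAt_exp x) (fun x _ => Real.hasDerivAt_exp x)
      Real.continuous_exp.continuousOn
  have hc : (0 : ℝ) < s.card := by exact_mod_cast hs.card_pos
  set a := s.card * Real.exp (-(m * R)) with ha
  set b := s.card * Real.exp (m * R) with hb
  have ha0 : 0 < a := by positivity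
  have hpos : ∀ x ∈ Icc a b, x ≠ 0 := fun x hx => (ha0.trans_le hx.1).ne'
  refine (PolyApprox.const m⁻¹).mul (hexp.comp (g := Real.log) (g' := fun x => x⁻¹)
    (g'' := fun x => -(x ^ 2)⁻¹) (a := a) (b := b) ?_ (fun u hu => ⟨?_, ?_⟩)
    (fun x hx => Real.hasDerivAt_log (hpos x hx)) (fun x hx => hasDerivAt_inv (hpos x hx)) ?_)
  · rw [ha, hb]
    gcongr
    linarith [mul_nonneg hm.le hR0]
  · rw [ha, ← nsmul_eq_mul]
    refine Finset.card_nsmul_le_sum _ _ _ fun x hx => ?_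
    exact Real.exp_le_exp.2 (hin x hx u hu).1
  · rw [hb, ← nsmul_eq_mul]
    refine Finset.sum_le_card_nsmul _ _ _ fun x hx => ?_
    exact Real.exp_le_exp.2 (hin x hx u hu).2
  · exact ((continuousOn_id.pow 2).inv₀ fun x hx => pow_ne_zero 2 (hpos x hx)).neg

variable [FiniteDimensional ℝ E]

/-- Bodies whose support function is polynomial on the sphere are dense. -/
lemma exists_polyFun_dist_le (K : ConvexBody E) {ε : ℝ} (hε : 0 < ε) :
    ∃ L : ConvexBody E, dist K L ≤ ε ∧ ∃ P ∈ polyFun E, ∀ u, ‖u‖ = 1 → supp L u = P u := by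
  obtain ⟨s, hs, K', hK', -, hd⟩ := exists_polytope_dist_le K (half_pos hε)
  have hc : (1 : ℝ) ≤ s.card := by exact_mod_cast hs.card_pos
  have hlog : 0 ≤ Real.log s.card := Real.log_nonneg hc
  set m := 4 * (Real.log s.card + 1) / ε with hm
  have hm0 : 0 < m := by positivity
  have hml : m⁻¹ * Real.log s.card ≤ ε / 4 := by
    rw [hm, inv_div, div_mul_eq_mul_div, div_le_div_iff₀ (by positivity) (by positivity)]
    nlinarith
  have hlow : ∀ u, supp K' u ≤ softMax s m u := fun u => supp_le fun x hx => by
    have hx' : x ∈ convexHull ℝ (s : Set E) := hK' ▸ hx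
    have : convexHull ℝ (s : Set E) ⊆ {x | ⟪x, u⟫ ≤ softMax s m u} :=
      convexHull_min (fun y hy => inner_le_softMax hm0 hy u)
        (convex_halfSpace_le ⟨fun a b => inner_add_left a b u,
          fun a b => real_inner_smul_left b u a⟩ _)
    exact this hx'
  have hup : ∀ u, softMax s m u ≤ supp K' u + ε / 4 := fun u =>
    (softMax_le hs hm0 fun x hx => inner_le_supp
      (show x ∈ (K' : Set E) from hK' ▸ subset_convexHull ℝ _ hx) u).trans (by linarith)
  obtain ⟨P, hP, hPc⟩ := polyApprox_softMax hs hm0 (ε / 40) (by positivity)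
  have hb : ∀ u, ‖u‖ = 1 → |softMax s m u - P u| ≤ ε / 40 := hPc.bound
  have hlin : LinSupp fun u => P u + 4 * (ε / 40) := by
    have := (linSupp_softMax hs hm0).add_C11 hPc.neg
    have e : (fun u => softMax s m u + -(softMax s m u - P u) + 4 * (ε / 40))
        = fun u => P u + 4 * (ε / 40) := by
      funext u; ring
    rwa [e] at this
  obtain ⟨c, hc⟩ := exists_C11_of_mem_polyFun hP
  obtain ⟨L, hL⟩ := hlin.exists_body (C := c + 4 * (ε / 40)) fun u hu => by
    have := (abs_le.1 (hc.bound u hu)).2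
    linarith
  refine ⟨L, ?_, P + algebraMap ℝ (E → ℝ) (4 * (ε / 40)),
    Subalgebra.add_mem _ hP (Subalgebra.algebraMap_mem _ _), fun u hu => hL u hu⟩
  have hKL : dist K' L ≤ ε / 2 := dist_le_of_supp (by positivity) fun u hu => by
    rw [hL u hu, abs_le]
    have h1 := abs_le.1 (hb u hu)
    have h2 := hlow u
    have h3 := hup u
    constructor <;> linarith
  linarith [dist_triangle K K' L]

end Density

section Assembly
variable {n : ℕ}

lemma polySlot_prod_rename {σ A B V : Type*} [Fintype σ] [DecidableEq σ] [CommRing A]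
    [Algebra ℂ A] [CommRing B] [Algebra ℂ B] (c : A →ₗ[ℂ] B) (v : V → A) (Q : MvPolynomial V ℂ) :
    polySlot c v (∏ s : σ, MvPolynomial.rename (Prod.mk s) Q)
      = c (MvPolynomial.aeval v Q) ^ Fintype.card σ := by
  have h1 : ∀ s : σ, slotEval v (MvPolynomial.rename (Prod.mk s) Q)
      = slot s (MvPolynomial.aeval v Q) := by
    intro s
    have : (slotEval v).comp (MvPolynomial.rename (Prod.mk s))
        = (slot s).comp (MvPolynomial.aeval v) := by
      ext d
      simp
    exact DFunLike.congr_fun this Q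
  have h2 : ∀ (a : A) (t : Finset σ), ∏ s ∈ t, slot s a
      = PiTensorProduct.tprod ℂ (fun s : σ => if s ∈ t then a else 1) := by
    intro a t
    induction t using Finset.induction_on with
    | empty => simp [PiTensorProduct.one_def]; rfl
    | insert s t hs ih =>
      rw [Finset.prod_insert hs, ih, mul_comm, tprod_mul_slot]
      congr 1
      ext r
      rcases eq_or_ne r s with rfl | h
      · simp [hs]
      · simp [h]
  rw [polySlot_apply, map_prod, Finset.prod_congr rfl fun s _ => h1 s, h2, slotMap_tprod]
  simp

/-- Real polynomial functions on the sphere are polynomials in the complex coordinates. -/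
lemma exists_aeval_cv {P : Cn n → ℝ} (hP : P ∈ polyFun (Cn n)) :
    ∃ Q : MvPolynomial (Fin n × Bool) ℂ, ∀ u : sphere (0 : Cn n) 1,
      (MvPolynomial.aeval (cv n) Q : sphere (0 : Cn n) 1 → ℂ) u = P u := by
  induction hP using Algebra.adjoin_induction with
  | mem x hx =>
    obtain ⟨x, rfl⟩ := hx
    refine ⟨∑ i, ((star (x i) / 2) • MvPolynomial.X (i, false) +
      (x i / 2) • MvPolynomial.X (i, true)), fun u => ?_⟩
    simp only [map_sum, map_add, map_smul, MvPolynomial.aeval_X, Subalgebra.coe_add,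
      Subalgebra.coe_smul, AddSubmonoidClass.coe_finsetSum, Finset.sum_apply, Pi.add_apply,
      Pi.smul_apply, smul_eq_mul, cv_false, cv_true]
    rw [PiLp.inner_apply, Complex.ofReal_sum]
    refine Finset.sum_congr rfl fun i _ => ?_
    simp only [Complex.inner]
    apply Complex.ext <;> simp <;> ring
  | algebraMap r =>
    refine ⟨MvPolynomial.C (r : ℂ), fun u => ?_⟩
    simp
  | add x y _ _ hx hy =>
    obtain ⟨Q, hQ⟩ := hx
    obtain ⟨R, hR⟩ := hy
    exact ⟨Q + R, fun u => by simp [hQ, hR]⟩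
  | mul x y _ _ hx hy =>
    obtain ⟨Q, hQ⟩ := hx
    obtain ⟨R, hR⟩ := hy
    exact ⟨Q * R, fun u => by simp [hQ, hR]⟩

variable {μ : ConvexBody (Cn n) → ℂ} {l : ℤ}

lemma isSlotFun_slotFun {σ : Type*} [Fintype σ] [DecidableEq σ] (hμ : IsVal μ)
    (hl : HasWeight l μ) : IsSlotFun l (slotFun σ hμ) where
  gen i j P := slotFun_gen hμ hl i j P
  sphere P s := slotFun_sphere hμ P s
  mul_X s d _ hP := slotFun_mul_X hμ s d hP
  cubic _ _ hst d₁ d₂ d₃ P := slotFun_cubic hμ hst d₁ d₂ d₃ P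

lemma exists_norm_one_zpow_ne (hl : l ≠ 0) : ∃ c : ℂ, c * star c = 1 ∧ c ^ l ≠ 1 := by
  have hlr : (l : ℝ) ≠ 0 := by exact_mod_cast hl
  refine ⟨Complex.exp ((Real.pi / l : ℝ) * Complex.I), ?_, ?_⟩
  · have h := Complex.mul_conj (Complex.exp ((Real.pi / l : ℝ) * Complex.I))
    rw [Complex.normSq_eq_norm_sq, Complex.norm_exp_ofReal_mul_I] at h
    simpa using h
  · rw [← Complex.exp_int_mul]
    have : (l : ℂ) * ((Real.pi / l : ℝ) * Complex.I) = Real.pi * Complex.I := by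
      have : (l : ℂ) ≠ 0 := by exact_mod_cast hl
      push_cast
      field_simp
    rw [this, Complex.exp_pi_mul_I]
    norm_num

lemma apply_zero_of_hasWeight (hn : 0 < n) (hl : l ≠ 0) (h : HasWeight l μ) : μ 0 = 0 := by
  obtain ⟨c, hc, hcl⟩ := exists_norm_one_zpow_ne hl
  set v : Fin n → ℂ := Pi.single ⟨0, hn⟩ 1 with hv
  have hvv : star v ⬝ᵥ v = 1 := by simp [hv]
  have h1 : twist v c * star (twist v c) = 1 := by
    rw [star_twist, twist_mul hvv, hc, twist_one]
  have h2 : star (twist v c) * twist v c = 1 := by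
    rw [star_twist, twist_mul hvv, mul_comm, hc, twist_one]
  have h3 := h (twist v c) ⟨h2, h1⟩ 0 0 (by
    rw [ConvexBody.coe_zero, ← singleton_zero, image_singleton, map_zero])
  rw [det_twist hvv] at h3
  by_contra h0
  exact hcl (mul_right_cancel₀ h0 (by rw [one_mul]; exact h3.symm))

lemma eq_zero_of_supp_mem_polyFun (hμ : IsVal μ) (hw : HasWeight l μ) (hn : 2 ≤ n) (hl : 3 ≤ |l|)
    {K : ConvexBody (Cn n)} {P : Cn n → ℝ} (hP : P ∈ polyFun (Cn n))
    (h : ∀ u, ‖u‖ = 1 → supp K u = P u) : μ K = 0 := by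
  obtain ⟨Q, hQ⟩ := exists_aeval_cv hP
  have hC := exists_C11_of_mem_polyFun hP
  have hlg : lg K = cl (MvPolynomial.aeval (cv n) Q) := by
    have : MvPolynomial.aeval (cv n) Q = rc P hC := by
      ext u
      rw [hQ, rc_apply]
    rw [this, cl_rc, ← rlg_supp]
    exact rlg_congr h
  have hl0 : l ≠ 0 := by
    rintro rfl
    norm_num at hl
  rw [← ev_cls hμ K, cls_eq_sum_lg, map_sum]
  refine Finset.sum_eq_zero fun j _ => ?_
  rw [map_smul]
  rcases j with _ | j
  · rw [pow_zero, ← cls_zero, ev_cls, apply_zero_of_hasWeight (by omega) hl0 hw, smul_zero]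
  · have e := polySlot_prod_rename (σ := Fin (j + 1)) cl (cv n) Q
    rw [Fintype.card_fin] at e
    have e2 := (isSlotFun_slotFun (σ := Fin (j + 1)) hμ hw).eq_zero 0 hn hl
      (∏ s, MvPolynomial.rename (Prod.mk s) Q)
    rw [slotFun, LinearMap.comp_apply, e] at e2
    rw [hlg, e2, smul_zero]

lemma eq_zero_of_hasWeight (hμ : IsVal μ) (hw : HasWeight l μ) (hn : 2 ≤ n) (hl : 3 ≤ |l|)
    (K : ConvexBody (Cn n)) : μ K = 0 := by
  choose L hL P hP hLP using fun k : ℕ =>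
    exists_polyFun_dist_le K (Nat.one_div_pos_of_nat (α := ℝ) (n := k))
  have hlim : Tendsto L atTop (𝓝 K) := by
    rw [tendsto_iff_dist_tendsto_zero]
    refine squeeze_zero (fun _ => dist_nonneg) (fun k => ?_) tendsto_one_div_add_atTop_nhds_zero_nat
    rw [dist_comm]
    exact hL k
  refine tendsto_nhds_unique ((hμ.cont.tendsto K).comp hlim) ?_
  refine tendsto_const_nhds.congr fun k => ?_
  exact (eq_zero_of_supp_mem_polyFun hμ hw hn hl (hP k) (hLP k)).symm

end Assembly

end UVal

/-- For `|l| ≥ 3`, every continuous, translation invariant valuation on `ℂⁿ` of weight `l`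
is identically zero. -/
theorem weight_ge_three_valuation_zero (n : ℕ) (hn : 2 ≤ n) (l : ℤ) (hl : 3 ≤ |l|)
    (μ : ConvexBody (Cn n) → ℂ)
    (h1 : IsValuation μ) (h2 : Continuous μ) (h3 : TranslationInvariant μ)
    (h4 : HasWeight l μ) :
    ∀ K : ConvexBody (Cn n), μ K = 0 :=
  UVal.eq_zero_of_hasWeight ⟨h1, h2, h3⟩ h4 hn hl

end
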